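/- arXiv:1710.05079 — 2 statements merged into one kernel-verified Lean document; each statement's English description precedes it below -/
import Mathlib

section
/- The collection of closed subsets C of the space [ℕ]^ℕ of infinite subsets of ℕ such that the shift graph restricted to C has finite Borel chromatic number, viewed as a subset of the Effros Borel space F([ℕ]^ℕ), is Σ¹₂-complete. -/
open MeasureTheory Set

/-- The Baire space `ℕ^ℕ`. -/
abbrev NN : Type := ℕ → ℕ

/-- The space `[ℕ]^ℕ` of infinite subsets of `ℕ`, identified with their increasing
enumerations, with the topology inherited from `ℕ^ℕ`. -/
abbrev IncSeq : Type := {x : NN // StrictMono x}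

/-- The shift map `S(x) = x \ {min x}`. -/
def shift (x : IncSeq) : IncSeq :=
  ⟨fun n => x.1 (n + 1), fun _ _ h => x.2 (Nat.add_lt_add_right h 1)⟩

/-- The edge relation of the shift graph `G_S` on `[ℕ]^ℕ`. -/
def shiftEdge (x y : IncSeq) : Prop := x ≠ y ∧ (shift x = y ∨ shift y = x)

/-- `G_S|_B` admits a Borel coloring with `n` colors. -/
def BorelColoringLE (B : Set IncSeq) (n : ℕ) : Prop :=
  ∃ c : B → Fin n, Measurable c ∧ ∀ x y : B, shiftEdge x.1 y.1 → c x ≠ c y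

/-- Coanalytic (`Π¹₁`) subsets of a topological space. -/
def IsCoanalytic {X : Type} [TopologicalSpace X] (S : Set X) : Prop := AnalyticSet Sᶜ

/-- `Σ¹₂` subsets of a topological space: projections of coanalytic subsets of `X × ℕ^ℕ`. -/
def IsSigma12 {X : Type} [TopologicalSpace X] (A : Set X) : Prop :=
  ∃ C : Set (X × NN), IsCoanalytic C ∧ A = Prod.fst '' C

/-- `A` is `Σ¹₂`-hard: every `Σ¹₂` subset of a Polish space Borel-reduces to `A`. -/
def Sigma12Hard {X : Type} [MeasurableSpace X] (A : Set X) : Prop :=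
  ∀ (Z : Type) [TopologicalSpace Z] [PolishSpace Z] [MeasurableSpace Z] [BorelSpace Z],
    ∀ A' : Set Z, IsSigma12 A' → ∃ f : Z → X, Measurable f ∧ ∀ z, z ∈ A' ↔ f z ∈ A

/-- The Effros Borel space `F(X)` of closed subsets of `X`, with the σ-algebra generated
by the sets `{F | F ∩ U ≠ ∅}` for `U` open. -/
abbrev Effros (X : Type) [TopologicalSpace X] : Type := {F : Set X // IsClosed F}

instance {X : Type} [TopologicalSpace X] : MeasurableSpace (Effros X) :=
  MeasurableSpace.generateFrom
    {S | ∃ U : Set X, IsOpen U ∧ S = {F : Effros X | (F.1 ∩ U).Nonempty}}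

/-- Analytic subsets of a standard Borel (here: arbitrary measurable) space:
empty or the range of a Borel map from `ℕ^ℕ`. -/
def MAnalytic {Z : Type} [MeasurableSpace Z] (S : Set Z) : Prop :=
  S = ∅ ∨ ∃ g : NN → Z, Measurable g ∧ S = Set.range g

/-- `Σ¹₂` subsets of a standard Borel space: projections of coanalytic subsets
of `Z × ℕ^ℕ`. -/
def MSigma12 {Z : Type} [MeasurableSpace Z] (A : Set Z) : Prop :=
  ∃ C : Set (Z × NN), MAnalytic Cᶜ ∧ A = Prod.fst '' C

namespace ShiftComplexity

/-! ### The Galvin–Prikry theorem -/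

/-- The elements of `A` lying strictly above `s`. -/
def Above (s : Finset ℕ) (A : Set ℕ) : Set ℕ := {n | n ∈ A ∧ ∀ m ∈ s, m < n}

/-- The Ellentuck neighbourhood `[s, A]`. -/
def Ell (s : Finset ℕ) (A : Set ℕ) : Set IncSeq :=
  {u | (s : Set ℕ) ⊆ range u.1 ∧ range u.1 ⊆ ↑s ∪ Above s A}

def CompletelyRamsey (X : Set IncSeq) : Prop :=
  ∀ s A, A.Infinite → ∃ B ⊆ A, B.Infinite ∧ (Ell s B ⊆ X ∨ Ell s B ⊆ Xᶜ)

lemma Ell_mono {s : Finset ℕ} {A B : Set ℕ} (h : Above s B ⊆ A) : Ell s B ⊆ Ell s A := by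
  rintro u ⟨h1, h2⟩
  refine ⟨h1, fun n hn => ?_⟩
  rcases h2 hn with h3 | h3
  · exact Or.inl h3
  · exact Or.inr ⟨h h3, h3.2⟩

lemma Above_subset (s : Finset ℕ) (A : Set ℕ) : Above s A ⊆ A := fun _ h => h.1

lemma infinite_Above {A : Set ℕ} (s : Finset ℕ) (hA : A.Infinite) : (Above s A).Infinite := by
  have : A ⊆ Above s A ∪ Iic (s.sup id) := by
    intro n hn
    by_cases h : n ≤ s.sup id
    · exact Or.inr h
    · refine Or.inl ⟨hn, fun m hm => lt_of_le_of_lt (Finset.le_sup (f := id) hm) (not_le.1 h)⟩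
  intro hf
  exact hA ((hf.union (finite_Iic _)).subset this)

lemma infinite_range_incSeq (u : IncSeq) : (range u.1).Infinite :=
  infinite_range_of_injective u.2.injective

/-- Fusion: a dense hereditary property can be achieved simultaneously for all finite
extensions of `s` by subsets of a single infinite set. -/
lemma exists_fusion (P : Finset ℕ → Set ℕ → Prop)
    (hered : ∀ s A B, Above s B ⊆ A → P s A → P s B)
    (dense : ∀ s A, A.Infinite → ∃ B ⊆ A, B.Infinite ∧ P s B)
    (s : Finset ℕ) (A : Set ℕ) (hA : A.Infinite) :
    ∃ B ⊆ A, B.Infinite ∧ ∀ t : Finset ℕ, (t : Set ℕ) ⊆ B → P (s ∪ t) B := by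
  classical
  have hfin : ∀ (S : Finset (Finset ℕ)) (A : Set ℕ), A.Infinite →
      ∃ B ⊆ A, B.Infinite ∧ ∀ t ∈ S, P t B := by
    intro S
    induction S using Finset.induction_on with
    | empty => intro A hA; exact ⟨A, subset_rfl, hA, by simp⟩
    | insert t S _ ih =>
      intro A hA
      obtain ⟨B, hBA, hB, h1⟩ := ih A hA
      obtain ⟨C, hCB, hC, h2⟩ := dense t B hB
      refine ⟨C, hCB.trans hBA, hC, fun t' ht' => ?_⟩
      rcases Finset.mem_insert.1 ht' with rfl | ht'
      · exact h2
      · exact hered _ _ _ ((Above_subset _ _).trans hCB) (h1 t' ht')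
  have step : ∀ (F : Finset ℕ) (A : {A : Set ℕ // A.Infinite}),
      ∃ B : {A : Set ℕ // A.Infinite}, B.1 ⊆ A.1 ∧ (∀ b ∈ B.1, sInf A.1 < b) ∧
        ∀ t ⊆ insert (sInf A.1) F, P (s ∪ t) B.1 := by
    intro F A
    obtain ⟨B, h1, h2, h3⟩ := hfin ((insert (sInf A.1) F).powerset.image (fun t => s ∪ t))
      (Above {sInf A.1} A.1) (infinite_Above _ A.2)
    refine ⟨⟨B, h2⟩, h1.trans (Above_subset _ _), fun b hb => (h1 hb).2 _ (by simp), ?_⟩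
    intro t ht
    exact h3 _ (Finset.mem_image_of_mem _ (Finset.mem_powerset.2 ht))
  choose next n1 n2 n3 using step
  obtain ⟨A0, h0A, h0, hP0⟩ := dense s A hA
  let st : ℕ → Finset ℕ × {A : Set ℕ // A.Infinite} := fun k =>
    Nat.rec (∅, ⟨A0, h0⟩) (fun _ p => (insert (sInf p.2.1) p.1, next p.1 p.2)) k
  let b : ℕ → ℕ := fun k => sInf (st k).2.1
  have hst : ∀ k, st (k + 1) = (insert (b k) (st k).1, next (st k).1 (st k).2) := fun _ => rfl
  have hbmem : ∀ k, b k ∈ (st k).2.1 := fun k => Nat.sInf_mem (st k).2.2.nonempty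
  have hanti : ∀ i j, i ≤ j → (st j).2.1 ⊆ (st i).2.1 := by
    intro i j hij
    induction hij with
    | refl => exact subset_rfl
    | step _ ih => exact (n1 _ _).trans ih
  have hbmono : StrictMono b := by
    refine strictMono_nat_of_lt_succ fun k => ?_
    exact n2 (st k).1 (st k).2 _ (hbmem (k + 1))
  have hF : ∀ k j, j < k → b j ∈ (st k).1 := by
    intro k
    induction k with
    | zero => intro j hj; omega
    | succ k ih =>
      intro j hj
      rw [hst]
      rcases Nat.lt_succ_iff_lt_or_eq.1 hj with h | rfl
      · exact Finset.mem_insert_of_mem (ih j h)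
      · exact Finset.mem_insert_self _ _
  refine ⟨range b, ?_, infinite_range_of_injective hbmono.injective, ?_⟩
  · rintro _ ⟨k, rfl⟩
    exact h0A (hanti 0 k (Nat.zero_le _) (hbmem k))
  · intro t ht
    rcases t.eq_empty_or_nonempty with rfl | hne
    · refine hered _ A0 _ ?_ (by simpa using hP0)
      refine (Above_subset _ _).trans ?_
      rintro _ ⟨k, rfl⟩
      exact hanti 0 k (Nat.zero_le _) (hbmem k)
    · obtain ⟨k, hk⟩ := ht (t.max'_mem hne)
      have hsub : t ⊆ insert (sInf (st k).2.1) (st k).1 := by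
        intro m hm
        obtain ⟨j, rfl⟩ := ht hm
        have : b j ≤ b k := hk ▸ t.le_max' _ hm
        rcases (hbmono.le_iff_le.1 this).lt_or_eq with h | rfl
        · exact Finset.mem_insert_of_mem (hF k j h)
        · exact Finset.mem_insert_self _ _
      refine hered _ _ _ ?_ (n3 (st k).1 (st k).2 t hsub)
      rintro _ ⟨⟨j, rfl⟩, hj⟩
      have : b k < b j := hj _ (by rw [hk]; exact Finset.mem_union_right _ (t.max'_mem hne))
      exact hanti (k + 1) j (hbmono.lt_iff_lt.1 this) (hbmem j)

/-- `t` is an initial segment of `C`. -/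
def InitSeg (t : Finset ℕ) (C : Set ℕ) : Prop :=
  (t : Set ℕ) ⊆ C ∧ ∀ n ∈ C, n ∉ t → ∀ m ∈ t, m < n

lemma completelyRamsey_open (T : Finset ℕ → Prop) :
    CompletelyRamsey {u | ∃ t, T t ∧ InitSeg t (range u.1)} := by
  classical
  intro s A hA
  set O : Set IncSeq := {u | ∃ t, T t ∧ InitSeg t (range u.1)} with hO
  let P : Finset ℕ → Set ℕ → Prop := fun s A =>
    Ell s A ⊆ O ∨ ∀ B ⊆ A, B.Infinite → ¬ Ell s B ⊆ O
  obtain ⟨B, hBA, hB, hP⟩ := exists_fusion P (by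
      rintro s A B h (h1 | h1)
      · exact Or.inl ((Ell_mono h).trans h1)
      · refine Or.inr fun B' hB' hinf hE => h1 (Above s B') ?_ (infinite_Above _ hinf) ?_
        · exact fun n hn => h ⟨hB' hn.1, hn.2⟩
        · exact (Ell_mono fun n hn => hn.1.1).trans hE)
    (by
      intro s A hA
      by_cases h : ∃ B ⊆ A, B.Infinite ∧ Ell s B ⊆ O
      · obtain ⟨B, h1, h2, h3⟩ := h
        exact ⟨B, h1, h2, Or.inl h3⟩
      · push Not at h
        exact ⟨A, subset_rfl, hA, Or.inr fun B h1 h2 => h B h1 h2⟩) s A hA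
  by_cases hs : Ell s B ⊆ O
  · exact ⟨B, hBA, hB, Or.inl hs⟩
  let rej : Finset ℕ → Prop := fun t => ∀ B' ⊆ B, B'.Infinite → ¬ Ell t B' ⊆ O
  have hrej : ∀ t : Finset ℕ, (t : Set ℕ) ⊆ B → ¬ rej (s ∪ t) → Ell (s ∪ t) B ⊆ O :=
    fun t ht h => (hP t ht).resolve_right h
  have hbad : ∀ t : Finset ℕ, (t : Set ℕ) ⊆ B → rej (s ∪ t) →
      {n | n ∈ Above (s ∪ t) B ∧ ¬ rej (insert n (s ∪ t))}.Finite := by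
    intro t ht hr
    by_contra hinf
    refine hr _ (fun n hn => hn.1.1) hinf ?_
    rintro u ⟨h1, h2⟩
    set N := {n | n ∈ Above (s ∪ t) B ∧ ¬ rej (insert n (s ∪ t))} with hN
    have hne : (range u.1 \ ↑(s ∪ t)).Nonempty :=
      ((infinite_range_incSeq u).sdiff (Finset.finite_toSet _)).nonempty
    set n := sInf (range u.1 \ ↑(s ∪ t)) with hn
    have hnm : n ∈ range u.1 \ ↑(s ∪ t) := Nat.sInf_mem hne
    have hnN : n ∈ N := ((h2 hnm.1).resolve_left hnm.2).1
    have hE : Ell (s ∪ insert n t) B ⊆ O := by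
      apply hrej
      · rw [Finset.coe_insert]
        exact insert_subset hnN.1.1 ht
      · rw [Finset.union_insert]; exact hnN.2
    refine hE ⟨?_, ?_⟩
    · rw [Finset.union_insert, Finset.coe_insert]
      exact insert_subset hnm.1 h1
    · intro m hm
      by_cases hmn : m ∈ s ∪ insert n t
      · exact Or.inl hmn
      · right
        rw [Finset.union_insert, Finset.mem_insert, not_or] at hmn
        have hm' := (h2 hm).resolve_left hmn.2
        refine ⟨hm'.1.1.1, fun k hk => ?_⟩
        rw [Finset.union_insert, Finset.mem_insert] at hk
        rcases hk with rfl | hk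
        · exact lt_of_le_of_ne (Nat.sInf_le ⟨hm, hmn.2⟩) (Ne.symm hmn.1)
        · exact hm'.2 k hk
  let Q : Finset ℕ → Set ℕ → Prop := fun s' A =>
    (∃ t : Finset ℕ, (t : Set ℕ) ⊆ B ∧ s' = s ∪ t) → rej s' →
      ∀ n ∈ Above s' A, n ∈ B → rej (insert n s')
  obtain ⟨C, hCB, hC, hQ⟩ := exists_fusion Q (by
      intro s A B h h1 h2 h3 n hn
      exact h1 h2 h3 n ⟨h hn, hn.2⟩)
    (by
      intro s' A hA
      by_cases h : (∃ t : Finset ℕ, (t : Set ℕ) ⊆ B ∧ s' = s ∪ t) ∧ rej s'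
      · obtain ⟨⟨t, ht, rfl⟩, hr⟩ := h
        refine ⟨A \ _, sdiff_subset, hA.sdiff (hbad t ht hr), fun _ _ n hn hnB => ?_⟩
        by_contra hcon
        exact hn.1.2 ⟨⟨hnB, hn.2⟩, hcon⟩
      · exact ⟨A, subset_rfl, hA, fun h1 h2 => absurd ⟨h1, h2⟩ h⟩) s B hB
  have hall : ∀ t : Finset ℕ, (t : Set ℕ) ⊆ Above s C → rej (s ∪ t) := by
    intro t
    induction t using Finset.induction_on_max with
    | empty =>
      intro _
      rw [Finset.union_empty]
      exact ((by simpa using hP ∅ (by simp)) : P s B).resolve_left hs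
    | insert n t hnt ih =>
      intro ht
      rw [Finset.coe_insert, insert_subset_iff] at ht
      rw [Finset.union_insert]
      have htC := ht.2.trans (Above_subset _ _)
      refine hQ t htC ⟨t, htC.trans hCB, rfl⟩ (ih ht.2) n ⟨ht.1.1, ?_⟩ (hCB ht.1.1)
      intro m hm
      rcases Finset.mem_union.1 hm with h | h
      · exact ht.1.2 m h
      · exact hnt m h
  refine ⟨C, hCB.trans hBA, hC, Or.inr ?_⟩
  rintro u ⟨h1, h2⟩ ⟨t0, hT, h3, h4⟩
  have hsub : ((t0 \ s : Finset ℕ) : Set ℕ) ⊆ Above s C := by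
    intro n hn
    rw [Finset.mem_coe, Finset.mem_sdiff] at hn
    exact (h2 (h3 hn.1)).resolve_left hn.2
  refine hall _ hsub C hCB hC ?_
  rw [Finset.union_sdiff_self_eq_union]
  rintro u' ⟨h5, h6⟩
  refine ⟨t0, hT, fun n hn => h5 (Finset.mem_union_right _ hn), ?_⟩
  intro n hn hnt m hm
  rcases h6 hn with h7 | h7
  · rcases Finset.mem_union.1 h7 with h8 | h8
    · exact h4 n (h1 h8) hnt m hm
    · exact absurd h8 hnt
  · exact h7.2 m (Finset.mem_union_right _ hm)

lemma CompletelyRamsey.compl {X : Set IncSeq} (h : CompletelyRamsey X) :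
    CompletelyRamsey Xᶜ := by
  intro s A hA
  obtain ⟨B, h1, h2, h3⟩ := h s A hA
  exact ⟨B, h1, h2, by rw [compl_compl]; exact h3.symm⟩

lemma CompletelyRamsey.iUnion {X : ℕ → Set IncSeq} (h : ∀ n, CompletelyRamsey (X n)) :
    CompletelyRamsey (⋃ n, X n) := by
  classical
  intro s A hA
  let P : Finset ℕ → Set ℕ → Prop := fun s A =>
    ∀ n ≤ s.card, Ell s A ⊆ X n ∨ Ell s A ⊆ (X n)ᶜ
  obtain ⟨B, hBA, hB, hP⟩ := exists_fusion P (by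
      intro s A B hAB h1 n hn
      exact (h1 n hn).imp (Ell_mono hAB).trans (Ell_mono hAB).trans)
    (by
      intro s A hA
      have : ∀ k, ∃ B ⊆ A, B.Infinite ∧ ∀ n < k, Ell s B ⊆ X n ∨ Ell s B ⊆ (X n)ᶜ := by
        intro k
        induction k with
        | zero => exact ⟨A, subset_rfl, hA, by simp⟩
        | succ k ih =>
          obtain ⟨B, h1, h2, h3⟩ := ih
          obtain ⟨C, h4, h5, h6⟩ := h k s B h2
          refine ⟨C, h4.trans h1, h5, fun n hn => ?_⟩
          have hm := Ell_mono (s := s) ((Above_subset s C).trans h4)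
          rcases Nat.lt_succ_iff_lt_or_eq.1 hn with h7 | rfl
          · exact (h3 n h7).imp hm.trans hm.trans
          · exact h6
      obtain ⟨B, h1, h2, h3⟩ := this (s.card + 1)
      exact ⟨B, h1, h2, fun n hn => h3 n (Nat.lt_succ_of_le hn)⟩) s A hA
  let T : Finset ℕ → Prop := fun t => s ⊆ t ∧ ∃ n, Ell t B ⊆ X n
  have key : ∀ u ∈ Ell s B, (u ∈ ⋃ n, X n) ↔ ∃ t, T t ∧ InitSeg t (range u.1) := by
    rintro u ⟨h1, h2⟩
    have hmem : ∀ t : Finset ℕ, s ⊆ t → InitSeg t (range u.1) → u ∈ Ell t B := by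
      intro t hst ht
      refine ⟨ht.1, fun n hn => ?_⟩
      by_cases hnt : n ∈ t
      · exact Or.inl hnt
      · exact Or.inr ⟨((h2 hn).resolve_left fun h => hnt (hst h)).1, ht.2 n hn hnt⟩
    constructor
    · rintro hu
      obtain ⟨n, hn⟩ := mem_iUnion.1 hu
      have hN : ∃ N, n ≤ N ∧ ∀ m ∈ s, ∃ i < N, u.1 i = m := by
        choose f hf using fun m : s => h1 m.2
        refine ⟨max n (s.attach.sup f + 1), le_max_left _ _, fun m hm => ⟨f ⟨m, hm⟩, ?_, hf _⟩⟩
        exact lt_of_lt_of_le (Nat.lt_succ_of_le (Finset.le_sup (Finset.mem_attach _ _)))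
          (le_max_right _ _)
      obtain ⟨N, hnN, hN⟩ := hN
      let t : Finset ℕ := (Finset.range N).image u.1
      have hst : s ⊆ t := by
        intro m hm
        obtain ⟨i, hi, rfl⟩ := hN m hm
        exact Finset.mem_image_of_mem _ (Finset.mem_range.2 hi)
      have hti : InitSeg t (range u.1) := by
        refine ⟨fun m hm => ?_, ?_⟩
        · obtain ⟨i, _, rfl⟩ := Finset.mem_image.1 (Finset.mem_coe.1 hm)
          exact mem_range_self i
        · rintro _ ⟨j, rfl⟩ hj m hm
          obtain ⟨i, hi, rfl⟩ := Finset.mem_image.1 hm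
          refine u.2 (lt_of_lt_of_le (Finset.mem_range.1 hi) ?_)
          by_contra hjN
          exact hj (Finset.mem_image_of_mem _ (Finset.mem_range.2 (not_le.1 hjN)))
      have hcard : n ≤ t.card := by
        rw [Finset.card_image_of_injective _ u.2.injective, Finset.card_range]; exact hnN
      have ht' : ((t \ s : Finset ℕ) : Set ℕ) ⊆ B := by
        intro m hm
        rw [Finset.mem_coe, Finset.mem_sdiff] at hm
        exact ((h2 (hti.1 hm.1)).resolve_left hm.2).1
      have h4 := hP _ ht'
      rw [Finset.union_sdiff_of_subset hst] at h4
      refine ⟨t, ⟨hst, n, (h4 n hcard).resolve_right fun h5 => h5 (hmem t hst hti) hn⟩, hti⟩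
    · rintro ⟨t, ⟨hst, n, hn⟩, ht⟩
      exact mem_iUnion.2 ⟨n, hn (hmem t hst ht)⟩
  obtain ⟨C, hCB, hC, h1⟩ := completelyRamsey_open T s B hB
  have hm := Ell_mono (s := s) ((Above_subset s C).trans hCB)
  refine ⟨C, hCB.trans hBA, hC, h1.imp (fun h2 u hu => ?_) (fun h2 u hu => ?_)⟩
  · exact (key u (hm hu)).2 (h2 hu)
  · exact fun h3 => h2 hu ((key u (hm hu)).1 h3)

lemma measurableSet_induction {p : Set IncSeq → Prop}
    (basic : ∀ i j, p {u | u.1 i = j}) (compl : ∀ X, p X → p Xᶜ)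
    (union : ∀ X : ℕ → Set IncSeq, (∀ n, p (X n)) → p (⋃ n, X n))
    {X : Set IncSeq} (hX : MeasurableSet X) : p X := by
  let m : MeasurableSpace IncSeq :=
    { MeasurableSet' := p
      measurableSet_empty := by
        have h := compl _ (union (fun i => {u : IncSeq | u.1 0 = i}) fun i => basic 0 i)
        convert h using 1
        ext u; simp
      measurableSet_compl := compl
      measurableSet_iUnion := fun f hf => union f hf }
  have hle : (Subtype.instMeasurableSpace : MeasurableSpace IncSeq) ≤ m := by
    have : @Measurable IncSeq NN m _ Subtype.val := by
      refine @measurable_pi_lambda _ _ _ m _ _ fun i => ?_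
      refine @measurable_to_countable' _ _ _ _ m _ fun j => ?_
      exact basic i j
    exact this.comap_le
  exact hle X hX

lemma completelyRamsey_of_measurableSet {X : Set IncSeq} (hX : MeasurableSet X) :
    CompletelyRamsey X := by
  classical
  refine measurableSet_induction (p := CompletelyRamsey) (fun i j => ?_)
    (fun _ h => h.compl) (fun _ h => CompletelyRamsey.iUnion h) hX
  convert completelyRamsey_open fun t => t.card = i + 1 ∧ j ∈ t ∧ ∀ m ∈ t, m ≤ j using 1
  ext u
  constructor
  · rintro rfl
    refine ⟨(Finset.range (i + 1)).image u.1, ⟨?_, ?_, ?_⟩, ?_, ?_⟩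
    · rw [Finset.card_image_of_injective _ u.2.injective, Finset.card_range]
    · exact Finset.mem_image_of_mem _ (by simp)
    · intro m hm
      obtain ⟨k, hk, rfl⟩ := Finset.mem_image.1 hm
      exact u.2.monotone (Nat.lt_succ_iff.1 (Finset.mem_range.1 hk))
    · intro m hm
      obtain ⟨k, _, rfl⟩ := Finset.mem_image.1 (Finset.mem_coe.1 hm)
      exact mem_range_self k
    · rintro _ ⟨k, rfl⟩ hk m hm
      obtain ⟨l, hl, rfl⟩ := Finset.mem_image.1 hm
      refine u.2 (lt_of_lt_of_le (Finset.mem_range.1 hl) ?_)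
      by_contra hcon
      exact hk (Finset.mem_image_of_mem _ (Finset.mem_range.2 (not_le.1 hcon)))
  · rintro ⟨t, ⟨hc, hj, hmax⟩, h1, h2⟩
    obtain ⟨k, rfl⟩ := h1 hj
    have : t = (Finset.range (k + 1)).image u.1 := by
      ext m
      constructor
      · intro hm
        obtain ⟨l, rfl⟩ := h1 hm
        exact Finset.mem_image_of_mem _
          (Finset.mem_range.2 (Nat.lt_succ_of_le (u.2.le_iff_le.1 (hmax _ hm))))
      · intro hm
        obtain ⟨l, hl, rfl⟩ := Finset.mem_image.1 hm
        by_contra hcon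
        have := h2 _ (mem_range_self l) hcon _ hj
        exact absurd (u.2.lt_iff_lt.1 this) (by have := Finset.mem_range.1 hl; omega)
    rw [this, Finset.card_image_of_injective _ u.2.injective, Finset.card_range] at hc
    have : k = i := by omega
    subst this
    rfl

lemma exists_shift_eq (b : IncSeq → Bool × Bool) (hb : Measurable b) :
    ∃ u, b (shift u) = b u := by
  obtain ⟨A, -, hA, h1⟩ := completelyRamsey_of_measurableSet
    (measurableSet_eq_fun (hb.fst) (measurable_const (a := true))) ∅ univ infinite_univ
  obtain ⟨B, hBA, hB, h2⟩ := completelyRamsey_of_measurableSet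
    (measurableSet_eq_fun (hb.snd) (measurable_const (a := true))) ∅ A hA
  let u : IncSeq := ⟨Nat.nth (· ∈ B), Nat.nth_strictMono hB⟩
  have hu : u ∈ Ell ∅ B := by
    refine ⟨by simp, ?_⟩
    rintro _ ⟨n, rfl⟩
    exact Or.inr ⟨Nat.nth_mem_of_infinite hB n, by simp⟩
  have hs : shift u ∈ Ell ∅ B := by
    refine ⟨by simp, ?_⟩
    rintro _ ⟨n, rfl⟩
    exact hu.2 (mem_range_self (n + 1))
  have hm := Ell_mono (s := ∅) ((Above_subset ∅ B).trans hBA)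
  refine ⟨u, Prod.ext ?_ ?_⟩
  · rcases h1 with h | h
    · exact (h (hm hs) : _ = _).trans (h (hm hu) : _ = _).symm
    · have e1 : (b (shift u)).1 ≠ true := h (hm hs)
      have e2 : (b u).1 ≠ true := h (hm hu)
      simp only [ne_eq, Bool.not_eq_true] at e1 e2
      rw [e1, e2]
  · rcases h2 with h | h
    · exact (h hs : _ = _).trans (h hu : _ = _).symm
    · have e1 : (b (shift u)).2 ≠ true := h hs
      have e2 : (b u).2 ≠ true := h hu
      simp only [ne_eq, Bool.not_eq_true] at e1 e2
      rw [e1, e2]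

end ShiftComplexity

namespace ShiftComplexity

/-! ### Borel codes and evaluation certificates -/

/-- Labellings of the full tree of finite sequences. -/
abbrev Lab : Type := List ℕ → ℕ

/-- The labelling induced on the subtree above `[n]`. -/
def child (n : ℕ) (α : Lab) : Lab := fun q => α (n :: q)

/-- `α` is a Borel code: a node labelled `0` is the NAND of its children and a node with a
positive label `l + 1` is a leaf testing the `l`-th basic clopen condition. -/
inductive IsCode : Lab → Prop
  | leaf (α : Lab) : α [] ≠ 0 → IsCode α
  | node (α : Lab) : (∀ n, IsCode (child n α)) → IsCode α

/-- No proper initial segment of `q` is a leaf of `α`. -/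
def Active : Lab → List ℕ → Prop
  | _, [] => True
  | α, n :: q => α [] = 0 ∧ Active (child n α) q

def EvalRule (α : Lab) (u : NN) (r : Lab) (q : List ℕ) : Prop :=
  (∀ l, α q = l + 1 → (r q ≠ 0 ↔ u l.unpair.1 = l.unpair.2)) ∧
    (∀ n, α q = 0 → r q = 0 → r (q ++ [n]) ≠ 0) ∧
    ∀ n, α q = 0 → r q = n + 1 → r (q ++ [n]) = 0

/-- `r` certifies the evaluation of `α` at `u`; nonzero values of `r` stand for truth. -/
def Eval (α : Lab) (u : NN) (r : Lab) : Prop := ∀ q, Active α q → EvalRule α u r q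

lemma eval_iff {α : Lab} {u : NN} {r : Lab} :
    Eval α u r ↔ EvalRule α u r [] ∧ (α [] = 0 → ∀ n, Eval (child n α) u (child n r)) := by
  constructor
  · exact fun h => ⟨h [] trivial, fun h0 n q hq => h (n :: q) ⟨h0, hq⟩⟩
  · rintro ⟨h1, h2⟩ (_ | ⟨n, q⟩) hq
    · exact h1
    · exact h2 hq.1 n q hq.2

/-- The two bits coded by the first two children of the root. -/
def bits (r : Lab) : Bool × Bool := (decide (r [0] ≠ 0), decide (r [1] ≠ 0))

lemma isClosed_setOf_discrete {X D : Type*} [TopologicalSpace X] [TopologicalSpace D]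
    [DiscreteTopology D] {f : X → D} (hf : Continuous f) (p : D → Prop) :
    IsClosed {x | p (f x)} :=
  (isClosed_discrete {d | p d}).preimage hf

lemma isOpen_setOf_discrete {X D : Type*} [TopologicalSpace X] [TopologicalSpace D]
    [DiscreteTopology D] {f : X → D} (hf : Continuous f) (p : D → Prop) :
    IsOpen {x | p (f x)} :=
  (isOpen_discrete {d | p d}).preimage hf

lemma isClosed_forall {X ι : Type*} [TopologicalSpace X] {p : ι → X → Prop}
    (h : ∀ i, IsClosed {x | p i x}) : IsClosed {x | ∀ i, p i x} := by
  rw [ofPred_forall]; exact isClosed_iInter h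

lemma isClosed_and {X : Type*} [TopologicalSpace X] {p q : X → Prop}
    (hp : IsClosed {x | p x}) (hq : IsClosed {x | q x}) : IsClosed {x | p x ∧ q x} :=
  hp.inter hq

lemma measurableSet_exists {X ι : Type*} [MeasurableSpace X] [Countable ι] {p : ι → X → Prop}
    (h : ∀ i, MeasurableSet {x | p i x}) : MeasurableSet {x | ∃ i, p i x} := by
  rw [ofPred_exists]; exact MeasurableSet.iUnion h

lemma measurableSet_forall {X ι : Type*} [MeasurableSpace X] [Countable ι] {p : ι → X → Prop}
    (h : ∀ i, MeasurableSet {x | p i x}) : MeasurableSet {x | ∀ i, p i x} := by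
  rw [ofPred_forall]; exact MeasurableSet.iInter h

lemma continuous_child (n : ℕ) : Continuous (child n) := by
  unfold child; fun_prop

lemma measurable_child (n : ℕ) : Measurable (child n) := by
  unfold child; fun_prop

lemma continuous_bits : Continuous bits := by
  refine Continuous.prodMk ?_ ?_
  · exact continuous_of_discreteTopology.comp (g := fun n : ℕ => decide (n ≠ 0))
      (continuous_apply [0])
  · exact continuous_of_discreteTopology.comp (g := fun n : ℕ => decide (n ≠ 0))
      (continuous_apply [1])

lemma isOpen_active {X : Type*} [TopologicalSpace X] (q : List ℕ) {f : X → Lab}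
    (hf : Continuous f) : IsOpen {x | Active (f x) q} := by
  induction q generalizing f with
  | nil => simp [Active]
  | cons n q ih =>
    refine IsOpen.inter ?_ (ih ((continuous_child n).comp hf))
    exact isOpen_setOf_discrete ((continuous_apply []).comp hf) (· = 0)

lemma isClosed_eval {X : Type*} [TopologicalSpace X] {f : X → Lab} {u : X → NN} {r : X → Lab}
    (hf : Continuous f) (hu : Continuous u) (hr : Continuous r) :
    IsClosed {x | Eval (f x) (u x) (r x)} := by
  refine isClosed_forall fun q => ?_
  refine isClosed_imp (isOpen_active q hf) ?_
  have hf' : ∀ q, Continuous fun x => f x q := fun q => (continuous_apply q).comp hf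
  have hr' : ∀ q, Continuous fun x => r x q := fun q => (continuous_apply q).comp hr
  have hu' : ∀ q, Continuous fun x => u x q := fun q => (continuous_apply q).comp hu
  refine isClosed_and ?_ (isClosed_and ?_ ?_)
  · refine isClosed_forall fun l => ?_
    exact isClosed_setOf_discrete ((hf' q).prodMk ((hr' q).prodMk (hu' l.unpair.1)))
      fun d => d.1 = l + 1 → (d.2.1 ≠ 0 ↔ d.2.2 = l.unpair.2)
  · refine isClosed_forall fun n => ?_
    exact isClosed_setOf_discrete ((hf' q).prodMk ((hr' q).prodMk (hr' (q ++ [n]))))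
      fun d => d.1 = 0 → d.2.1 = 0 → d.2.2 ≠ 0
  · refine isClosed_forall fun n => ?_
    exact isClosed_setOf_discrete ((hf' q).prodMk ((hr' q).prodMk (hr' (q ++ [n]))))
      fun d => d.1 = 0 → d.2.1 = n + 1 → d.2.2 = 0

/-! ### Measurable evaluation -/

lemma measurable_sInf_setOf {X : Type*} [MeasurableSpace X] {p : ℕ → X → Prop}
    (hp : ∀ n, MeasurableSet {x | p n x}) : Measurable fun x => sInf {n | p n x} := by
  classical
  have h0 : MeasurableSet {x | ∃ n, p n x} := by
    exact measurableSet_exists hp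
  let q : X → ℕ → Prop := fun x n => p n x ∨ ¬ ∃ n, p n x
  have hq : ∀ x, ∃ n, q x n := by
    intro x
    by_cases h : ∃ n, p n x
    · exact ⟨_, Or.inl h.choose_spec⟩
    · exact ⟨0, Or.inr h⟩
  have : (fun x => sInf {n | p n x}) = fun x => Nat.find (hq x) := by
    funext x
    by_cases h : ∃ n, p n x
    · rw [Nat.sInf_def (s := {n | p n x}) h]
      exact Nat.find_congr' (by simp [q, h])
    · have : {n | p n x} = ∅ := by
        ext n; simp only [mem_ofPred_eq, mem_empty_iff_false, iff_false]; exact fun hn => h ⟨n, hn⟩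
      rw [this, Nat.sInf_empty, eq_comm, Nat.find_eq_zero]
      exact Or.inr h
  rw [this]
  exact measurable_find hq fun n => (hp n).union h0.compl

lemma measurable_apply_nat {X ι : Type*} [MeasurableSpace X] [Countable ι] [MeasurableSpace ι]
    [MeasurableSingletonClass ι] {f : X → ι → ℕ} {i : X → ι}
    (hf : Measurable f) (hi : Measurable i) : Measurable fun x => f x (i x) := by
  refine measurable_to_countable' fun j => ?_
  have : (fun x => f x (i x)) ⁻¹' {j} = ⋃ n, {x | i x = n} ∩ {x | f x n = j} := by
    ext x; simp
  rw [this]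
  refine MeasurableSet.iUnion fun n => ?_
  exact (hi (measurableSet_singleton n)).inter
    (((measurable_pi_apply n).comp hf) (measurableSet_singleton j))

/-- The certificate at a leaf. -/
def evalLeaf (α : Lab) (u : NN) : Lab := fun _ =>
  if u (α [] - 1).unpair.1 = (α [] - 1).unpair.2 then 1 else 0

open Classical in
/-- The certificate at a NAND node, given certificates for the children. -/
noncomputable def evalNode (e : ℕ → Lab) : Lab
  | [] => if ∃ n, e n [] = 0 then sInf {n | e n [] = 0} + 1 else 0
  | n :: q => e n q

lemma eval_evalLeaf {α : Lab} (h : α [] ≠ 0) (u : NN) : Eval α u (evalLeaf α u) := by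
  rw [eval_iff]
  refine ⟨⟨fun l hl => ?_, fun n h0 => absurd h0 h, fun n h0 => absurd h0 h⟩,
    fun h0 => absurd h0 h⟩
  simp [evalLeaf, hl]

lemma eval_evalNode {α : Lab} (h : α [] = 0) {u : NN} {e : ℕ → Lab}
    (he : ∀ n, Eval (child n α) u (e n)) : Eval α u (evalNode e) := by
  rw [eval_iff]
  refine ⟨⟨fun l hl => by omega, fun n _ h0 h1 => ?_, fun n _ h0 => ?_⟩, fun _ n => he n⟩
  · have h1 : e n [] = 0 := h1
    have : ∃ n, e n [] = 0 := ⟨n, h1⟩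
    simp [evalNode, this] at h0
  · by_cases h1 : ∃ n, e n [] = 0
    · simp only [evalNode, h1, if_true, Nat.add_right_cancel_iff] at h0
      have := Nat.sInf_mem (s := {n | e n [] = 0}) h1
      rw [h0] at this
      exact this
    · simp [evalNode, h1] at h0

lemma measurable_evalLeaf : Measurable fun p : Lab × NN => evalLeaf p.1 p.2 := by
  refine measurable_pi_lambda _ fun _ => ?_
  refine Measurable.ite (measurableSet_eq_fun ?_ ?_) measurable_const measurable_const
  · refine measurable_apply_nat measurable_snd ?_
    exact (measurable_of_countable fun n : ℕ => (n - 1).unpair.1).comp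
      ((measurable_pi_apply []).comp measurable_fst)
  · exact (measurable_of_countable fun n : ℕ => (n - 1).unpair.2).comp
      ((measurable_pi_apply []).comp measurable_fst)

lemma measurable_evalNode : Measurable evalNode := by
  have h : ∀ n q, Measurable fun e : ℕ → Lab => e n q := fun n q => by fun_prop
  have h0 : ∀ n, MeasurableSet {e : ℕ → Lab | e n [] = 0} := fun n =>
    h n [] (measurableSet_singleton 0)
  refine measurable_pi_lambda _ fun q => ?_
  rcases q with _ | ⟨n, q⟩
  · refine Measurable.ite ?_ ((measurable_sInf_setOf h0).add_const 1) measurable_const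
    exact measurableSet_exists h0
  · exact h n q

lemma IsCode.exists_eval {α : Lab} (h : IsCode α) :
    ∃ E : NN → Lab, Measurable E ∧ ∀ u, Eval α u (E u) := by
  induction h with
  | leaf α h0 =>
    exact ⟨evalLeaf α, measurable_evalLeaf.comp (measurable_const.prodMk measurable_id),
      eval_evalLeaf h0⟩
  | node α _ ih =>
    by_cases h0 : α [] = 0
    · choose E hE hEv using ih
      refine ⟨fun u => evalNode fun n => E n u, measurable_evalNode.comp
        (measurable_pi_lambda _ hE), fun u => eval_evalNode h0 fun n => hEv n u⟩
    · exact ⟨evalLeaf α, measurable_evalLeaf.comp (measurable_const.prodMk measurable_id),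
        eval_evalLeaf h0⟩

/-! ### Every Borel set has a code -/

def Codes (α : Lab) (B : Set IncSeq) : Prop :=
  IsCode α ∧ ∀ (u : IncSeq) r, Eval α u.1 r → (r [] ≠ 0 ↔ u ∈ B)

/-- The NAND of a sequence of codes. -/
def nand (a : ℕ → Lab) : Lab
  | [] => 0
  | n :: q => a n q

lemma Codes.nand {a : ℕ → Lab} {B : ℕ → Set IncSeq} (h : ∀ n, Codes (a n) (B n)) :
    Codes (nand a) (⋂ n, B n)ᶜ := by
  refine ⟨IsCode.node _ fun n => (h n).1, fun u r hr => ?_⟩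
  rw [eval_iff] at hr
  obtain ⟨⟨-, h1, h2⟩, h3⟩ := hr
  have h4 : ∀ n, r [n] ≠ 0 ↔ u ∈ B n := fun n => (h n).2 u _ (h3 rfl n)
  simp only [mem_compl_iff, mem_iInter, not_forall, ← h4]
  constructor
  · intro h0
    obtain ⟨n, hn⟩ := Nat.exists_eq_succ_of_ne_zero h0
    exact ⟨n, by simpa using h2 n rfl hn⟩
  · rintro ⟨n, hn⟩ h0
    exact hn (h1 n rfl h0)

lemma exists_codes {B : Set IncSeq} (hB : MeasurableSet B) : ∃ α, Codes α B := by
  have hc : ∀ X, (∃ α, Codes α X) → ∃ α, Codes α Xᶜ := by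
    rintro X ⟨α, hα⟩
    have := Codes.nand fun _ : ℕ => hα
    rw [iInter_const] at this
    exact ⟨_, this⟩
  refine measurableSet_induction (p := fun B => ∃ α, Codes α B) (fun i j => ?_) hc
    (fun X hX => ?_) hB
  · refine ⟨fun _ => Nat.pair i j + 1, IsCode.leaf _ (by simp), fun u r hr => ?_⟩
    simpa using (hr [] trivial).1 _ rfl
  · choose a ha using fun n => hc _ (hX n)
    refine ⟨nand a, ?_⟩
    have := Codes.nand ha
    rwa [← compl_iUnion, compl_compl] at this

/-- `α` codes the map `c` through the first two children of its root. -/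
def CodesBits (α : Lab) (c : IncSeq → Bool × Bool) : Prop :=
  IsCode α ∧ α [] = 0 ∧ ∀ (u : IncSeq) r, Eval α u.1 r → bits r = c u

lemma exists_codesBits {c : IncSeq → Bool × Bool} (hc : Measurable c) : ∃ α, CodesBits α c := by
  obtain ⟨a, ha⟩ := exists_codes (measurableSet_eq_fun hc.fst (measurable_const (a := true)))
  obtain ⟨b, hb⟩ := exists_codes (measurableSet_eq_fun hc.snd (measurable_const (a := true)))
  refine ⟨nand fun n => if n = 0 then a else b, IsCode.node _ fun n => ?_, rfl, ?_⟩
  · by_cases h : n = 0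
    · subst h; exact ha.1
    · have : child n (nand fun n => if n = 0 then a else b) = b := by
        funext q; simp [child, nand, h]
      rw [this]; exact hb.1
  · intro u r hr
    have h := (eval_iff.1 hr).2 rfl
    have h0 := ha.2 u _ (h 0)
    have h1 := hb.2 u _ (h 1)
    simp only [child, mem_ofPred_eq] at h0 h1
    ext1
    · rw [Bool.eq_iff_iff]; simpa [bits] using h0
    · rw [Bool.eq_iff_iff]; simpa [bits] using h1

end ShiftComplexity

namespace ShiftComplexity

/-! ### Colourings of shift graphs from labellings that change along every orbit -/

lemma shift_ne (x : IncSeq) : shift x ≠ x := by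
  intro h
  have : (shift x).1 0 = x.1 0 := by rw [h]
  exact absurd (x.2 (Nat.zero_lt_one)) (by rw [← this]; exact lt_irrefl _)

lemma measurable_shift : Measurable shift := by
  refine Measurable.subtype_mk (measurable_pi_lambda _ fun n => ?_)
  exact (measurable_pi_apply (n + 1)).comp measurable_subtype_coe

lemma exists_coloring_of_label {κ : Type} [MeasurableSpace κ] [MeasurableSingletonClass κ]
    [Countable κ] {C : Set IncSeq} (hC : MeasurableSet C) {lam : IncSeq → κ}
    (hl : Measurable lam)
    (h : ∀ x, (∀ n, shift^[n] x ∈ C) → ∃ n, lam (shift^[n] x) ≠ lam (shift^[n + 1] x)) :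
    ∃ c : IncSeq → κ × Bool, Measurable c ∧ ∀ v ∈ C, shift v ∈ C → c v ≠ c (shift v) := by
  classical
  let p : ℕ → IncSeq → Prop := fun t x =>
    shift^[t + 1] x ∉ C ∨ lam (shift^[t] x) ≠ lam (shift^[t + 1] x)
  have hs : ∀ n, Measurable shift^[n] := fun n => measurable_shift.iterate n
  have hp : ∀ t, MeasurableSet {x | p t x} := by
    intro t
    refine MeasurableSet.union (hs _ hC).compl ?_
    exact (measurableSet_eq_fun (hl.comp (hs _)) (hl.comp (hs _))).compl
  let t : IncSeq → ℕ := fun x => sInf {t | p t x}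
  have ht : Measurable t := measurable_sInf_setOf hp
  refine ⟨fun x => (lam x, decide (Even (t x))),
    hl.prodMk ((measurable_of_countable fun n : ℕ => decide (Even n)).comp ht), ?_⟩
  intro v hv hsv heq
  rw [Prod.mk.injEq] at heq
  have hne : {t | p t v}.Nonempty := by
    by_cases hall : ∀ n, shift^[n] v ∈ C
    · obtain ⟨n, hn⟩ := h v hall
      exact ⟨n, Or.inr hn⟩
    · push Not at hall
      obtain ⟨_ | n, hn⟩ := hall
      · exact absurd hv hn
      · exact ⟨n, Or.inl hn⟩
  have h0 : ¬ p 0 v := by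
    rintro (h1 | h1)
    · exact h1 hsv
    · exact h1 heq.1
  have h1 : 1 ≤ sInf {t | p t v} := by
    by_contra hlt
    have := Nat.sInf_mem hne
    rw [show sInf {t | p t v} = 0 by omega] at this
    exact h0 this
  have h2 : t (shift v) + 1 = t v := Nat.sInf_add (p := fun t => p t v) h1
  have h3 := heq.2
  rw [← h2, decide_eq_decide, Nat.even_add_one] at h3
  exact iff_not_self h3.symm

lemma borelColoringLE_of_coloring {κ : Type} [MeasurableSpace κ] [Finite κ]
    [MeasurableSingletonClass κ] {C : Set IncSeq} {c : IncSeq → κ} (hc : Measurable c)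
    (h : ∀ v ∈ C, shift v ∈ C → c v ≠ c (shift v)) : BorelColoringLE C (Nat.card κ) := by
  refine ⟨fun x => Finite.equivFin κ (c x.1),
    (measurable_of_countable _).comp (hc.comp measurable_subtype_coe), ?_⟩
  rintro ⟨x, hx⟩ ⟨y, hy⟩ ⟨-, h1⟩ heq
  replace heq := (Finite.equivFin κ).injective heq
  rcases h1 with h1 | h1
  · dsimp only at h1 heq; subst h1; exact h x hx hy heq
  · dsimp only at h1 heq; subst h1; exact h y hy hx heq.symm

lemma exists_bits_of_borelColoringLE {C : Set IncSeq} (hC : MeasurableSet C) {n : ℕ}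
    (h : BorelColoringLE C n) :
    ∃ b : IncSeq → Bool × Bool, Measurable b ∧ ∀ v ∈ C, shift v ∈ C → b v ≠ b (shift v) := by
  classical
  obtain ⟨c, hc, h⟩ := h
  let d : IncSeq → ℕ := fun x => if hx : x ∈ C then (c ⟨x, hx⟩ : ℕ) else 0
  have hd : Measurable d :=
    Measurable.dite (((measurable_of_countable fun i : Fin n => (i : ℕ))).comp hc)
      measurable_const hC
  refine exists_coloring_of_label hC (lam := fun x => decide (d x < d (shift x))) ?_ ?_
  · exact (measurable_of_countable fun p : ℕ × ℕ => decide (p.1 < p.2)).comp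
      (hd.prodMk (hd.comp measurable_shift))
  · intro x hx
    have hdn : ∀ k, d (shift^[k] x) < n := by
      intro k; simp only [d, hx k, dif_pos]; exact Fin.is_lt _
    have hne : ∀ k, d (shift^[k] x) ≠ d (shift^[k + 1] x) := by
      intro k heq
      simp only [d, hx k, hx (k + 1), dif_pos] at heq
      refine h ⟨_, hx k⟩ ⟨_, hx (k + 1)⟩ ⟨?_, Or.inl ?_⟩ (Fin.ext heq)
      · dsimp only; rw [Function.iterate_succ_apply']; exact (shift_ne _).symm
      · dsimp only; rw [Function.iterate_succ_apply']
    by_contra hcon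
    push Not at hcon
    have hcon : ∀ k, (d (shift^[k] x) < d (shift^[k + 1] x) ↔ d x < d (shift x)) := by
      intro k
      induction k with
      | zero => rfl
      | succ k ih =>
        rw [← ih]
        have := hcon k
        simp only [← Function.iterate_succ_apply', decide_eq_decide] at this
        exact this.symm
    by_cases h0 : d x < d (shift x)
    · have hm : StrictMono fun k => d (shift^[k] x) :=
        strictMono_nat_of_lt_succ fun k => (hcon k).2 h0
      exact absurd (hm.id_le n) (not_le.2 (hdn n))
    · have hm : ∀ k, d (shift^[k + 1] x) < d (shift^[k] x) := fun k =>
        lt_of_le_of_ne (not_lt.1 fun h1 => h0 ((hcon k).1 h1)) (hne k).symm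
      have : ∀ k, d (shift^[k] x) + k ≤ d x := by
        intro k
        induction k with
        | zero => simp
        | succ k ih => have := hm k; omega
      have := this (d x + 1)
      omega

end ShiftComplexity

namespace ShiftComplexity
open Filter Topology

/-! ### Sequences carrying a labelling -/

/-- The first `n` values of `w`. -/
def pre : ℕ → NN → List ℕ
  | 0, _ => []
  | n + 1, w => w 0 :: pre n fun i => w (i + 1)

lemma length_pre (n : ℕ) (w : NN) : (pre n w).length = n := by
  induction n generalizing w with
  | zero => rfl
  | succ n ih => simp [pre, ih]

lemma getD_pre {n : ℕ} (w : NN) {i : ℕ} (hi : i < n) : (pre n w).getD i 0 = w i := by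
  induction n generalizing w i with
  | zero => omega
  | succ n ih =>
    cases i with
    | zero => rfl
    | succ i =>
      rw [pre, List.getD_cons_succ]
      exact ih (fun i => w (i + 1)) (by omega)

lemma encode_pre_lt (n : ℕ) (w : NN) :
    Encodable.encode (pre n w) < Encodable.encode (pre (n + 1) w) := by
  induction n generalizing w with
  | zero => simp [pre]
  | succ n ih =>
    rw [pre, pre, Encodable.encode_list_cons, Encodable.encode_list_cons]
    exact Nat.succ_lt_succ (Nat.pair_lt_pair_right _ (ih _))

/-- The list with code `n`. -/
abbrev lst (n : ℕ) : List ℕ := Denumerable.ofNat (List ℕ) n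

lemma lst_encode (p : List ℕ) : lst (Encodable.encode p) = p := Denumerable.ofNat_encode p

lemma encode_lst (n : ℕ) : Encodable.encode (lst n) = n := Denumerable.encode_ofNat n

/-- The labelling read off from `u`. -/
def labelOf (u : NN) : Lab := fun p =>
  (lst (u (Encodable.encode p + 1))).getD (Encodable.encode p) 0

/-- The entries of `u` code longer and longer coherent approximations to a labelling. -/
def Coherent (u : NN) : Prop :=
  ∀ n, n ≤ (lst (u n)).length ∧
    ∀ i, i < (lst (u n)).length → (lst (u n)).getD i 0 = (lst (u (i + 1))).getD i 0

/-- The shift on all of Baire space. -/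
def shiftNN (u : NN) : NN := fun n => u (n + 1)

lemma Coherent.shiftNN {u : NN} (h : Coherent u) : Coherent (shiftNN u) := by
  intro n
  refine ⟨(Nat.le_succ n).trans (h (n + 1)).1, fun i hi => ?_⟩
  exact ((h (n + 1)).2 i hi).trans ((h (i + 2)).2 i (by have := (h (i + 2)).1; omega)).symm

lemma Coherent.labelOf_shiftNN {u : NN} (h : Coherent u) :
    labelOf (ShiftComplexity.shiftNN u) = labelOf u := by
  funext p
  exact (h (Encodable.encode p + 2)).2 _ (by have := (h (Encodable.encode p + 2)).1; omega)

lemma isClosed_coherent : IsClosed {u | Coherent u} := by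
  refine isClosed_forall fun n => isClosed_and ?_ (isClosed_forall fun i => ?_)
  · exact isClosed_setOf_discrete (f := fun u : NN => u n) (by fun_prop) fun m =>
      n ≤ (lst m).length
  · exact isClosed_setOf_discrete (f := fun u : NN => (u n, u (i + 1))) (by fun_prop) fun m =>
      i < (lst m.1).length → (lst m.1).getD i 0 = (lst m.2).getD i 0

lemma continuous_labelOf : Continuous labelOf := by
  refine continuous_pi fun p => ?_
  exact continuous_of_discreteTopology.comp
    (g := fun n : ℕ => (lst n).getD (Encodable.encode p) 0) (continuous_apply _)

lemma continuous_shiftNN : Continuous shiftNN := by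
  unfold shiftNN; fun_prop

/-- The codes of the approximations to the labelling `α`. -/
def approx (α : Lab) (j : ℕ) : ℕ := Encodable.encode (pre j fun i => α (lst i))

lemma strictMono_approx (α : Lab) : StrictMono (approx α) :=
  strictMono_nat_of_lt_succ fun n => encode_pre_lt n _

lemma coherent_approx (α : Lab) {w : NN} (hw : StrictMono w) :
    Coherent fun n => approx α (w n) := by
  have hn : ∀ n, n ≤ w n := hw.id_le
  intro n
  simp only [approx, lst_encode, length_pre]
  refine ⟨hn n, fun i hi => ?_⟩
  rw [getD_pre _ hi, getD_pre _ (lt_of_lt_of_le (Nat.lt_succ_self i) (hn (i + 1)))]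

lemma labelOf_approx (α : Lab) {w : NN} (hw : StrictMono w) :
    labelOf (fun n => approx α (w n)) = α := by
  funext p
  have : Encodable.encode p < w (Encodable.encode p + 1) :=
    lt_of_lt_of_le (Nat.lt_succ_self _) (hw.id_le _)
  simp only [labelOf, approx, lst_encode]
  rw [getD_pre _ this, lst_encode]

lemma isClosed_strictMono : IsClosed {u : NN | StrictMono u} := by
  have : {u : NN | StrictMono u} = {u | ∀ n, u n < u (n + 1)} := by
    ext u; exact ⟨fun h n => h (Nat.lt_succ_self n), strictMono_nat_of_lt_succ⟩
  rw [this]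
  refine isClosed_forall fun n => ?_
  exact isClosed_setOf_discrete (f := fun u : NN => (u n, u (n + 1))) (by fun_prop)
    fun m => m.1 < m.2

/-! ### The obstruction set -/

lemma continuous_apply_nat {X : Type*} [TopologicalSpace X] {f : X → NN} {i : X → ℕ}
    (hf : Continuous f) (hi : Continuous i) : Continuous fun x => f x (i x) := by
  rw [continuous_iff_continuousAt]
  intro x
  have h : ∀ᶠ x' in 𝓝 x, i x' = i x :=
    hi.continuousAt.eventually ((isOpen_discrete {i x}).mem_nhds rfl)
  refine ((continuous_apply (i x)).comp hf).continuousAt.congr ?_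
  filter_upwards [h] with x' hx
  simp [hx]

/-- The map of finite sequences whose value at `t ++ [i]` has last entry `g (t ++ [i])`. -/
def hom : Lab → List ℕ → List ℕ
  | _, [] => []
  | g, i :: t => g [i] :: hom (child i g) t

/-- `hom g` maps the interior nodes of `T` to inner nodes of `α`. -/
def Emb (T : Set (List ℕ)) (α g : Lab) : Prop := ∀ t i, t ++ [i] ∈ T → α (hom g t) = 0

/-- The part of `T` above `[i]`. -/
def branch (i : ℕ) (T : Set (List ℕ)) : Set (List ℕ) := {s | i :: s ∈ T}

lemma emb_iff {T : Set (List ℕ)} {α g : Lab} :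
    Emb T α g ↔ ((∃ i, [i] ∈ T) → α [] = 0) ∧
      ∀ i, Emb (branch i T) (child (g [i]) α) (child i g) := by
  constructor
  · exact fun h => ⟨fun ⟨i, hi⟩ => h [] i hi, fun j t i hi => h (j :: t) i hi⟩
  · rintro ⟨h1, h2⟩ (_ | ⟨j, t⟩) i hi
    · exact h1 ⟨i, hi⟩
    · exact h2 j t i hi

lemma IsCode.no_branch {α : Lab} (h : IsCode α) {T : Set (List ℕ)} {g : Lab} (hg : Emb T α g)
    (w : NN) : ¬ ∀ n, pre n w ∈ T := by
  induction h generalizing T g w with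
  | leaf α h0 => exact fun hw => h0 (hg [] (w 0) (hw 1))
  | node α _ ih =>
    intro hw
    exact ih _ ((emb_iff.1 hg).2 (w 0)) (fun i => w (i + 1)) fun n => hw (n + 1)

lemma isClosed_hom {X : Type*} [TopologicalSpace X] (t : List ℕ) {α g : X → Lab}
    (hα : Continuous α) (hg : Continuous g) : IsClosed {x | α x (hom (g x) t) = 0} := by
  induction t generalizing α g with
  | nil => exact isClosed_setOf_discrete ((continuous_apply []).comp hα) (· = 0)
  | cons i t ih =>
    have h1 : Continuous fun x => child (g x [i]) (α x) := by
      refine continuous_pi fun q => ?_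
      exact continuous_apply_nat (f := fun x n => α x (n :: q))
        (continuous_pi fun n => (continuous_apply _).comp hα) ((continuous_apply [i]).comp hg)
    exact ih h1 ((continuous_child i).comp hg)

/-- The decoding of the first kind of obstruction. -/
def seqPart (ρ : NN) : NN := fun k => ρ (3 * k + 1)
def certPart (ρ : NN) : Lab := fun p => ρ (3 * Encodable.encode p + 2)
def certPart' (ρ : NN) : Lab := fun p => ρ (3 * Encodable.encode p + 3)

/-- The sequence `a` carries `α`, and the pair of bits coded by `α` agrees on `a` and on
its shift. -/
def ObstrEq (α : Lab) (ρ : NN) : Prop :=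
  StrictMono (seqPart ρ) ∧ Coherent (seqPart ρ) ∧ labelOf (seqPart ρ) = α ∧
    Eval α (seqPart ρ) (certPart ρ) ∧ Eval α (shiftNN (seqPart ρ)) (certPart' ρ) ∧
    bits (certPart ρ) = bits (certPart' ρ) ∧ ρ 0 = seqPart ρ 1 + 1

/-- Inverse to the decoding of the first kind of obstruction. -/
def mkEq (a : NN) (r r' : Lab) : NN
  | 0 => a 1 + 1
  | n + 1 => if n % 3 = 0 then a (n / 3) else
      if n % 3 = 1 then r (lst (n / 3)) else r' (lst (n / 3))

lemma seqPart_mkEq (a : NN) (r r' : Lab) : seqPart (mkEq a r r') = a := by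
  funext k
  simp [seqPart, mkEq]

lemma certPart_mkEq (a : NN) (r r' : Lab) : certPart (mkEq a r r') = r := by
  funext p
  have h1 : (3 * Encodable.encode p + 1) % 3 = 1 := by omega
  have h2 : (3 * Encodable.encode p + 1) / 3 = Encodable.encode p := by omega
  simp only [certPart, mkEq, h1, h2, lst_encode]
  simp

lemma certPart'_mkEq (a : NN) (r r' : Lab) : certPart' (mkEq a r r') = r' := by
  funext p
  have h1 : (3 * Encodable.encode p + 2) % 3 = 2 := by omega
  have h2 : (3 * Encodable.encode p + 2) / 3 = Encodable.encode p := by omega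
  simp only [certPart', mkEq, h1, h2, lst_encode]
  simp

lemma obstrEq_mkEq {a : NN} {α r r' : Lab} (h1 : StrictMono a) (h2 : Coherent a)
    (h3 : labelOf a = α) (h4 : Eval α a r) (h5 : Eval α (shiftNN a) r') (h6 : bits r = bits r') :
    ObstrEq α (mkEq a r r') := by
  simp only [ObstrEq, seqPart_mkEq, certPart_mkEq, certPart'_mkEq]
  exact ⟨h1, h2, h3, h4, h5, h6, rfl⟩

/-- The decoding of the second kind of obstruction. -/
def witPart (ρ : NN) : NN := fun k => ρ (2 * k)
def embPart (ρ : NN) : Lab := fun p => ρ (2 * Encodable.encode p + 1)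

/-- Inverse to the decoding of the second kind of obstruction. -/
def mkEmb (y : NN) (g : Lab) : NN := fun n => if n % 2 = 0 then y (n / 2) else g (lst (n / 2))

lemma witPart_mkEmb (y : NN) (g : Lab) : witPart (mkEmb y g) = y := by
  funext k
  simp [witPart, mkEmb]

lemma embPart_mkEmb (y : NN) (g : Lab) : embPart (mkEmb y g) = g := by
  funext p
  have h1 : (2 * Encodable.encode p + 1) % 2 = 1 := by omega
  have h2 : (2 * Encodable.encode p + 1) / 2 = Encodable.encode p := by omega
  simp only [embPart, mkEmb, h1, h2, lst_encode]
  simp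

/-- The obstructions: `ObstrEq`, or an embedding of one of the trees `T x y` into `α`. -/
def Obstr (T : NN → NN → Set (List ℕ)) (x : NN) (α : Lab) (ρ : NN) : Prop :=
  ObstrEq α ρ ∨ Emb (T x (witPart ρ)) α (embPart ρ)

lemma continuous_seqPart : Continuous seqPart := by unfold seqPart; fun_prop
lemma continuous_certPart : Continuous certPart := by unfold certPart; fun_prop
lemma continuous_certPart' : Continuous certPart' := by unfold certPart'; fun_prop
lemma continuous_witPart : Continuous witPart := by unfold witPart; fun_prop
lemma continuous_embPart : Continuous embPart := by unfold embPart; fun_prop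

lemma isClosed_obstrEq : IsClosed {p : Lab × NN | ObstrEq p.1 p.2} := by
  have hs := continuous_seqPart.comp (continuous_snd (X := Lab) (Y := NN))
  have hc := continuous_certPart.comp (continuous_snd (X := Lab) (Y := NN))
  have hc' := continuous_certPart'.comp (continuous_snd (X := Lab) (Y := NN))
  refine isClosed_and (isClosed_strictMono.preimage hs) ?_
  refine isClosed_and (isClosed_coherent.preimage hs) ?_
  refine isClosed_and (isClosed_eq (continuous_labelOf.comp hs) continuous_fst) ?_
  refine isClosed_and (isClosed_eval continuous_fst hs hc) ?_
  refine isClosed_and (isClosed_eval continuous_fst (continuous_shiftNN.comp hs) hc') ?_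
  refine isClosed_and (isClosed_eq (continuous_bits.comp hc) (continuous_bits.comp hc')) ?_
  exact isClosed_setOf_discrete (f := fun p : Lab × NN => (p.2 0, seqPart p.2 1))
    (by unfold seqPart; fun_prop) fun m => m.1 = m.2 + 1

lemma isClosed_obstr {T : NN → NN → Set (List ℕ)}
    (hT : ∀ s, IsOpen {p : NN × NN | s ∈ T p.1 p.2}) :
    IsClosed {p : NN × Lab × NN | Obstr T p.1 p.2.1 p.2.2} := by
  refine IsClosed.union (isClosed_obstrEq.preimage continuous_snd) ?_
  refine isClosed_forall fun t => isClosed_forall fun i => isClosed_imp ?_ ?_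
  · exact (hT (t ++ [i])).preimage (f := fun p : NN × Lab × NN => (p.1, witPart p.2.2))
      (continuous_fst.prodMk (continuous_witPart.comp (continuous_snd.comp continuous_snd)))
  · exact isClosed_hom t (continuous_fst.comp continuous_snd)
      (continuous_embPart.comp (continuous_snd.comp continuous_snd))

/-- The first `k` values of `x` and `u` rule out obstructions below `u`. -/
def Good (T : NN → NN → Set (List ℕ)) (x : NN) (k : ℕ) (u : NN) : Prop :=
  ¬ ∃ x' α ρ, (∀ i < k, x' i = x i) ∧ (∀ i < k, α (lst i) = labelOf u (lst i)) ∧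
    (∀ i < k, ρ i ≤ u i) ∧ Obstr T x' α ρ

lemma good_congr {T : NN → NN → Set (List ℕ)} {x y u v : NN} {k : ℕ}
    (hx : ∀ i < k, x i = y i) (hu : ∀ i < k + 1, u i = v i) : Good T x k u ↔ Good T y k v := by
  have h : ∀ i < k, labelOf u (lst i) = labelOf v (lst i) := by
    intro i hi
    simp only [labelOf, encode_lst]
    rw [hu (i + 1) (by omega)]
  unfold Good
  refine not_congr (exists_congr fun x' => exists_congr fun α => exists_congr fun ρ => ?_)
  refine and_congr (forall₂_congr fun i hi => by rw [hx i hi]) (and_congr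
    (forall₂_congr fun i hi => by rw [h i hi]) (and_congr_left' (forall₂_congr fun i hi => ?_)))
  rw [hu i (by omega)]

lemma Good.of_shiftNN {T : NN → NN → Set (List ℕ)} {x u : NN} {k : ℕ} (hu : StrictMono u)
    (hc : Coherent u) (h : Good T x k (shiftNN u)) : Good T x k u := by
  rintro ⟨x', α, ρ, h1, h2, h3, h4⟩
  refine h ⟨x', α, ρ, h1, ?_, fun i hi => (h3 i hi).trans (hu.monotone (Nat.le_succ i)), h4⟩
  rwa [hc.labelOf_shiftNN]

lemma not_obstr_of_good {T : NN → NN → Set (List ℕ)} {x u ρ : NN} {k : ℕ}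
    (h : Good T x k u) (hρ : ∀ i, ρ i ≤ u i) : ¬ Obstr T x (labelOf u) ρ := fun ho =>
  h ⟨x, labelOf u, ρ, fun _ _ => rfl, fun _ _ => rfl, fun i _ => hρ i, ho⟩

lemma exists_obstr_of_forall_not_good {T : NN → NN → Set (List ℕ)}
    (hT : ∀ s, IsOpen {p : NN × NN | s ∈ T p.1 p.2}) {x u : NN}
    (h : ∀ k, ¬ Good T x k u) : ∃ ρ, (∀ i, ρ i ≤ u i) ∧ Obstr T x (labelOf u) ρ := by
  simp only [Good, not_not] at h
  choose X A R h1 h2 h3 h4 using h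
  have hX : Tendsto X atTop (𝓝 x) := by
    refine tendsto_pi_nhds.2 fun i => tendsto_const_nhds.congr' ?_
    filter_upwards [eventually_gt_atTop i] with k hk using (h1 k i hk).symm
  have hA : Tendsto A atTop (𝓝 (labelOf u)) := by
    refine tendsto_pi_nhds.2 fun p => tendsto_const_nhds.congr' ?_
    filter_upwards [eventually_gt_atTop (Encodable.encode p)] with k hk
    have := h2 k _ hk
    rw [lst_encode] at this
    exact this.symm
  let b : NN := fun i => u i + ∑ k ∈ Finset.range (i + 1), R k i
  have hR : ∀ k, R k ∈ univ.pi fun i => Iic (b i) := by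
    intro k i _
    by_cases hk : i < k
    · exact (h3 k i hk).trans (Nat.le_add_right _ _)
    · have : R k i ≤ ∑ k ∈ Finset.range (i + 1), R k i :=
        Finset.single_le_sum (f := fun k => R k i) (fun _ _ => Nat.zero_le _)
          (Finset.mem_range.2 (by omega))
      exact this.trans (Nat.le_add_left _ _)
  obtain ⟨ρ, -, φ, hφ, hρ⟩ :=
    (isCompact_univ_pi fun i => (finite_Iic (b i)).isCompact).tendsto_subseq hR
  refine ⟨ρ, fun i => ?_, ?_⟩
  · refine le_of_tendsto ((tendsto_pi_nhds.1 hρ) i) ?_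
    filter_upwards [eventually_gt_atTop i] with k hk
    exact h3 _ _ (hk.trans_le (hφ.id_le k))
  · have := (hX.comp hφ.tendsto_atTop).prodMk_nhds
      ((hA.comp hφ.tendsto_atTop).prodMk_nhds hρ)
    exact (isClosed_obstr hT).mem_of_tendsto this (Eventually.of_forall fun k => h4 _)

/-! ### The closed sets -/

lemma eventually_agree {X : Type*} [TopologicalSpace X] {f : X → NN} (hf : Continuous f)
    (x : X) (k : ℕ) : ∀ᶠ y in 𝓝 x, ∀ i < k, f y i = f x i := by
  have : ∀ i ∈ Finset.range k, ∀ᶠ y in 𝓝 x, f y i = f x i := fun i _ =>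
    ((continuous_apply i).comp hf).continuousAt.eventually
      ((isOpen_discrete {f x i}).mem_nhds rfl)
  filter_upwards [(Filter.eventually_all_finset _).2 this] with y hy i hi
  exact hy i (Finset.mem_range.2 hi)

/-- The sequence of second components. -/
def second (v : NN) : NN := fun n => (v n).unpair.2

lemma continuous_second : Continuous second :=
  continuous_pi fun n => continuous_of_discreteTopology.comp
    (g := fun m : ℕ => m.unpair.2) (continuous_apply n)

/-- The closed set attached to the parameter `x`. -/
def closedOf (T : NN → NN → Set (List ℕ)) (x : NN) : Set IncSeq :=
  {v | StrictMono (second v.1) ∧ Coherent (second v.1) ∧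
    Good T x (v.1 0).unpair.1 (second v.1)}

lemma isClosed_closedOf (T : NN → NN → Set (List ℕ)) (x : NN) : IsClosed (closedOf T x) := by
  have hs : Continuous fun v : IncSeq => second v.1 :=
    continuous_second.comp continuous_subtype_val
  refine isClosed_and (isClosed_strictMono.preimage hs)
    (isClosed_and (isClosed_coherent.preimage hs) ?_)
  rw [← isOpen_compl_iff, isOpen_iff_mem_nhds]
  intro v hv
  filter_upwards [eventually_agree hs v ((v.1 0).unpair.1 + 1),
    eventually_agree continuous_subtype_val v 1] with v' h1 h2 h3
  refine hv ?_
  simp only [mem_ofPred_eq] at h3 ⊢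
  rw [h2 0 one_pos] at h3
  exact (good_congr (fun _ _ => rfl) h1).1 h3

lemma isOpen_closedOf_inter (T : NN → NN → Set (List ℕ)) (O : Set IncSeq) :
    IsOpen {x | (closedOf T x ∩ O).Nonempty} := by
  rw [isOpen_iff_mem_nhds]
  rintro x ⟨v, ⟨h1, h2, h3⟩, hO⟩
  filter_upwards [eventually_agree continuous_id x (v.1 0).unpair.1] with y hy
  exact ⟨v, ⟨h1, h2, (good_congr hy fun _ _ => rfl).2 h3⟩, hO⟩

lemma measurable_closedOf {Z : Type*} [MeasurableSpace Z] (T : NN → NN → Set (List ℕ))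
    {φ : Z → NN} (hφ : Measurable φ) :
    Measurable fun z => (⟨closedOf T (φ z), isClosed_closedOf T _⟩ : Effros IncSeq) := by
  refine measurable_generateFrom ?_
  rintro _ ⟨O, -, rfl⟩
  exact hφ (isOpen_closedOf_inter T O).measurableSet

end ShiftComplexity

namespace ShiftComplexity

/-! ### Parameters whose closed set has infinite Borel chromatic number -/

lemma isOpen_good (T : NN → NN → Set (List ℕ)) (x : NN) (k : ℕ) :
    IsOpen {u | Good T x k u} := by
  rw [isOpen_iff_mem_nhds]
  intro u hu
  filter_upwards [eventually_agree continuous_id u (k + 1)] with v hv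
  exact (good_congr (fun _ _ => rfl) hv).2 hu

/-- The least `k` with `Good T x k u`. -/
noncomputable def goodIdx (T : NN → NN → Set (List ℕ)) (x u : NN) : ℕ :=
  sInf {k | Good T x k u}

lemma measurable_goodIdx (T : NN → NN → Set (List ℕ)) (x : NN) : Measurable (goodIdx T x) :=
  measurable_sInf_setOf fun k => (isOpen_good T x k).measurableSet

/-- The maximum of `goodIdx` over the first `n + 1` shifts of `u`. -/
noncomputable def maxIdx (T : NN → NN → Set (List ℕ)) (x : NN) : ℕ → NN → ℕ
  | 0, u => goodIdx T x u
  | n + 1, u => max (goodIdx T x u) (maxIdx T x n (shiftNN u))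

lemma measurable_maxIdx (T : NN → NN → Set (List ℕ)) (x : NN) (n : ℕ) :
    Measurable (maxIdx T x n) := by
  induction n with
  | zero => exact measurable_goodIdx T x
  | succ n ih =>
    exact (measurable_goodIdx T x).max (ih.comp continuous_shiftNN.measurable)

lemma goodIdx_le_maxIdx (T : NN → NN → Set (List ℕ)) (x : NN) (n : ℕ) (u : NN) :
    goodIdx T x u ≤ maxIdx T x n u := by
  cases n with
  | zero => exact le_rfl
  | succ n => exact le_max_left _ _

lemma maxIdx_le_succ (T : NN → NN → Set (List ℕ)) (x : NN) (n : ℕ) (u : NN) :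
    maxIdx T x n u ≤ maxIdx T x (n + 1) u := by
  induction n generalizing u with
  | zero => exact le_max_left _ _
  | succ n ih => exact max_le_max le_rfl (ih _)

lemma strictMono_pair_maxIdx (T : NN → NN → Set (List ℕ)) (x : NN) {u : NN}
    (hu : StrictMono u) : StrictMono fun n => Nat.pair (maxIdx T x n u) (u n) := by
  refine strictMono_nat_of_lt_succ fun n => ?_
  refine lt_of_lt_of_le (Nat.pair_lt_pair_right _ (hu (Nat.lt_succ_self n))) ?_
  rcases (maxIdx_le_succ T x n u).lt_or_eq with h | h
  · exact (Nat.pair_lt_pair_left _ h).le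
  · rw [h]

/-- The lift of `u` to a point which lies in the closed set of `x` whenever possible. -/
noncomputable def lift (T : NN → NN → Set (List ℕ)) (x : NN) (u : IncSeq) : IncSeq :=
  ⟨_, strictMono_pair_maxIdx T x u.2⟩

lemma measurable_lift (T : NN → NN → Set (List ℕ)) (x : NN) : Measurable (lift T x) := by
  refine Measurable.subtype_mk (measurable_pi_lambda _ fun n => ?_)
  exact (measurable_of_countable fun p : ℕ × ℕ => Nat.pair p.1 p.2).comp
    (((measurable_maxIdx T x n).comp measurable_subtype_coe).prodMk
      ((measurable_pi_apply n).comp measurable_subtype_coe))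

lemma second_lift (T : NN → NN → Set (List ℕ)) (x : NN) (u : IncSeq) :
    second (lift T x u).1 = u.1 := by
  funext n
  simp [second, lift]

lemma lift_mem {T : NN → NN → Set (List ℕ)} {x : NN} {u : IncSeq} (hc : Coherent u.1)
    (h : ∃ k, Good T x k u.1) : lift T x u ∈ closedOf T x := by
  rw [closedOf, mem_ofPred_eq, second_lift]
  refine ⟨u.2, hc, ?_⟩
  have : ((lift T x u).1 0).unpair.1 = goodIdx T x u.1 := by simp [lift, maxIdx]
  rw [this]
  exact Nat.sInf_mem (s := {k | Good T x k u.1}) h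

lemma shift_lift {T : NN → NN → Set (List ℕ)} {x : NN} {u : IncSeq} (hc : Coherent u.1)
    (h : ∃ k, Good T x k (shift u).1) : shift (lift T x u) = lift T x (shift u) := by
  refine Subtype.ext (funext fun n => ?_)
  have h1 : goodIdx T x u.1 ≤ goodIdx T x (shift u).1 :=
    Nat.sInf_le (Good.of_shiftNN u.2 hc
      (Nat.sInf_mem (s := {k | Good T x k (shift u).1}) h))
  have h2 : maxIdx T x (n + 1) u.1 = maxIdx T x n (shift u).1 :=
    max_eq_right (h1.trans (goodIdx_le_maxIdx T x n _))
  exact congrArg (fun m => Nat.pair m (u.1 (n + 1))) h2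

lemma not_borelColoringLE {T : NN → NN → Set (List ℕ)}
    (hT : ∀ s, IsOpen {p : NN × NN | s ∈ T p.1 p.2}) {x : NN}
    (hx : ∀ y, ∃ w, ∀ n, pre n w ∈ T x y) (n : ℕ) : ¬ BorelColoringLE (closedOf T x) n := by
  intro hcol
  obtain ⟨b, hb, hbne⟩ :=
    exists_bits_of_borelColoringLE (isClosed_closedOf T x).measurableSet hcol
  let c : IncSeq → Bool × Bool := fun u => b (lift T x u)
  have hc : Measurable c := hb.comp (measurable_lift T x)
  obtain ⟨α, hcode, -, hα⟩ := exists_codesBits hc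
  let app : IncSeq → IncSeq := fun w => ⟨fun n => approx α (w.1 n), (strictMono_approx α).comp w.2⟩
  have happ : Measurable app := by
    refine Measurable.subtype_mk (measurable_pi_lambda _ fun n => ?_)
    exact (measurable_of_countable (approx α)).comp
      ((measurable_pi_apply n).comp measurable_subtype_coe)
  let M : Set IncSeq := {a | Coherent a.1 ∧ labelOf a.1 = α ∧ c (shift a) = c a}
  have hM : M.Nonempty := by
    obtain ⟨w, hw⟩ := exists_shift_eq (fun w => c (app w)) (hc.comp happ)
    exact ⟨app w, coherent_approx α w.2, labelOf_approx α w.2, hw⟩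
  obtain ⟨a, ⟨ha1, ha2, ha3⟩, hmin⟩ := (measure fun a : IncSeq => a.1 1).wf.has_min M hM
  have hlab : labelOf (shift a).1 = α := (ha1.labelOf_shiftNN).trans ha2
  have hgood : ∃ k, Good T x k (shift a).1 := by
    by_contra hcon
    push Not at hcon
    obtain ⟨ρ, h1, h2⟩ := exists_obstr_of_forall_not_good hT hcon
    rw [hlab] at h2
    rcases h2 with ⟨h3, h4, h5, h6, h7, h8, h9⟩ | h2
    · refine hmin ⟨seqPart ρ, h3⟩ ⟨h4, h5, ?_⟩ ?_
      · have e1 := hα ⟨seqPart ρ, h3⟩ _ h6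
        have e2 := hα (shift ⟨seqPart ρ, h3⟩) _ h7
        rw [← e1, ← e2, h8]
      · have h10 := h1 0
        rw [h9] at h10
        exact h10
    · obtain ⟨w, hw⟩ := hx (witPart ρ)
      exact hcode.no_branch h2 w hw
  have hgood' : ∃ k, Good T x k a.1 := hgood.imp fun k hk => hk.of_shiftNN a.2 ha1
  have hmem : shift (lift T x a) ∈ closedOf T x := by
    rw [shift_lift ha1 hgood]
    exact lift_mem ha1.shiftNN hgood
  refine hbne _ (lift_mem ha1 hgood') hmem ?_
  rw [shift_lift ha1 hgood]
  exact ha3.symm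

end ShiftComplexity

namespace ShiftComplexity
open Filter Topology

/-! ### Well-founded trees -/

inductive IsWF : Set (List ℕ) → Prop
  | empty : IsWF ∅
  | node (T : Set (List ℕ)) : (∀ n, IsWF (branch n T)) → IsWF T

/-- Dependent choice along finite sequences. -/
lemma exists_forall_pre {σ : Type*} (S : Set σ) (next : σ → ℕ → σ) (p : σ → List ℕ → Prop)
    (hroot : ∀ s ∈ S, p s []) (hstep : ∀ s n q, p (next s n) q → p s (n :: q))
    (hS : ∀ s ∈ S, ∃ n, next s n ∈ S) {s : σ} (hs : s ∈ S) : ∃ w, ∀ n, p s (pre n w) := by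
  choose! d hd using hS
  let st : ℕ → σ → σ := fun n => (fun s => next s (d s))^[n]
  refine ⟨fun n => d (st n s), fun n => ?_⟩
  induction n generalizing s with
  | zero => exact hroot s hs
  | succ n ih => exact hstep _ _ _ (ih (hd s hs))

lemma isWF_of_no_branch {T : Set (List ℕ)} (hp : ∀ s i, s ++ [i] ∈ T → s ∈ T)
    (h : ¬ ∃ w, ∀ n, pre n w ∈ T) : IsWF T := by
  by_contra hwf
  refine h (exists_forall_pre {T | (∀ s i, s ++ [i] ∈ T → s ∈ T) ∧ ¬ IsWF T}
    (fun T n => branch n T) (fun T q => q ∈ T) ?_ (fun T n q hq => hq) ?_ ⟨hp, hwf⟩)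
  · rintro T ⟨h1, h2⟩
    have hne : T.Nonempty := by
      rw [nonempty_iff_ne_empty]
      rintro rfl
      exact h2 IsWF.empty
    obtain ⟨s, hs⟩ := hne
    induction s using List.reverseRecOn with
    | nil => exact hs
    | append_singleton s i ih => exact ih (h1 s i hs)
  · rintro T ⟨h1, h2⟩
    by_contra hcon
    push Not at hcon
    refine h2 (IsWF.node T fun n => ?_)
    by_contra h3
    exact hcon n ⟨fun s i hs => h1 (n :: s) i hs, h3⟩

/-- Uniformly in `α`, a well-founded tree embeds into `α` or `α` can be evaluated. -/
lemma IsWF.exists_emb_or_eval {T : Set (List ℕ)} (h : IsWF T) :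
    ∃ (Q : Set Lab) (G : Lab → Lab) (E : Lab × NN → Lab), MeasurableSet Q ∧ Measurable G ∧
      Measurable E ∧ (∀ α ∈ Q, Emb T α (G α)) ∧ ∀ α ∉ Q, ∀ u, Eval α u (E (α, u)) := by
  classical
  induction h with
  | empty =>
    exact ⟨univ, id, fun p => p.1, MeasurableSet.univ, measurable_id, measurable_fst,
      fun α _ t i hi => absurd hi (notMem_empty _), fun α hα => absurd (mem_univ α) hα⟩
  | node T _ ih =>
    choose Q G E hQ hG hE hemb hev using ih
    have hch : ∀ n m, MeasurableSet {α | child m α ∈ Q n} := fun n m => measurable_child m (hQ n)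
    have h0 : MeasurableSet {α : Lab | α [] = 0} :=
      (measurable_pi_apply []) (measurableSet_singleton 0)
    have hm : ∀ n, Measurable fun α => sInf {m | child m α ∈ Q n} := fun n =>
      measurable_sInf_setOf (hch n)
    let N : Lab → ℕ := fun α => sInf {n | ∀ m, child m α ∉ Q n}
    have hN : Measurable N := measurable_sInf_setOf fun n =>
      measurableSet_forall fun m => (hch n m).compl
    let G' : Lab → Lab := fun α q =>
      match q with
      | [] => 0
      | [n] => sInf {m | child m α ∈ Q n}
      | n :: k :: q => G n (child (sInf {m | child m α ∈ Q n}) α) (k :: q)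
    have hchild : ∀ {X : Type} [MeasurableSpace X] {f : X → Lab} {i : X → ℕ}, Measurable f →
        Measurable i → Measurable fun x => child (i x) (f x) := by
      intro X _ f i hf hi
      refine measurable_pi_lambda _ fun q => ?_
      exact measurable_apply_nat (f := fun x n => f x (n :: q))
        (measurable_pi_lambda _ fun n => (measurable_pi_apply (n :: q)).comp hf) hi
    have hG' : Measurable G' := by
      refine measurable_pi_lambda _ fun q => ?_
      rcases q with _ | ⟨n, _ | ⟨k, q⟩⟩
      · exact measurable_const
      · exact hm n
      · exact (measurable_pi_apply (k :: q)).comp ((hG n).comp (hchild measurable_id (hm n)))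
    let E' : Lab × NN → Lab := fun p =>
      if p.1 [] = 0 then evalNode fun m => E (N p.1) (child m p.1, p.2) else evalLeaf p.1 p.2
    have hE' : Measurable E' := by
      refine Measurable.ite (measurable_fst h0) ?_ measurable_evalLeaf
      refine measurable_evalNode.comp (measurable_pi_lambda _ fun m =>
        measurable_pi_lambda _ fun q => ?_)
      refine measurable_apply_nat (f := fun (p : Lab × NN) n => E n (child m p.1, p.2) q)
        (measurable_pi_lambda _ fun n => ?_) (hN.comp measurable_fst)
      exact (measurable_pi_apply q).comp ((hE n).comp
        (((measurable_child m).comp measurable_fst).prodMk measurable_snd))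
    refine ⟨{α | ((∃ i, [i] ∈ T) → α [] = 0) ∧ ∀ n, ∃ m, child m α ∈ Q n}, G', E', ?_, hG', hE',
      ?_, ?_⟩
    · refine MeasurableSet.inter (s₁ := {α : Lab | (∃ i, [i] ∈ T) → α [] = 0}) ?_
        (measurableSet_forall fun n => measurableSet_exists (hch n))
      by_cases hT : ∃ i, [i] ∈ T
      · have : {α : Lab | (∃ i, [i] ∈ T) → α [] = 0} = {α | α [] = 0} := by ext; simp [hT]
        rwa [this]
      · have : {α : Lab | (∃ i, [i] ∈ T) → α [] = 0} = univ := by ext; simp [hT]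
        rw [this]; exact MeasurableSet.univ
    · rintro α ⟨h1, h2⟩
      refine emb_iff.2 ⟨h1, fun i => ?_⟩
      have hmem : child (sInf {m | child m α ∈ Q i}) α ∈ Q i :=
        Nat.sInf_mem (s := {m | child m α ∈ Q i}) (h2 i)
      have key := hemb i _ hmem
      have hhom : ∀ (t : List ℕ) (g g' : Lab), (∀ k q, g (k :: q) = g' (k :: q)) →
          hom g t = hom g' t := by
        intro t g g' hgg
        cases t with
        | nil => rfl
        | cons k t =>
          have : child k g = child k g' := funext fun q => hgg k q
          simp only [hom, hgg, this]
      intro t j htj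
      have := key t j htj
      rw [hhom t (child i (G' α)) (G i (child (sInf {m | child m α ∈ Q i}) α)) fun k q => rfl]
      exact this
    · intro α hα u
      by_cases hα0 : α [] = 0
      · have hex : ∃ n, ∀ m, child m α ∉ Q n := by
          by_contra hcon
          push Not at hcon
          exact hα ⟨fun _ => hα0, hcon⟩
        have hspec : ∀ m, child m α ∉ Q (N α) :=
          Nat.sInf_mem (s := {n | ∀ m, child m α ∉ Q n}) hex
        simp only [E', hα0, if_true]
        exact eval_evalNode hα0 fun m => hev _ _ (hspec m) u
      · simp only [E', hα0, if_false]
        exact eval_evalLeaf hα0 u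

/-! ### Lexicographic infima -/

/-- The elements of `Ω` whose first `n` values are lexicographically minimal. -/
def lexMin (Ω : Set NN) : ℕ → Set NN
  | 0 => Ω
  | n + 1 => {w | w ∈ lexMin Ω n ∧ w n = sInf {m | ∃ w' ∈ lexMin Ω n, w' n = m}}

/-- The lexicographic infimum of `Ω`. -/
noncomputable def lexInf (Ω : Set NN) : NN := fun n => sInf {m | ∃ w ∈ lexMin Ω n, w n = m}

lemma lexMin_subset (Ω : Set NN) (n : ℕ) : lexMin Ω n ⊆ Ω := by
  induction n with
  | zero => exact subset_rfl
  | succ n ih => exact fun w hw => ih hw.1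

lemma lexInf_mem_closure {Ω : Set NN} (h : Ω.Nonempty) : lexInf Ω ∈ closure Ω := by
  have hne : ∀ n, (lexMin Ω n).Nonempty := by
    intro n
    induction n with
    | zero => exact h
    | succ n ih =>
      obtain ⟨w, hw⟩ := ih
      obtain ⟨w', hw', he⟩ :=
        Nat.sInf_mem (s := {m | ∃ w' ∈ lexMin Ω n, w' n = m}) ⟨_, w, hw, rfl⟩
      exact ⟨w', hw', he⟩
  choose w hw using hne
  have hag : ∀ n, ∀ w ∈ lexMin Ω n, ∀ i < n, w i = lexInf Ω i := by
    intro n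
    induction n with
    | zero => intro w _ i hi; omega
    | succ n ih =>
      intro w hw i hi
      rcases Nat.lt_succ_iff_lt_or_eq.1 hi with h1 | rfl
      · exact ih w hw.1 i h1
      · exact hw.2
  refine mem_closure_of_tendsto (f := w) (b := atTop) ?_
    (Eventually.of_forall fun n => lexMin_subset Ω n (hw n))
  refine tendsto_pi_nhds.2 fun i => tendsto_const_nhds.congr' ?_
  filter_upwards [eventually_gt_atTop i] with n hn using (hag n _ (hw n) i hn).symm

lemma measurable_lexInf {X ι : Type*} [MeasurableSpace X] [Countable ι] {P : ι → X → Prop}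
    {w : ι → X → NN} (hP : ∀ j, MeasurableSet {x | P j x}) (hw : ∀ j, Measurable (w j)) :
    Measurable fun x => lexInf {z | ∃ j, P j x ∧ w j x = z} := by
  have hwi : ∀ j n, Measurable fun x => w j x n := fun j n => (measurable_pi_apply n).comp (hw j)
  have key : ∀ n, (∀ j, MeasurableSet {x | P j x ∧ w j x ∈ lexMin {z | ∃ j, P j x ∧ w j x = z} n}) →
      Measurable fun x => lexInf {z | ∃ j, P j x ∧ w j x = z} n := by
    intro n h
    have : ∀ x, {m | ∃ z ∈ lexMin {z | ∃ j, P j x ∧ w j x = z} n, z n = m} =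
        {m | ∃ j, (P j x ∧ w j x ∈ lexMin {z | ∃ j, P j x ∧ w j x = z} n) ∧ w j x n = m} := by
      intro x
      ext m
      constructor
      · rintro ⟨z, hz, rfl⟩
        obtain ⟨j, h1, rfl⟩ := lexMin_subset _ _ hz
        exact ⟨j, ⟨h1, hz⟩, rfl⟩
      · rintro ⟨j, ⟨-, h2⟩, rfl⟩
        exact ⟨_, h2, rfl⟩
    simp only [lexInf, this]
    refine measurable_sInf_setOf fun m => measurableSet_exists fun j => (h j).inter ?_
    exact hwi j n (measurableSet_singleton m)
  have hmem : ∀ n j, MeasurableSet {x | P j x ∧ w j x ∈ lexMin {z | ∃ j, P j x ∧ w j x = z} n} := by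
    intro n
    induction n with
    | zero =>
      intro j
      have : {x | P j x ∧ w j x ∈ lexMin {z | ∃ j, P j x ∧ w j x = z} 0} = {x | P j x} := by
        ext x; exact ⟨fun h => h.1, fun h => ⟨h, j, h, rfl⟩⟩
      rw [this]; exact hP j
    | succ n ih =>
      intro j
      have : {x | P j x ∧ w j x ∈ lexMin {z | ∃ j, P j x ∧ w j x = z} (n + 1)} =
          {x | P j x ∧ w j x ∈ lexMin {z | ∃ j, P j x ∧ w j x = z} n} ∩
            {x | w j x n = lexInf {z | ∃ j, P j x ∧ w j x = z} n} := by
        ext x; exact ⟨fun h => ⟨⟨h.1, h.2.1⟩, h.2.2⟩, fun h => ⟨h.1.1, h.1.2, h.2⟩⟩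
      rw [this]
      exact (ih j).inter (measurableSet_eq_fun (hwi j n) (key n ih))
  exact measurable_pi_lambda _ fun n => key n (hmem n)

/-! ### Parameters whose closed set has finite Borel chromatic number -/

/-- The sequence obtained from `u` by deleting `n` entries and prepending `t`. -/
def graft (j : List ℕ × ℕ) (u : NN) : NN := fun i =>
  if i < j.1.length then j.1.getD i 0 else u (i - j.1.length + j.2)

lemma measurable_graft (j : List ℕ × ℕ) : Measurable (graft j) := by
  refine measurable_pi_lambda _ fun i => ?_
  by_cases h : i < j.1.length
  · simp only [graft, h, if_true]; exact measurable_const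
  · simp only [graft, h, if_false]; exact measurable_pi_apply _

lemma graft_nil (u : NN) : graft ([], 0) u = u := by funext i; simp [graft]

lemma graft_shiftNN (t : List ℕ) (n : ℕ) (u : NN) :
    graft (t, n) (shiftNN u) = graft (t, n + 1) u := by
  funext i; simp [graft, shiftNN, add_assoc]

lemma graft_zero (t : List ℕ) (u : NN) : graft (t, 0) u = graft (t ++ [u 0], 0) (shiftNN u) := by
  funext i
  simp only [graft, shiftNN, List.length_append, List.length_singleton]
  rcases lt_trichotomy i t.length with h | rfl | h
  · rw [if_pos h, if_pos (by omega), List.getD_append _ _ _ _ h]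
  · rw [if_neg (lt_irrefl _), if_pos (by omega), List.getD_append_right _ _ _ _ le_rfl]
    simp
  · rw [if_neg (by omega), if_neg (by omega)]
    congr 1
    omega

/-- Increasing sequences tail equivalent to `u`, carrying the same labelling, at which the
evaluated bits agree with those at the shift. -/
def TailEq (E : Lab × NN → Lab) (j : List ℕ × ℕ) (u : NN) : Prop :=
  StrictMono (graft j u) ∧ Coherent (graft j u) ∧ labelOf (graft j u) = labelOf u ∧
    bits (E (labelOf u, graft j u)) = bits (E (labelOf u, shiftNN (graft j u)))

def tailObstr (E : Lab × NN → Lab) (j : List ℕ × ℕ) (u : NN) : NN :=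
  mkEq (graft j u) (E (labelOf u, graft j u)) (E (labelOf u, shiftNN (graft j u)))

lemma tailSet_shiftNN (E : Lab × NN → Lab) {u : NN} (hc : Coherent u) :
    {z | ∃ j, TailEq E j (shiftNN u) ∧ tailObstr E j (shiftNN u) = z} =
      {z | ∃ j, TailEq E j u ∧ tailObstr E j u = z} := by
  ext z
  simp only [TailEq, tailObstr, hc.labelOf_shiftNN, mem_ofPred_eq]
  constructor
  · rintro ⟨⟨t, n⟩, h⟩
    rw [graft_shiftNN] at h
    exact ⟨(t, n + 1), h⟩
  · rintro ⟨⟨t, _ | n⟩, h⟩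
    · rw [graft_zero] at h
      exact ⟨(t ++ [u 0], 0), h⟩
    · rw [← graft_shiftNN] at h
      exact ⟨(t, n), h⟩

lemma measurable_mkEq : Measurable fun p : NN × Lab × Lab => mkEq p.1 p.2.1 p.2.2 := by
  refine measurable_pi_lambda _ fun n => ?_
  cases n with
  | zero => exact ((measurable_pi_apply 1).comp measurable_fst).add_const 1
  | succ n =>
    by_cases h0 : n % 3 = 0
    · simp only [mkEq, h0, if_true]; exact (measurable_pi_apply _).comp measurable_fst
    by_cases h1 : n % 3 = 1
    · simp only [mkEq, h1, one_ne_zero, if_true, if_false]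
      exact (measurable_pi_apply _).comp (measurable_fst.comp measurable_snd)
    · simp only [mkEq, h0, h1, if_false]
      exact (measurable_pi_apply _).comp (measurable_snd.comp measurable_snd)

lemma measurable_mkEmb (y : NN) : Measurable (mkEmb y) := by
  refine measurable_pi_lambda _ fun n => ?_
  by_cases h0 : n % 2 = 0
  · simp only [mkEmb, h0, if_true]; exact measurable_const
  · simp only [mkEmb, h0, if_false]; exact measurable_pi_apply _

/-- A measurable shift-invariant choice of obstructions. -/
lemma exists_invariant_obstr {T : NN → NN → Set (List ℕ)} {x y : NN} (hwf : IsWF (T x y)) :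
    ∃ (F : NN → NN) (b : NN → Bool × Bool), Measurable F ∧ Measurable b ∧
      ∀ u, StrictMono u → Coherent u → F (shiftNN u) = F u ∧
        (b u = b (shiftNN u) → Obstr T x (labelOf u) (F u)) := by
  classical
  obtain ⟨Q, G, E, hQ, hG, hE, hemb, hev⟩ := hwf.exists_emb_or_eval
  have hl := continuous_labelOf.measurable
  have hs := continuous_shiftNN.measurable
  have hbits := continuous_bits.measurable
  have hg : ∀ j, Measurable fun u => E (labelOf u, graft j u) := fun j =>
    hE.comp (hl.prodMk (measurable_graft j))
  have hg' : ∀ j, Measurable fun u => E (labelOf u, shiftNN (graft j u)) := fun j =>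
    hE.comp (hl.prodMk (hs.comp (measurable_graft j)))
  have hT : ∀ j, MeasurableSet {u | TailEq E j u} := by
    intro j
    refine MeasurableSet.inter (measurable_graft j isClosed_strictMono.measurableSet) ?_
    refine MeasurableSet.inter (measurable_graft j isClosed_coherent.measurableSet) ?_
    refine MeasurableSet.inter (measurableSet_eq_fun (hl.comp (measurable_graft j)) hl) ?_
    exact measurableSet_eq_fun (hbits.comp (hg j)) (hbits.comp (hg' j))
  have hO : ∀ j, Measurable (tailObstr E j) := fun j =>
    measurable_mkEq.comp ((measurable_graft j).prodMk ((hg j).prodMk (hg' j)))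
  refine ⟨fun u => if labelOf u ∈ Q then mkEmb y (G (labelOf u)) else
      lexInf {z | ∃ j, TailEq E j u ∧ tailObstr E j u = z},
    fun u => bits (E (labelOf u, u)), ?_, ?_, ?_⟩
  · exact Measurable.ite (hl hQ) ((measurable_mkEmb y).comp (hG.comp hl))
      (measurable_lexInf hT hO)
  · exact hbits.comp (hE.comp (hl.prodMk measurable_id))
  intro u hu hc
  refine ⟨?_, fun hb => ?_⟩
  · dsimp only
    rw [tailSet_shiftNN E hc, hc.labelOf_shiftNN]
  by_cases h : labelOf u ∈ Q
  · right
    simp only [h, if_true, witPart_mkEmb, embPart_mkEmb]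
    exact hemb _ h
  · left
    simp only [h, if_false]
    dsimp only at hb
    rw [hc.labelOf_shiftNN] at hb
    have hcl : IsClosed {ρ | ObstrEq (labelOf u) ρ} :=
      isClosed_obstrEq.preimage (Continuous.prodMk_right (labelOf u))
    refine hcl.closure_subset_iff.2 ?_ (lexInf_mem_closure ?_)
    · rintro _ ⟨j, ⟨h1, h2, h3, h4⟩, rfl⟩
      exact obstrEq_mkEq h1 h2 h3 (hev _ h _) (hev _ h _) h4
    · refine ⟨_, ([], 0), ?_, rfl⟩
      simp only [TailEq, graft_nil]
      exact ⟨hu, hc, trivial, hb⟩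

/-- The partial sums of `i ↦ f i + 1`. -/
def partialSum (f : NN) (k : ℕ) : ℕ := ∑ i ∈ Finset.range (k + 1), (f i + 1)

lemma strictMono_partialSum (f : NN) : StrictMono (partialSum f) := by
  refine strictMono_nat_of_lt_succ fun n => ?_
  rw [partialSum, partialSum, Finset.sum_range_succ _ (n + 1)]
  omega

lemma le_partialSum (f : NN) (k : ℕ) : f k ≤ partialSum f k := by
  rw [partialSum, Finset.sum_range_succ]
  omega

lemma measurable_partialSum (k : ℕ) : Measurable fun f => partialSum f k := by
  refine Finset.measurable_sum _ fun i _ => ?_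
  exact (measurable_pi_apply i).add_const 1

/-- Whether there is a partial sum of `f` in the interval `(m, n]` changes infinitely often
along the consecutive entries of `u`, unless a shift of `u` dominates `f`. -/
lemma exists_dominated {f u : NN} (hu : StrictMono u)
    (h : ∀ n, (∃ j, u n < partialSum f j ∧ partialSum f j ≤ u (n + 1)) ↔
      ∃ j, u 0 < partialSum f j ∧ partialSum f j ≤ u 1) : ∀ i, f i ≤ u (i + 1) := by
  by_cases h0 : ∃ j, u 0 < partialSum f j ∧ partialSum f j ≤ u 1
  · have key : ∀ k, partialSum f k ≤ u (k + 1) := by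
      intro k
      induction k with
      | zero =>
        obtain ⟨j, -, hj⟩ := h0
        exact ((strictMono_partialSum f).monotone (Nat.zero_le j)).trans hj
      | succ k ih =>
        obtain ⟨j, h1, h2⟩ := (h (k + 1)).2 h0
        have : k < j := (strictMono_partialSum f).lt_iff_lt.1 (ih.trans_lt h1)
        exact ((strictMono_partialSum f).monotone this).trans h2
    exact fun i => (le_partialSum f i).trans (key i)
  · exfalso
    have h1 : ∀ n, u n < partialSum f (u 0 + 1) := by
      intro n
      induction n with
      | zero => exact lt_of_lt_of_le (Nat.lt_succ_self _) ((strictMono_partialSum f).id_le _)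
      | succ n ih =>
        by_contra hcon
        exact h0 ((h n).1 ⟨_, ih, not_lt.1 hcon⟩)
    exact absurd (h1 (partialSum f (u 0 + 1))) (not_lt.2 (hu.id_le _))

lemma exists_borelColoringLE {T : NN → NN → Set (List ℕ)} {x y : NN} (hwf : IsWF (T x y)) :
    ∃ n, BorelColoringLE (closedOf T x) n := by
  classical
  obtain ⟨F, b, hF, hb, hinv⟩ := exists_invariant_obstr hwf
  let cross : NN → Bool := fun u =>
    if ∃ j, u 0 < partialSum (F u) j ∧ partialSum (F u) j ≤ u 1 then true else false
  have hcross : Measurable cross := by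
    have hp : ∀ j, Measurable fun u => partialSum (F u) j := fun j =>
      (measurable_partialSum j).comp hF
    refine Measurable.ite (measurableSet_exists fun j => ?_) measurable_const measurable_const
    exact (measurableSet_lt (measurable_pi_apply 0) (hp j)).inter
      (measurableSet_le (hp j) (measurable_pi_apply 1))
  have hsec : Measurable fun v : IncSeq => second v.1 :=
    continuous_second.measurable.comp measurable_subtype_coe
  obtain ⟨c, hc, hne⟩ := exists_coloring_of_label (isClosed_closedOf T x).measurableSet
    (lam := fun v => (b (second v.1), cross (second v.1)))
    ((hb.comp hsec).prodMk (hcross.comp hsec)) (by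
      intro v hv
      by_contra hcon
      push Not at hcon
      let u : ℕ → NN := fun n => second (shift^[n] v).1
      have hu : ∀ n, u (n + 1) = shiftNN (u n) := by
        intro n
        simp only [u, Function.iterate_succ_apply']
        rfl
      have hun : ∀ n i, u n i = u 0 (i + n) := by
        intro n
        induction n with
        | zero => intro i; rfl
        | succ n ih =>
          intro i
          rw [hu, shiftNN, ih]
          congr 1
          omega
      have hFn : ∀ n, F (u n) = F (u 0) := by
        intro n
        induction n with
        | zero => rfl
        | succ n ih => rw [hu, (hinv _ (hv n).1 (hv n).2.1).1, ih]
      have hobs : Obstr T x (labelOf (u 1)) (F (u 1)) := by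
        refine (hinv (u 1) (hv 1).1 (hv 1).2.1).2 ?_
        rw [← hu]
        exact congrArg Prod.fst (hcon 1)
      have hcr : ∀ n, cross (u n) = cross (u 0) := by
        intro n
        induction n with
        | zero => rfl
        | succ n ih => rw [← ih]; exact (congrArg Prod.snd (hcon n)).symm
      refine not_obstr_of_good (hv 1).2.2 (fun i => ?_) hobs
      change F (u 1) i ≤ u 1 i
      rw [hFn, hun]
      refine exists_dominated (f := F (u 0)) (u := u 0) (hv 0).1 (fun n => ?_) i
      have := hcr n
      simp only [cross, hFn, hun n, zero_add, Bool.if_false_right, Bool.and_true,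
        decide_eq_decide] at this
      rw [add_comm n 1]
      exact this)
  exact ⟨_, borelColoringLE_of_coloring hc hne⟩

end ShiftComplexity

namespace ShiftComplexity
open Filter Topology

/-! ### Hardness -/

lemma exists_tree_of_analyticSet {D : Set (NN × NN)} (hD : AnalyticSet D) :
    ∃ T : NN → NN → Set (List ℕ), (∀ s, IsOpen {p : NN × NN | s ∈ T p.1 p.2}) ∧
      (∀ x y s i, s ++ [i] ∈ T x y → s ∈ T x y) ∧
      ∀ x y, (x, y) ∈ D ↔ ∃ w, ∀ n, pre n w ∈ T x y := by
  rw [AnalyticSet] at hD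
  rcases hD with rfl | ⟨g, hg, rfl⟩
  · exact ⟨fun _ _ => ∅, fun s => by simp, fun _ _ _ _ h => h, fun x y => by simp⟩
  refine ⟨fun x y => {s | ∃ w, (∀ i < s.length, s.getD i 0 = w i) ∧
    ∀ i < s.length, (g w).1 i = x i ∧ (g w).2 i = y i}, ?_, ?_, ?_⟩
  · intro s
    rw [isOpen_iff_mem_nhds]
    rintro p ⟨w, h1, h2⟩
    filter_upwards [eventually_agree continuous_fst p s.length,
      eventually_agree continuous_snd p s.length] with q hq1 hq2
    exact ⟨w, h1, fun i hi => ⟨(h2 i hi).1.trans (hq1 i hi).symm,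
      (h2 i hi).2.trans (hq2 i hi).symm⟩⟩
  · rintro x y s k ⟨w, h1, h2⟩
    rw [List.length_append, List.length_singleton] at h1 h2
    refine ⟨w, fun i hi => ?_, fun i hi => h2 i (by omega)⟩
    rw [← h1 i (by omega), List.getD_append _ _ _ _ hi]
  · intro x y
    constructor
    · rintro ⟨w, hw⟩
      refine ⟨w, fun n => ⟨w, fun i hi => ?_, fun i _ => by rw [hw]; exact ⟨rfl, rfl⟩⟩⟩
      rw [length_pre] at hi
      exact getD_pre w hi
    · rintro ⟨w, hw⟩
      choose v h1 h2 using hw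
      simp only [length_pre] at h1 h2
      have hv : Tendsto v atTop (𝓝 w) := by
        refine tendsto_pi_nhds.2 fun i => tendsto_const_nhds.congr' ?_
        filter_upwards [eventually_gt_atTop i] with n hn
        rw [← h1 n i hn, getD_pre w hn]
      have hgv := (hg.tendsto w).comp hv
      have hxy : Tendsto (g ∘ v) atTop (𝓝 (x, y)) := by
        have hx : Tendsto (fun n => (g (v n)).1) atTop (𝓝 x) := by
          refine tendsto_pi_nhds.2 fun i => tendsto_const_nhds.congr' ?_
          filter_upwards [eventually_gt_atTop i] with n hn using (h2 n i hn).1.symm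
        have hy : Tendsto (fun n => (g (v n)).2) atTop (𝓝 y) := by
          refine tendsto_pi_nhds.2 fun i => tendsto_const_nhds.congr' ?_
          filter_upwards [eventually_gt_atTop i] with n hn using (h2 n i hn).2.symm
        exact hx.prodMk_nhds hy
      exact ⟨w, tendsto_nhds_unique hgv hxy⟩

lemma sigma12Hard_finiteBorelChromatic :
    Sigma12Hard {F : Effros IncSeq | ∃ n : ℕ, BorelColoringLE F.1 n} := by
  rintro Z _ _ _ _ A ⟨C, hC, rfl⟩
  let φ : Z → NN := fun z n => (MeasurableSpace.mapNatBool Z z n).toNat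
  have hφ : Measurable φ := by
    refine measurable_pi_lambda _ fun n => ?_
    exact (measurable_of_countable Bool.toNat).comp
      ((measurable_pi_apply n).comp (MeasurableSpace.measurable_mapNatBool Z))
  have hinj : Function.Injective φ := by
    intro z z' h
    refine MeasurableSpace.injective_mapNatBool Z (funext fun n => ?_)
    have h' : (MeasurableSpace.mapNatBool Z z n).toNat =
      (MeasurableSpace.mapNatBool Z z' n).toNat := congrFun h n
    generalize MeasurableSpace.mapNatBool Z z n = b at h'
    generalize MeasurableSpace.mapNatBool Z z' n = b' at h'
    cases b <;> cases b' <;> simp_all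
  have hD : AnalyticSet (Prod.map φ id '' Cᶜ) := by
    have hC : AnalyticSet Cᶜ := hC
    rw [AnalyticSet] at hC
    rcases hC with h | ⟨g, hg, h⟩
    · rw [h, image_empty]; exact analyticSet_empty
    · rw [← h, ← range_comp, ← image_univ]
      exact MeasurableSet.univ.analyticSet_image ((hφ.prodMap measurable_id).comp hg.measurable)
  obtain ⟨T, hT, hpre, hbr⟩ := exists_tree_of_analyticSet hD
  have hDC : ∀ z y, (φ z, y) ∈ Prod.map φ id '' Cᶜ ↔ (z, y) ∉ C := by
    intro z y
    constructor
    · rintro ⟨⟨z', y'⟩, h1, h2⟩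
      simp only [Prod.map_apply, id_eq, Prod.mk.injEq] at h2
      obtain ⟨h2, rfl⟩ := h2
      rw [← hinj h2]
      exact h1
    · exact fun h => ⟨(z, y), h, rfl⟩
  refine ⟨_, measurable_closedOf T hφ, fun z => ?_⟩
  constructor
  · rintro ⟨⟨z, y⟩, h, rfl⟩
    refine exists_borelColoringLE (y := y) (isWF_of_no_branch (hpre _ _) ?_)
    rw [← hbr, hDC]
    exact not_not.2 h
  · rintro ⟨n, hn⟩
    by_contra hcon
    refine not_borelColoringLE hT (x := φ z) (fun y => ?_) n hn
    rw [← hbr, hDC]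
    exact fun h => hcon ⟨(z, y), h, rfl⟩

/-! ### Complexity -/

lemma not_isCode_iff {α : Lab} : ¬ IsCode α ↔ ∃ w, ∀ n, α (pre n w) = 0 := by
  constructor
  · intro h
    refine exists_forall_pre {α | ¬ IsCode α} (fun α n => child n α) (fun α q => α q = 0) ?_
      (fun α n q hq => hq) ?_ h
    · intro α hα
      by_contra h0
      exact hα (IsCode.leaf α h0)
    · intro α hα
      by_contra hcon
      push Not at hcon
      exact hα (IsCode.node α fun n => not_not.1 (hcon n))
  · rintro ⟨w, hw⟩ h
    induction h generalizing w with
    | leaf α h0 => exact h0 (hw 0)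
    | node α _ ih => exact ih (w 0) (fun i => w (i + 1)) fun n => hw (n + 1)

lemma mAnalytic_image {X W : Type} [TopologicalSpace X] [PolishSpace X] [MeasurableSpace X]
    [BorelSpace X] [MeasurableSpace W] {D : Set X} (hD : IsClosed D) {g : X → W}
    (hg : Measurable g) : MAnalytic (g '' D) := by
  rcases D.eq_empty_or_nonempty with rfl | hne
  · exact Or.inl (image_empty g)
  · have := hD.polishSpace
    have := hne.to_subtype
    obtain ⟨f, hf, hsurj⟩ := PolishSpace.exists_nat_nat_continuous_surjective D
    refine Or.inr ⟨fun w => g (f w), hg.comp (continuous_subtype_val.comp hf).measurable, ?_⟩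
    ext z
    constructor
    · rintro ⟨x, hx, rfl⟩
      obtain ⟨w, hw⟩ := hsurj ⟨x, hx⟩
      exact ⟨w, by dsimp only; rw [hw]⟩
    · rintro ⟨w, rfl⟩
      exact ⟨f w, (f w).2, rfl⟩

lemma mAnalytic_union {W : Type} [MeasurableSpace W] {S S' : Set W} (hS : MAnalytic S)
    (hS' : MAnalytic S') : MAnalytic (S ∪ S') := by
  rcases hS with rfl | ⟨g, hg, rfl⟩
  · rwa [empty_union]
  rcases hS' with rfl | ⟨g', hg', rfl⟩
  · rw [union_empty]; exact Or.inr ⟨g, hg, rfl⟩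
  have ht : Measurable shiftNN := continuous_shiftNN.measurable
  refine Or.inr ⟨fun w => if w 0 = 0 then g (shiftNN w) else g' (shiftNN w),
    Measurable.ite ((measurable_pi_apply 0) (measurableSet_singleton 0)) (hg.comp ht)
      (hg'.comp ht), ?_⟩
  ext z
  constructor
  · rintro (⟨w, rfl⟩ | ⟨w, rfl⟩)
    · exact ⟨fun n => Nat.casesOn n 0 w, rfl⟩
    · exact ⟨fun n => Nat.casesOn n 1 w, rfl⟩
  · rintro ⟨w, rfl⟩
    by_cases h : w 0 = 0
    · exact Or.inl ⟨shiftNN w, by simp [h]⟩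
    · exact Or.inr ⟨shiftNN w, by simp [h]⟩

instance : SecondCountableTopology IncSeq :=
  Topology.IsInducing.subtypeVal.secondCountableTopology

instance : PolishSpace IncSeq := isClosed_strictMono.polishSpace

/-- The closed set enumerated densely by a sequence. -/
def closedRange (σ : ℕ → IncSeq) : Effros IncSeq := ⟨closure (range σ), isClosed_closure⟩

lemma measurable_closedRange : Measurable closedRange := by
  refine measurable_generateFrom ?_
  rintro _ ⟨U, hU, rfl⟩
  have : closedRange ⁻¹' {F | (F.1 ∩ U).Nonempty} = ⋃ n, {σ | σ n ∈ U} := by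
    ext σ
    simp only [mem_preimage, mem_ofPred_eq, closedRange, mem_iUnion]
    rw [closure_inter_open_nonempty_iff hU]
    constructor
    · rintro ⟨_, ⟨n, rfl⟩, h⟩
      exact ⟨n, h⟩
    · rintro ⟨n, h⟩
      exact ⟨_, ⟨n, rfl⟩, h⟩
  rw [this]
  exact MeasurableSet.iUnion fun n => measurable_pi_apply n hU.measurableSet

lemma exists_closedRange_eq {F : Effros IncSeq} (h : F.1.Nonempty) :
    ∃ σ, closedRange σ = F := by
  have := h.to_subtype
  obtain ⟨σ, hσ⟩ := TopologicalSpace.exists_dense_seq F.1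
  refine ⟨fun n => σ n, Subtype.ext (Subset.antisymm ?_ fun x hx => ?_)⟩
  · refine closure_minimal ?_ F.2
    rintro _ ⟨n, rfl⟩
    exact (σ n).2
  · have := closure_subtype.1 (hσ ⟨x, hx⟩)
    rwa [← range_comp] at this

/-- The labelling coded by an element of Baire space. -/
def labelling (y : NN) : Lab := fun p => y (Encodable.encode p)

lemma continuous_labelling : Continuous labelling := by
  unfold labelling; fun_prop

lemma labelling_surjective (α : Lab) : labelling (fun n => α (lst n)) = α := by
  funext p
  simp only [labelling, lst_encode]

/-- Some edge of the shift graph on `F` is monochromatic for the bits coded by `y`. -/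
def Mono (F : Effros IncSeq) (y : NN) : Prop :=
  ∃ u ∈ F.1, shift u ∈ F.1 ∧ ∃ r r', Eval (labelling y) u.1 r ∧
    Eval (labelling y) (shift u).1 r' ∧ bits r = bits r'

lemma exists_borelColoringLE_iff (F : Effros IncSeq) :
    (∃ n, BorelColoringLE F.1 n) ↔ ∃ y, IsCode (labelling y) ∧ ¬ Mono F y := by
  constructor
  · rintro ⟨n, hn⟩
    obtain ⟨b, hb, hne⟩ := exists_bits_of_borelColoringLE F.2.measurableSet hn
    obtain ⟨α, h1, -, h2⟩ := exists_codesBits hb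
    refine ⟨fun n => α (lst n), ?_⟩
    rw [Mono, labelling_surjective]
    refine ⟨h1, ?_⟩
    rintro ⟨u, hu, hsu, r, r', hr, hr', heq⟩
    rw [h2 u r hr, h2 _ r' hr'] at heq
    exact hne u hu hsu heq
  · rintro ⟨y, h1, h2⟩
    obtain ⟨E, hE, hev⟩ := h1.exists_eval
    refine ⟨_, borelColoringLE_of_coloring (c := fun u => bits (E u.1))
      (continuous_bits.measurable.comp (hE.comp measurable_subtype_coe)) fun u hu hsu heq => ?_⟩
    exact h2 ⟨u, hu, hsu, _, _, hev _, hev _, heq⟩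

lemma isClosed_zeroBranch : IsClosed {p : NN × NN | ∀ n, labelling p.1 (pre n p.2) = 0} := by
  refine isClosed_forall fun n => ?_
  have hpre : ∀ n (α : NN × NN → Lab) (w : NN × NN → NN), Continuous α → Continuous w →
      IsClosed {p | α p (pre n (w p)) = 0} := by
    intro n
    induction n with
    | zero =>
      intro α w hα _
      exact isClosed_setOf_discrete ((continuous_apply []).comp hα) (· = 0)
    | succ n ih =>
      intro α w hα hw
      refine ih (fun p => child (w p 0) (α p)) (fun p i => w p (i + 1)) ?_ (by fun_prop)
      refine continuous_pi fun q => ?_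
      exact continuous_apply_nat (f := fun p n => α p (n :: q))
        (continuous_pi fun n => (continuous_apply _).comp hα) ((continuous_apply 0).comp hw)
  exact hpre n _ _ (continuous_labelling.comp continuous_fst) continuous_snd

lemma continuous_shift : Continuous shift := by
  refine Continuous.subtype_mk (continuous_pi fun n => ?_) _
  exact (continuous_apply (n + 1)).comp continuous_subtype_val

lemma mSigma12_finiteBorelChromatic :
    MSigma12 {F : Effros IncSeq | ∃ n : ℕ, BorelColoringLE F.1 n} := by
  refine ⟨{p | IsCode (labelling p.2) ∧ ¬ Mono p.1 p.2}, ?_, ?_⟩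
  swap
  · ext F
    rw [mem_ofPred_eq, exists_borelColoringLE_iff]
    constructor
    · rintro ⟨y, h⟩
      exact ⟨(F, y), h, rfl⟩
    · rintro ⟨⟨F, y⟩, h, rfl⟩
      exact ⟨y, h⟩
  have : BorelSpace (NN × Lab × Lab) := Prod.borelSpace
  have : BorelSpace ((ℕ → IncSeq) × NN × NN) := Prod.borelSpace
  have : BorelSpace ((ℕ → IncSeq) × NN × Lab × Lab) := Prod.borelSpace
  let empt : Effros IncSeq := ⟨∅, isClosed_empty⟩
  have h1 : MAnalytic ((fun p : NN × NN => (empt, p.1)) ''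
      {p : NN × NN | ∀ n, labelling p.1 (pre n p.2) = 0}) :=
    mAnalytic_image isClosed_zeroBranch (measurable_const.prodMk measurable_fst)
  have h2 : MAnalytic ((fun p : (ℕ → IncSeq) × NN × NN => (closedRange p.1, p.2.1)) ''
      {p | ∀ n, labelling p.2.1 (pre n p.2.2) = 0}) :=
    mAnalytic_image (isClosed_zeroBranch.preimage continuous_snd)
      ((measurable_closedRange.comp measurable_fst).prodMk
        (measurable_fst.comp measurable_snd))
  have h3 : MAnalytic ((fun p : (ℕ → IncSeq) × NN × Lab × Lab => (closedRange p.1, p.2.1)) ''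
      {p | p.1 1 = shift (p.1 0) ∧ Eval (labelling p.2.1) (p.1 0).1 p.2.2.1 ∧
        Eval (labelling p.2.1) (shift (p.1 0)).1 p.2.2.2 ∧ bits p.2.2.1 = bits p.2.2.2}) := by
    refine mAnalytic_image ?_ ((measurable_closedRange.comp measurable_fst).prodMk
        (measurable_fst.comp measurable_snd))
    have c0 : Continuous fun p : (ℕ → IncSeq) × NN × Lab × Lab => p.1 0 := by fun_prop
    have c1 : Continuous fun p : (ℕ → IncSeq) × NN × Lab × Lab => p.1 1 := by fun_prop
    have cl : Continuous fun p : (ℕ → IncSeq) × NN × Lab × Lab => labelling p.2.1 :=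
      continuous_labelling.comp (by fun_prop)
    refine isClosed_and (isClosed_eq c1 (continuous_shift.comp c0)) ?_
    refine isClosed_and (isClosed_eval cl (continuous_subtype_val.comp c0) (by fun_prop)) ?_
    refine isClosed_and (isClosed_eval cl
      (continuous_subtype_val.comp (continuous_shift.comp c0)) (by fun_prop)) ?_
    exact isClosed_eq (continuous_bits.comp (by fun_prop)) (continuous_bits.comp (by fun_prop))
  convert mAnalytic_union (mAnalytic_union h1 h2) h3 using 1
  ext ⟨F, y⟩
  simp only [mem_compl_iff, mem_ofPred_eq, mem_union, mem_image, Prod.mk.injEq, not_and_or,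
    not_not, not_isCode_iff]
  constructor
  · rintro (⟨w, hw⟩ | ⟨u, hu, hsu, r, r', hr, hr', heq⟩)
    · left
      rcases F.1.eq_empty_or_nonempty with hF | hF
      · exact Or.inl ⟨(y, w), hw, Subtype.ext hF.symm, rfl⟩
      · obtain ⟨σ, hσ⟩ := exists_closedRange_eq hF
        exact Or.inr ⟨(σ, y, w), hw, hσ, rfl⟩
    · right
      obtain ⟨σ, rfl⟩ := exists_closedRange_eq ⟨u, hu⟩
      let τ : ℕ → IncSeq := fun n => Nat.casesOn n u fun n => Nat.casesOn n (shift u) σ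
      refine ⟨(τ, y, r, r'), ⟨rfl, hr, hr', heq⟩, Subtype.ext (Subset.antisymm ?_ ?_), rfl⟩
      · refine closure_minimal ?_ isClosed_closure
        rintro _ ⟨_ | _ | n, rfl⟩
        · exact hu
        · exact hsu
        · exact subset_closure ⟨n, rfl⟩
      · refine closure_mono ?_
        rintro _ ⟨n, rfl⟩
        exact ⟨n + 2, rfl⟩
  · rintro ((⟨⟨y, w⟩, hw, -, rfl⟩ | ⟨⟨σ, y, w⟩, hw, -, rfl⟩) |
      ⟨⟨σ, y, r, r'⟩, ⟨h0, hr, hr', heq⟩, rfl, rfl⟩)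
    · exact Or.inl ⟨w, hw⟩
    · exact Or.inl ⟨w, hw⟩
    · exact Or.inr ⟨σ 0, subset_closure ⟨0, rfl⟩, subset_closure ⟨1, h0⟩, r, r', hr, hr', heq⟩

end ShiftComplexity

/-- The collection of closed subsets `C ⊆ [ℕ]^ℕ` such that `G_S|_C` has finite Borel
chromatic number, viewed as a subset of the Effros Borel space `F([ℕ]^ℕ)`, is
`Σ¹₂`-complete (i.e. `Σ¹₂`-hard and itself `Σ¹₂`). -/
theorem finiteBorelChromatic_closed_subsets_Sigma12_complete :
    Sigma12Hard {F : Effros IncSeq | ∃ n : ℕ, BorelColoringLE F.1 n} ∧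
    MSigma12 {F : Effros IncSeq | ∃ n : ℕ, BorelColoringLE F.1 n} :=
  ⟨ShiftComplexity.sigma12Hard_finiteBorelChromatic,
    ShiftComplexity.mSigma12_finiteBorelChromatic⟩
end

section
/- Let U be a good universal closed subset of ℕ^ℕ × [ℕ]^ℕ, i.e., a closed set such that for every Polish space P and every closed C ⊆ P × [ℕ]^ℕ there is a Borel map f: P → ℕ^ℕ with U_{f(p)} = C_p for all p ∈ P. Then the set {x ∈ ℕ^ℕ : χ_B(G_S|_{U_x}) < ℵ₀} is Σ¹₂-complete. -/
open MeasureTheory Set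

/-- The list of the first `n` values of a sequence. -/
def preL (b : NN) (n : ℕ) : List ℕ := (List.range n).map b

@[simp] lemma length_preL (b : NN) (n : ℕ) : (preL b n).length = n := by simp [preL]

lemma preL_succ (b : NN) (n : ℕ) : preL b (n + 1) = preL b n ++ [b n] := by
  simp [preL, List.range_succ]

lemma getD_preL (b : NN) {n i : ℕ} (h : i < n) (d : ℕ) : (preL b n).getD i d = b i := by
  simp [preL, h]

lemma take_preL (b : NN) {n i : ℕ} (h : i ≤ n) : (preL b n).take i = preL b i := by
  simp [preL, ← List.map_take, List.take_range, h]

lemma mem_preL {b : NN} {n k : ℕ} : k ∈ preL b n ↔ ∃ i < n, b i = k := by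
  simp [preL]

lemma preL_eq_iff {b b' : NN} {n : ℕ} : preL b n = preL b' n ↔ ∀ i < n, b i = b' i := by
  simp [preL, List.map_inj_left]

lemma tail_preL (b : NN) (n : ℕ) : (preL b (n + 1)).tail = preL (fun i => b (i + 1)) n := by
  simp [preL, List.range_succ_eq_map, Function.comp_def]

/-- `Wins P a`: there is a strategy with moves that are large for a fixed ultrafilter, all of whose
outcomes extending `a` lie in `P`. -/
def Wins (P : Set NN) (a : List ℕ) : Prop :=
  ∃ A : List ℕ → Set ℕ, (∀ t, A t ∈ Filter.hyperfilter ℕ) ∧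
    ∀ x : NN, preL x a.length = a → (∀ n ≥ a.length, x n ∈ A (preL x n)) → x ∈ P

lemma Wins.mono {P Q : Set NN} {a : List ℕ} (h : Wins P a) (hPQ : P ⊆ Q) : Wins Q a := by
  obtain ⟨A, hA, h⟩ := h
  exact ⟨A, hA, fun x h1 h2 => hPQ (h x h1 h2)⟩

lemma Wins.of_eventually {P : Set NN} {a : List ℕ}
    (h : {m | Wins P (a ++ [m])} ∈ Filter.hyperfilter ℕ) : Wins P a := by
  classical
  have hB : ∀ m, ∃ A : List ℕ → Set ℕ, (∀ t, A t ∈ Filter.hyperfilter ℕ) ∧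
      (Wins P (a ++ [m]) → ∀ x : NN, preL x (a ++ [m]).length = (a ++ [m]) →
        (∀ n ≥ (a ++ [m]).length, x n ∈ A (preL x n)) → x ∈ P) := by
    intro m
    by_cases hm : Wins P (a ++ [m])
    · obtain ⟨A, hA, h⟩ := hm
      exact ⟨A, hA, fun _ => h⟩
    · exact ⟨fun _ => univ, fun _ => Filter.univ_mem, fun h => absurd h hm⟩
  choose B hB1 hB2 using hB
  refine ⟨fun t => if t.length ≤ a.length then {m | Wins P (a ++ [m])}
    else B (t.getD a.length 0) t, fun t => ?_, fun x hx hA => ?_⟩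
  · dsimp only
    split_ifs
    exacts [h, hB1 _ _]
  · refine hB2 (x a.length) ?_ x ?_ fun n hn => ?_
    · simpa using hA a.length le_rfl
    · simp [preL_succ, hx]
    · simp only [List.length_append, List.length_singleton] at hn
      have := hA n (by omega)
      beta_reduce at this
      rwa [length_preL, if_neg (by omega), getD_preL _ (by omega)] at this

/-- Every position is won by one of the two players. -/
def Decided (P : Set NN) : Prop := ∀ a, Wins P a ∨ Wins Pᶜ a

lemma decided_coord (i j : ℕ) : Decided {x | x i = j} := by
  have key : ∀ d (a : List ℕ), i + 1 - a.length = d →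
      Wins {x : NN | x i = j} a ∨ Wins {x : NN | x i = j}ᶜ a := by
    intro d
    induction d with
    | zero =>
      intro a ha
      have hx : ∀ x : NN, preL x a.length = a → x i = a.getD i 0 := by
        intro x hx
        rw [← hx, getD_preL _ (by omega)]
      by_cases h : a.getD i 0 = j
      · exact .inl ⟨fun _ => univ, fun _ => Filter.univ_mem, fun x h1 _ => (hx x h1).trans h⟩
      · refine .inr ⟨fun _ => univ, fun _ => Filter.univ_mem, fun x h1 _ h2 => h ?_⟩
        rw [← hx x h1]; exact h2
    | succ d ih =>
      intro a ha
      by_cases h : {m | Wins {x : NN | x i = j} (a ++ [m])} ∈ Filter.hyperfilter ℕ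
      · exact .inl (.of_eventually h)
      · refine .inr (.of_eventually ?_)
        rw [← Ultrafilter.compl_mem_iff_notMem] at h
        filter_upwards [h] with m hm
        exact (ih (a ++ [m]) (by simp; omega)).resolve_left hm
  exact fun a => key _ a rfl

lemma Decided.compl {P : Set NN} (h : Decided P) : Decided Pᶜ := fun a => by
  rw [compl_compl]; exact (h a).symm

lemma Decided.iUnion {P : ℕ → Set NN} (h : ∀ i, Decided (P i)) : Decided (⋃ i, P i) := by
  classical
  intro a
  by_contra! hcon
  obtain ⟨hbad, hbad2⟩ := hcon
  have hB : ∀ u i, ∃ A : List ℕ → Set ℕ, (∀ t, A t ∈ Filter.hyperfilter ℕ) ∧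
      (¬ Wins (⋃ i, P i) u → ∀ x : NN, preL x u.length = u →
        (∀ n ≥ u.length, x n ∈ A (preL x n)) → x ∈ (P i)ᶜ) := by
    intro u i
    by_cases hu : Wins (P i) u
    · exact ⟨fun _ => univ, fun _ => Filter.univ_mem,
        fun h => absurd (hu.mono (subset_iUnion P i)) h⟩
    · obtain ⟨A, hA, h⟩ := (h i u).resolve_left hu
      exact ⟨A, hA, fun _ => h⟩
  choose B hB1 hB2 using hB
  refine hbad2 ⟨fun t => {m | ¬ Wins (⋃ i, P i) t → ¬ Wins (⋃ i, P i) (t ++ [m])} ∩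
    ⋂ j ∈ Finset.range (t.length + 1), B (t.take j) (j - a.length) t, fun t => ?_, ?_⟩
  · refine Filter.inter_mem ?_ ((Filter.biInter_finset_mem _).2 fun j _ => hB1 _ _ _)
    by_cases ht : Wins (⋃ i, P i) t
    · simp [ht]
    · have : {m | Wins (⋃ i, P i) (t ++ [m])} ∉ Filter.hyperfilter ℕ :=
        fun h => ht (.of_eventually h)
      rw [← Ultrafilter.compl_mem_iff_notMem] at this
      filter_upwards [this] with m hm _ using hm
  · intro x hx hA
    have hb : ∀ n ≥ a.length, ¬ Wins (⋃ i, P i) (preL x n) := by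
      intro n hn
      induction n, hn using Nat.le_induction with
      | base => rwa [hx]
      | succ n hn ih =>
        rw [preL_succ]
        exact (hA n hn).1 ih
    simp only [compl_iUnion, mem_iInter]
    intro i
    refine hB2 (preL x (a.length + i)) i (hb _ (by omega)) x (by simp) fun n hn => ?_
    rw [length_preL] at hn
    have := mem_iInter₂.1 (hA n (by omega)).2 (a.length + i) (by simp; omega)
    rwa [take_preL _ hn, Nat.add_sub_cancel_left] at this

lemma measurableSet_NN_induction {motive : Set NN → Prop}
    (coord : ∀ i j, motive {x | x i = j}) (compl : ∀ P, motive P → motive Pᶜ)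
    (iUnion : ∀ P : ℕ → Set NN, (∀ i, motive (P i)) → motive (⋃ i, P i)) {P : Set NN}
    (hP : MeasurableSet P) : motive P := by
  have e : (MeasurableSpace.pi : MeasurableSpace NN) =
      MeasurableSpace.generateFrom {s | ∃ i j : ℕ, s = {x | x i = j}} := by
    apply le_antisymm
    · refine iSup_le fun i => ?_
      rw [← measurable_iff_comap_le]
      refine @measurable_to_countable' _ _ _ _ (_) _ fun j => ?_
      exact MeasurableSpace.measurableSet_generateFrom ⟨i, j, rfl⟩
    · refine MeasurableSpace.generateFrom_le ?_
      rintro _ ⟨i, j, rfl⟩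
      exact measurable_pi_apply (X := fun _ => ℕ) i (measurableSet_singleton j)
  rw [e] at hP
  induction hP with
  | basic s hs => obtain ⟨i, j, rfl⟩ := hs; exact coord i j
  | empty =>
    convert compl _ (iUnion (fun j => {x | x 0 = j}) fun j => coord 0 j)
    ext x
    simp
  | compl s _ ih => exact compl _ ih
  | iUnion f _ ih => exact iUnion _ ih

lemma decided_of_measurableSet {P : Set NN} (hP : MeasurableSet P) : Decided P :=
  measurableSet_NN_induction decided_coord (fun _ => Decided.compl) (fun _ => Decided.iUnion) hP

lemma exists_follow {B : List ℕ → Set ℕ} (hB : ∀ t, (B t).Nonempty) :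
    ∃ x : NN, ∀ n, x n ∈ B (preL x n) := by
  choose f hf using hB
  let L : ℕ → List ℕ := fun n => Nat.rec [] (fun _ t => t ++ [f t]) n
  have hL : ∀ n, L (n + 1) = L n ++ [f (L n)] := fun n => rfl
  have : ∀ n, preL (fun n => f (L n)) n = L n := by
    intro n
    induction n with
    | zero => rfl
    | succ n ih => rw [preL_succ, ih, hL]
  exact ⟨fun n => f (L n), fun n => by rw [this]; exact hf _⟩

lemma Wins.iInter_nonempty {ι : Type} [Finite ι] {P : ι → Set NN} (h : ∀ i, Wins (P i) []) :
    (⋂ i, P i).Nonempty := by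
  choose A hA hP using h
  obtain ⟨x, hx⟩ := exists_follow (B := fun t => ⋂ i, A i t) fun t =>
    Filter.NeBot.nonempty_of_mem inferInstance (Filter.iInter_mem.2 fun i => hA i t)
  exact ⟨x, mem_iInter.2 fun i => hP i x rfl fun n _ => mem_iInter.1 (hx n) i⟩

lemma measurableSet_strictMono : MeasurableSet {x : NN | StrictMono x} := by
  have : {x : NN | StrictMono x} = ⋂ n, {x : NN | x n < x (n + 1)} := by
    ext x
    simp only [mem_ofPred_eq, mem_iInter]
    exact ⟨fun h n => h (Nat.lt_succ_self n), strictMono_nat_of_lt_succ⟩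
  rw [this]
  exact .iInter fun n => measurableSet_lt (measurable_pi_apply _) (measurable_pi_apply _)

/-- The shift graph has no finite Borel coloring: every Borel map to a finite set takes the same
value at some `s` and its shift. -/
lemma exists_monochromatic_shift {α : Type} [Finite α] [MeasurableSpace α]
    [MeasurableSingletonClass α] (c : IncSeq → α) (hc : Measurable c) :
    ∃ s, c s = c (shift s) := by
  classical
  have hP : ∀ i, MeasurableSet (Subtype.val '' (c ⁻¹' {i})) := fun i =>
    MeasurableSet.subtype_image measurableSet_strictMono (hc (measurableSet_singleton i))
  have hmono : Wins {x : NN | StrictMono x} [] := by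
    refine ⟨fun t => ⋂ m ∈ t.toFinset, Ioi m, fun t => ?_, fun x _ hx => ?_⟩
    · refine (Filter.biInter_finset_mem _).2 fun m _ => ?_
      apply Filter.mem_hyperfilter_of_finite_compl
      simp [finite_Iic m]
    · refine strictMono_nat_of_lt_succ fun n => ?_
      exact mem_iInter₂.1 (hx (n + 1) (Nat.zero_le _)) (x n)
        (by simpa using mem_preL.2 ⟨n, by omega, rfl⟩)
  obtain ⟨i, A, hA, hi⟩ : ∃ i, Wins (Subtype.val '' (c ⁻¹' {i})) [] := by
    by_contra! hcon
    have h1 : ∀ o : Option α, Wins (o.elim {x : NN | StrictMono x}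
        fun i => (Subtype.val '' (c ⁻¹' {i}))ᶜ) [] := by
      rintro (_ | i)
      · exact hmono
      · exact (decided_of_measurableSet (hP i) []).resolve_left (hcon i)
    obtain ⟨x, hx⟩ := Wins.iInter_nonempty h1
    rw [mem_iInter] at hx
    exact hx (some (c ⟨x, hx none⟩)) ⟨⟨x, hx none⟩, rfl, rfl⟩
  obtain ⟨M, hM, hMm⟩ := hmono
  obtain ⟨x, hx⟩ := exists_follow (B := fun t => (M t ∩ A t) ∩ A t.tail) fun t =>
    Filter.NeBot.nonempty_of_mem inferInstance
      (Filter.inter_mem (Filter.inter_mem (hM t) (hA t)) (hA t.tail))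
  have hxm : StrictMono x := hMm x rfl fun n _ => (hx n).1.1
  obtain ⟨y, hy, hyx⟩ := hi x rfl fun n _ => (hx n).1.2
  obtain ⟨y', hy', hyx'⟩ := hi (shift ⟨x, hxm⟩).1 rfl fun n _ => by
    have := (hx (n + 1)).2
    rwa [tail_preL] at this
  have e1 : y = ⟨x, hxm⟩ := Subtype.ext hyx
  have e2 := Subtype.ext hyx'
  subst e1 e2
  exact ⟨_, hy.trans hy'.symm⟩

/-- The initial value of a sequence of truth values, together with the parity of the first
change. -/
def changeColor (P : ℕ → Prop) : Prop × Prop :=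
  (P 0, ∃ n, Even n ∧ ¬ (P n ↔ P (n + 1)) ∧ ∀ m < n, (P m ↔ P (m + 1)))

lemma changeColor_ne_shift {P : ℕ → Prop} (h : ∃ n, ¬ (P n ↔ P (n + 1))) :
    changeColor P ≠ changeColor (fun n => P (n + 1)) := by
  classical
  intro heq
  simp only [changeColor, Prod.mk.injEq, eq_iff_iff] at heq
  obtain ⟨h0, h1⟩ := heq
  obtain ⟨n, hn, hmin⟩ : ∃ n, ¬ (P n ↔ P (n + 1)) ∧ ∀ m < n, (P m ↔ P (m + 1)) :=
    ⟨Nat.find h, Nat.find_spec h, fun m hm => not_not.1 (Nat.find_min h hm)⟩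
  obtain _ | n := n
  · exact hn h0
  have uniq : ∀ k, ¬ (P k ↔ P (k + 1)) → (∀ m < k, (P m ↔ P (m + 1))) → k = n + 1 := by
    intro k hk hk'
    rcases lt_trichotomy k (n + 1) with hlt | heq | hgt
    · exact absurd (hmin _ hlt) hk
    · exact heq
    · exact absurd (hk' _ hgt) hn
  have e1 : (∃ k, Even k ∧ ¬ (P k ↔ P (k + 1)) ∧ ∀ m < k, (P m ↔ P (m + 1))) ↔ Even (n + 1) :=
    ⟨fun ⟨k, h1, h2, h3⟩ => uniq k h2 h3 ▸ h1, fun h => ⟨_, h, hn, hmin⟩⟩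
  have e2 : (∃ k, Even k ∧ ¬ (P (k + 1) ↔ P (k + 1 + 1)) ∧
      ∀ m < k, (P (m + 1) ↔ P (m + 1 + 1))) ↔ Even n := by
    constructor
    · rintro ⟨k, h1, h2, h3⟩
      have := uniq (k + 1) h2 fun m hm => by
        obtain _ | m := m
        · exact h0
        · exact h3 m (by omega)
      rwa [show k = n by omega] at h1
    · exact fun h => ⟨n, h, hn, fun m hm => hmin _ (by omega)⟩
  rw [e1, e2, Nat.even_add_one] at h1
  tauto

lemma measurable_changeColor {Ω : Type*} [MeasurableSpace Ω] {P : ℕ → Ω → Prop}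
    (hP : ∀ n, Measurable (P n)) : Measurable fun ω => changeColor fun n => P n ω := by
  have hi : ∀ n, Measurable fun ω => (P n ω ↔ P (n + 1) ω) := fun n => (hP n).iff (hP (n + 1))
  exact (hP 0).prodMk (.exists fun n => measurable_const.and ((hi n).not.and
    (.forall fun m => .forall fun _ => hi m)))

/-- A strictly increasing sequence above `y`. -/
def incMajorant (y : NN) (i : ℕ) : ℕ := i + ∑ j ∈ Finset.range (i + 1), y j

lemma strictMono_incMajorant (y : NN) : StrictMono (incMajorant y) :=
  strictMono_nat_of_lt_succ fun n => by
    rw [incMajorant, incMajorant, Finset.sum_range_succ _ (n + 1)]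
    omega

lemma le_incMajorant (y : NN) (i : ℕ) : y i ≤ incMajorant y i := by
  rw [incMajorant, Finset.sum_range_succ]
  omega

/-- A finite coloring separating `s` from its shift whenever `s` does not dominate `y`. -/
def escapeColor (y s : NN) : (Prop × Prop) × (Prop × Prop) :=
  (changeColor fun n => ∀ i, incMajorant y i ≤ s (n + i),
   changeColor fun n => ∃ j, s n < incMajorant y j ∧ incMajorant y j ≤ s (n + 1))

lemma escapeColor_ne {y s : NN} (hs : StrictMono s) (h : ¬ ∀ i, y i ≤ s i) :
    escapeColor y s ≠ escapeColor y (fun n => s (n + 1)) := by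
  intro heq
  simp only [escapeColor, Prod.mk.injEq] at heq
  obtain ⟨h1, h2⟩ := heq
  have hY := strictMono_incMajorant y
  have hn0 : ¬ ∀ i, incMajorant y i ≤ s (0 + i) :=
    fun h' => h fun i => (le_incMajorant y i).trans (by simpa using h' i)
  have never : ∀ n, ¬ ∀ i, incMajorant y i ≤ s (n + i) := by
    intro n
    induction n with
    | zero => exact hn0
    | succ n ih =>
      by_contra hc
      refine changeColor_ne_shift (P := fun n => ∀ i, incMajorant y i ≤ s (n + i))
        ⟨n, fun h => ih (h.2 hc)⟩ ?_
      simpa [Nat.add_right_comm] using h1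
  refine changeColor_ne_shift
    (P := fun n => ∃ j, s n < incMajorant y j ∧ incMajorant y j ≤ s (n + 1)) ?_ h2
  by_contra! hconst
  have hall : ∀ n, (∃ j, s n < incMajorant y j ∧ incMajorant y j ≤ s (n + 1)) ↔
      ∃ j, s 0 < incMajorant y j ∧ incMajorant y j ≤ s (0 + 1) := by
    intro n
    induction n with
    | zero => rfl
    | succ n ih => rw [← hconst n, ih]
  by_cases h0 : ∃ j, s 0 < incMajorant y j ∧ incMajorant y j ≤ s (0 + 1)
  · refine never 1 fun i => ?_
    induction i with
    | zero =>
      obtain ⟨j, _, hj⟩ := h0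
      exact (hY.monotone (Nat.zero_le j)).trans hj
    | succ i ih =>
      obtain ⟨j, hj1, hj2⟩ := (hall (1 + i)).2 h0
      exact (hY.monotone (hY.lt_iff_lt.1 (ih.trans_lt hj1))).trans hj2
  · have hb : ∀ n, s n < incMajorant y (s 0 + 1) := by
      intro n
      induction n with
      | zero => exact Nat.lt_of_succ_le (hY.le_apply (x := s 0 + 1))
      | succ n ih =>
        by_contra! hc
        exact h0 ((hall n).1 ⟨_, ih, hc⟩)
    exact (hb (incMajorant y (s 0 + 1))).not_ge hs.le_apply

lemma measurable_escapeColor {Ω : Type*} [MeasurableSpace Ω] {y s : Ω → NN} (hy : Measurable y)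
    (hs : Measurable s) : Measurable fun ω => escapeColor (y ω) (s ω) := by
  have hY : ∀ i, Measurable fun ω => incMajorant (y ω) i := fun i => by
    simp only [incMajorant]
    exact measurable_const.add
      (Finset.measurable_sum _ fun j _ => (measurable_pi_apply j).comp hy)
  have hS : ∀ i, Measurable fun ω => s ω i := fun i => (measurable_pi_apply i).comp hs
  refine (measurable_changeColor fun n => .forall fun i => ?_).prodMk
    (measurable_changeColor fun n => .exists fun i => .and ?_ ?_)
  · exact measurableSet_setOfPred.1 (measurableSet_le (hY i) (hS _))
  · exact measurableSet_setOfPred.1 (measurableSet_lt (hS _) (hY i))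
  · exact measurableSet_setOfPred.1 (measurableSet_le (hY i) (hS _))

/-- The `k`-th subbasic clopen subset of the Baire space. -/
def leaf (k : ℕ) : Set NN := {v | v k.unpair.1 = k.unpair.2}

/-- The child relation on the inner nodes of a labelled tree. -/
def codeRel (L : List ℕ → ℕ) (τ σ : List ℕ) : Prop := L σ = 0 ∧ ∃ m, τ = σ ++ [m]

/-- `E` assigns to each node of the Borel code `L` the set it codes: `leaf k` at a node labelled
`k + 1`, and the complement of the union of the sets of the children at a node labelled `0`. -/
structure IsValuation (L : List ℕ → ℕ) (E : List ℕ → Set NN) : Prop where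
  leaf : ∀ σ k, L σ = k + 1 → E σ = leaf k
  nor : ∀ σ, L σ = 0 → E σ = ⋂ m, (E (σ ++ [m]))ᶜ

/-- `e` certifies the membership of `v` in the sets coded by `L`: the value `0` stands for
membership, and the value `m + 1` at an inner node for membership in the `m`-th child. -/
def Correct (L : List ℕ → ℕ) (v : NN) (e : List ℕ → ℕ) : Prop :=
  ∀ σ m, (L σ = m + 1 → (e σ = 0 ↔ v ∈ leaf m)) ∧ (L σ = 0 → e σ = 0 → e (σ ++ [m]) ≠ 0) ∧
    (L σ = 0 → e σ = m + 1 → e (σ ++ [m]) = 0)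

lemma measurableSet_leaf (k : ℕ) : MeasurableSet (leaf k) :=
  measurable_pi_apply (X := fun _ => ℕ) k.unpair.1 (measurableSet_singleton k.unpair.2)

lemma exists_isValuation {L : List ℕ → ℕ} (hL : WellFounded (codeRel L)) :
    ∃ E, IsValuation L E ∧ ∀ σ, MeasurableSet (E σ) := by
  let E : List ℕ → Set NN := hL.fix fun σ rec =>
    if h : L σ = 0 then ⋂ m, (rec (σ ++ [m]) ⟨h, m, rfl⟩)ᶜ else leaf (L σ - 1)
  have hE : ∀ σ, E σ = if L σ = 0 then ⋂ m, (E (σ ++ [m]))ᶜ else leaf (L σ - 1) := by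
    intro σ
    rw [show E σ = _ from hL.fix_eq _ σ]
    split_ifs <;> rfl
  refine ⟨E, ⟨fun σ k h => ?_, fun σ h => ?_⟩, fun σ => ?_⟩
  · rw [hE, h]; simp
  · rw [hE, if_pos h]
  · induction σ using hL.induction with
    | _ σ ih =>
      rw [hE]
      split_ifs with h
      · exact .iInter fun m => (ih _ ⟨h, m, rfl⟩).compl
      · exact measurableSet_leaf _

lemma Correct.eq_zero_iff {L : List ℕ → ℕ} (hL : WellFounded (codeRel L)) {E : List ℕ → Set NN}
    (hE : IsValuation L E) {v : NN} {e : List ℕ → ℕ} (he : Correct L v e) (σ : List ℕ) :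
    e σ = 0 ↔ v ∈ E σ := by
  induction σ using hL.induction with
  | _ σ ih =>
    rcases hl : L σ with _ | k
    · rw [hE.nor σ hl, mem_iInter]
      have ih' := fun m => ih _ ⟨hl, m, rfl⟩
      simp only [mem_compl_iff, ← ih']
      refine ⟨fun h m => (he σ m).2.1 hl h, fun h => ?_⟩
      by_contra h0
      obtain ⟨m, hm⟩ := Nat.exists_eq_succ_of_ne_zero h0
      exact h m ((he σ m).2.2 hl hm)
    · rw [hE.leaf σ k hl]
      exact (he σ k).1 hl

lemma exists_correct {L : List ℕ → ℕ} {E : List ℕ → Set NN} (hE : IsValuation L E) (v : NN) :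
    ∃ e, Correct L v e := by
  classical
  have h : ∀ σ, ∃ n, (n = 0 ↔ v ∈ E σ) ∧ ∀ m, L σ = 0 → n = m + 1 → v ∈ E (σ ++ [m]) := by
    intro σ
    by_cases hv : v ∈ E σ
    · exact ⟨0, by simp [hv], by simp⟩
    · by_cases hl : L σ = 0
      · have hv' := hv
        rw [hE.nor σ hl] at hv'
        simp only [mem_iInter, mem_compl_iff, not_forall, not_not] at hv'
        obtain ⟨m, hm⟩ := hv'
        exact ⟨m + 1, by simp [hv], fun m' _ h' => by rwa [← Nat.succ_injective h']⟩
      · exact ⟨1, by simp [hv], fun m h => absurd h hl⟩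
  choose e he1 he2 using h
  refine ⟨e, fun σ m => ⟨fun hl => ?_, fun hl h0 h1 => ?_, fun hl h0 => ?_⟩⟩
  · rw [he1, hE.leaf σ m hl]
  · rw [he1] at h0 h1
    rw [hE.nor σ hl] at h0
    exact mem_iInter.1 h0 m h1
  · exact (he1 _).2 (he2 σ m hl h0)

/-- The code of the complement of a union, from codes of the members. -/
def graft (L : ℕ → List ℕ → ℕ) : List ℕ → ℕ
  | [] => 0
  | i :: σ => L i σ

lemma wellFounded_graft {L : ℕ → List ℕ → ℕ} (hL : ∀ i, WellFounded (codeRel (L i))) :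
    WellFounded (codeRel (graft L)) := by
  have h : ∀ i σ, Acc (codeRel (graft L)) (i :: σ) := by
    intro i σ
    induction σ using (hL i).induction with
    | _ σ ih =>
      refine ⟨_, ?_⟩
      rintro _ ⟨h0, m, rfl⟩
      exact ih _ ⟨h0, m, rfl⟩
  refine ⟨fun σ => ?_⟩
  rcases σ with _ | ⟨i, σ⟩
  · refine ⟨_, ?_⟩
    rintro _ ⟨_, m, rfl⟩
    exact h m []
  · exact h i σ

lemma exists_isValuation_graft {L : ℕ → List ℕ → ℕ} {E : ℕ → List ℕ → Set NN}
    (hE : ∀ i, IsValuation (L i) (E i)) :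
    ∃ F, IsValuation (graft L) F ∧ ∀ i, F [i] = E i [] := by
  let F : List ℕ → Set NN
    | [] => ⋂ m, (E m [])ᶜ
    | i :: σ => E i σ
  refine ⟨F, ⟨fun σ k h => ?_, fun σ h => ?_⟩, fun i => rfl⟩
  · rcases σ with _ | ⟨i, σ⟩
    · cases h
    · exact (hE i).leaf σ k h
  · rcases σ with _ | ⟨i, σ⟩
    · rfl
    · exact (hE i).nor σ h

/-- The set `P` has a well-founded code. -/
def HasCode (P : Set NN) : Prop :=
  ∃ L, WellFounded (codeRel L) ∧ ∃ E, IsValuation L E ∧ E [] = P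

lemma HasCode.nor {P : ℕ → Set NN} (h : ∀ i, HasCode (P i)) : HasCode (⋂ i, (P i)ᶜ) := by
  choose L hL E hE hP using h
  obtain ⟨F, hF, hFE⟩ := exists_isValuation_graft hE
  refine ⟨graft L, wellFounded_graft hL, F, hF, ?_⟩
  rw [hF.nor [] rfl]
  simp [hFE, hP]

lemma HasCode.compl {P : Set NN} (h : HasCode P) : HasCode Pᶜ := by
  have := HasCode.nor fun _ : ℕ => h
  rwa [iInter_const] at this

lemma hasCode_of_measurableSet {P : Set NN} (hP : MeasurableSet P) : HasCode P := by
  refine measurableSet_NN_induction (motive := HasCode) (fun i j => ?_) (fun _ => HasCode.compl)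
    (fun P h => ?_) hP
  · refine ⟨fun _ => Nat.pair i j + 1, ⟨fun σ => ⟨_, fun _ h => by cases h.1⟩⟩,
      fun _ => {x | x i = j}, ⟨fun σ k h => ?_, fun σ h => by cases h⟩, rfl⟩
    rw [← Nat.succ_injective h, leaf, Nat.unpair_pair]
  · simpa using (HasCode.nor h).compl

/-- The label of a node of the code stored in a sequence. -/
def lab (r : NN) (σ : List ℕ) : ℕ := r (Encodable.encode σ + 1)

lemma exists_code {n : ℕ} {P : Fin n → Set NN} (hP : ∀ i, MeasurableSet (P i)) :
    ∃ r : NN, r 0 = n ∧ WellFounded (codeRel (lab r)) ∧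
      ∃ E, IsValuation (lab r) E ∧ ∀ i : Fin n, E [(i : ℕ)] = P i := by
  have h : ∀ i : ℕ, HasCode (if h : i < n then P ⟨i, h⟩ else ∅) := by
    intro i
    split_ifs
    exacts [hasCode_of_measurableSet (hP _), hasCode_of_measurableSet .empty]
  choose L hL E hE hP using h
  obtain ⟨F, hF, hFE⟩ := exists_isValuation_graft hE
  let r : NN
    | 0 => n
    | k + 1 => graft L (Denumerable.ofNat (List ℕ) k)
  have hr : lab r = graft L := by
    ext σ
    simp [lab, r]
  refine ⟨r, rfl, hr ▸ wellFounded_graft hL, F, hr ▸ hF, fun i => ?_⟩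
  rw [hFE, hP, dif_pos i.2]

/-- `e` and `e'` witness that the coloring coded by `r` takes the same value at `v` and `v'`. -/
def SameColor (r v v' : NN) (e e' : List ℕ → ℕ) : Prop :=
  Correct (lab r) v e ∧ Correct (lab r) v' e' ∧ ∀ i < r 0, (e [i] = 0 ↔ e' [i] = 0)

lemma sameColor_iff {r v v' : NN} (hr : WellFounded (codeRel (lab r))) {E : List ℕ → Set NN}
    (hE : IsValuation (lab r) E) :
    (∃ e e', SameColor r v v' e e') ↔ ∀ i < r 0, (v ∈ E [i] ↔ v' ∈ E [i]) := by
  constructor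
  · rintro ⟨e, e', h1, h2, h3⟩ i hi
    rw [← h1.eq_zero_iff hr hE, ← h2.eq_zero_iff hr hE, h3 i hi]
  · intro h
    obtain ⟨e, he⟩ := exists_correct hE v
    obtain ⟨e', he'⟩ := exists_correct hE v'
    refine ⟨e, e', he, he', fun i hi => ?_⟩
    rw [he.eq_zero_iff hr hE, he'.eq_zero_iff hr hE, h i hi]

/-- `y` codes an infinite descending path through the inner nodes of `L`. -/
def Descends (L : List ℕ → ℕ) (y : NN) : Prop :=
  ∀ j, L (Denumerable.ofNat _ (y j)) = 0 ∧
    ∃ m, Denumerable.ofNat (List ℕ) (y (j + 1)) = Denumerable.ofNat (List ℕ) (y j) ++ [m]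

lemma wellFounded_codeRel_iff {L : List ℕ → ℕ} :
    WellFounded (codeRel L) ↔ ¬ ∃ y, Descends L y := by
  rw [wellFounded_iff_isEmpty_descending_chain, isEmpty_subtype]
  constructor
  · rintro h ⟨y, hy⟩
    exact h (fun j => Denumerable.ofNat _ (y j)) fun j => hy j
  · intro h f hf
    refine h ⟨fun j => Encodable.encode (f j), fun j => ?_⟩
    simpa [codeRel] using hf j

lemma Continuous.nat_comp {X α : Type*} [TopologicalSpace X] [TopologicalSpace α] {f : X → ℕ}
    (hf : Continuous f) (g : ℕ → α) : Continuous fun x => g (f x) :=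
  continuous_of_discreteTopology.comp hf

/-- Evaluation of a sequence at a varying index is continuous. -/
lemma Continuous.apply_nat {X : Type*} [TopologicalSpace X] {f : X → ℕ} {g : X → NN}
    (hf : Continuous f) (hg : Continuous g) : Continuous fun x => g x (f x) := by
  rw [continuous_iff_continuousAt]
  intro x
  have h1 : ∀ᶠ z in nhds x, f z = f x := hf.continuousAt ((isOpen_discrete {f x}).mem_nhds rfl)
  have h2 : ContinuousAt (fun z => g z (f x)) x :=
    ((continuous_apply (f x)).comp hg).continuousAt
  refine h2.congr ?_
  filter_upwards [h1] with z hz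
  rw [hz]

lemma isClosed_correct :
    IsClosed {p : (List ℕ → ℕ) × NN × (List ℕ → ℕ) | Correct p.1 p.2.1 p.2.2} := by
  simp only [Correct, ofPred_forall]
  refine isClosed_iInter fun σ => isClosed_iInter fun m => ?_
  exact (isClosed_discrete {t : ℕ × ℕ × ℕ × ℕ | (t.1 = m + 1 → (t.2.1 = 0 ↔
    t.2.2.1 = m.unpair.2)) ∧ (t.1 = 0 → t.2.1 = 0 → t.2.2.2 ≠ 0) ∧
    (t.1 = 0 → t.2.1 = m + 1 → t.2.2.2 = 0)}).preimage
    (f := fun p : (List ℕ → ℕ) × NN × (List ℕ → ℕ) =>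
      (p.1 σ, p.2.2 σ, p.2.1 m.unpair.1, p.2.2 (σ ++ [m]))) (by fun_prop)

lemma continuous_lab : Continuous lab := by
  unfold lab
  fun_prop

lemma isClosed_sameColor : IsClosed {p : NN × NN × NN × (List ℕ → ℕ) × (List ℕ → ℕ) |
    SameColor p.1 p.2.1 p.2.2.1 p.2.2.2.1 p.2.2.2.2} := by
  have hl := continuous_lab
  refine .inter (isClosed_correct.preimage (f := fun p : NN × NN × NN × (List ℕ → ℕ) ×
      (List ℕ → ℕ) => (lab p.1, p.2.1, p.2.2.2.1)) (by fun_prop))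
    (.inter (isClosed_correct.preimage (f := fun p : NN × NN × NN × (List ℕ → ℕ) ×
      (List ℕ → ℕ) => (lab p.1, p.2.2.1, p.2.2.2.2)) (by fun_prop)) ?_)
  have : ∀ i : ℕ, IsClosed {p : NN × NN × NN × (List ℕ → ℕ) × (List ℕ → ℕ) |
      i < p.1 0 → (p.2.2.2.1 [i] = 0 ↔ p.2.2.2.2 [i] = 0)} := fun i =>
    (isClosed_discrete {t : ℕ × ℕ × ℕ | i < t.1 → (t.2.1 = 0 ↔ t.2.2 = 0)}).preimage
      (f := fun p : NN × NN × NN × (List ℕ → ℕ) × (List ℕ → ℕ) =>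
        (p.1 0, p.2.2.2.1 [i], p.2.2.2.2 [i])) (by fun_prop)
  have h := isClosed_iInter this
  simp only [← ofPred_forall] at h
  exact h

lemma isClosed_descends : IsClosed {p : NN × NN | Descends (lab p.1) p.2} := by
  simp only [Descends, ofPred_forall]
  refine isClosed_iInter fun j => ?_
  have h2 : Continuous fun p : NN × NN =>
      lab p.1 (Denumerable.ofNat _ (p.2 j)) := by
    unfold lab
    exact .apply_nat (.nat_comp (f := fun p : NN × NN => p.2 j) (by fun_prop)
      fun n => Encodable.encode (Denumerable.ofNat (List ℕ) n) + 1) continuous_fst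
  exact (isClosed_discrete {t : ℕ × ℕ × ℕ | t.1 = 0 ∧ ∃ m,
    Denumerable.ofNat (List ℕ) t.2.2 = Denumerable.ofNat (List ℕ) t.2.1 ++ [m]}).preimage
    (f := fun p : NN × NN => (lab p.1 (Denumerable.ofNat _ (p.2 j)), p.2 j, p.2 (j + 1)))
    (by fun_prop)

/-- The interleaving of two sequences. -/
def join (r s : NN) : NN := fun n => if n % 2 = 0 then r (n / 2) else s (n / 2)

@[simp] lemma join_even (r s : NN) (i : ℕ) : join r s (2 * i) = r i := by simp [join]

@[simp] lemma join_odd (r s : NN) (i : ℕ) : join r s (2 * i + 1) = s i := by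
  simp [join, Nat.add_mod, Nat.mul_add_div]

lemma continuous_join {X : Type*} [TopologicalSpace X] {f g : X → NN} (hf : Continuous f)
    (hg : Continuous g) : Continuous fun x => join (f x) (g x) := by
  refine continuous_pi fun n => ?_
  unfold join
  split_ifs <;> fun_prop

lemma join_inj {r s r' s' : NN} : join r s = join r' s' ↔ r = r' ∧ s = s' := by
  refine ⟨fun h => ⟨funext fun i => ?_, funext fun i => ?_⟩, fun ⟨h, h'⟩ => h ▸ h' ▸ rfl⟩
  · simpa using congrFun h (2 * i)
  · simpa using congrFun h (2 * i + 1)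

/-- The sequence stored in a certificate. -/
def certSeq (y : NN) : NN := fun i => (y i).unpair.1

/-- The first family of values stored in a certificate. -/
def certFst (y : NN) (σ : List ℕ) : ℕ := (y (Encodable.encode σ)).unpair.2.unpair.1

/-- The second family of values stored in a certificate. -/
def certSnd (y : NN) (σ : List ℕ) : ℕ := (y (Encodable.encode σ)).unpair.2.unpair.2

lemma exists_cert (s : NN) (e e' : List ℕ → ℕ) :
    ∃ y, certSeq y = s ∧ certFst y = e ∧ certSnd y = e' := by
  refine ⟨fun i => Nat.pair (s i) (Nat.pair (e (Denumerable.ofNat _ i))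
    (e' (Denumerable.ofNat _ i))), ?_, ?_, ?_⟩ <;> funext i <;> simp [certSeq, certFst, certSnd]

/-- Pairs `(r, y)` such that `y` certifies that `r` is not a code, or that the coloring coded by
`r` fails to separate some `s` with `s 1 < k` from its shift. -/
def fault (k : ℕ) : Set (NN × NN) :=
  {p | (StrictMono (certSeq p.2) ∧ certSeq p.2 1 < k ∧ SameColor p.1 (join p.1 (certSeq p.2))
    (join p.1 fun i => certSeq p.2 (i + 1)) (certFst p.2) (certSnd p.2)) ∨
    Descends (lab p.1) p.2}

lemma isClosed_strictMono : IsClosed {x : NN | StrictMono x} := by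
  have h : IsClosed {x : NN | ∀ n, x n < x (n + 1)} := by
    rw [ofPred_forall]
    exact isClosed_iInter fun n => (isClosed_discrete {t : ℕ × ℕ | t.1 < t.2}).preimage
      (f := fun x : NN => (x n, x (n + 1))) (by fun_prop)
  convert h
  exact ⟨fun h n => h (Nat.lt_succ_self n), strictMono_nat_of_lt_succ⟩

lemma isClosed_fault (k : ℕ) : IsClosed (fault k) := by
  have h1 : Continuous certSeq := continuous_pi fun i =>
    .nat_comp (f := fun y : NN => y i) (by fun_prop) fun n => n.unpair.1
  have h2 : Continuous certFst := continuous_pi fun i =>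
    .nat_comp (f := fun y : NN => y _) (by fun_prop) fun n => n.unpair.2.unpair.1
  have h3 : Continuous certSnd := continuous_pi fun i =>
    .nat_comp (f := fun y : NN => y _) (by fun_prop) fun n => n.unpair.2.unpair.2
  refine .union (.inter ?_ (.inter ?_ ?_)) isClosed_descends
  · exact isClosed_strictMono.preimage (h1.comp continuous_snd)
  · exact (isClosed_discrete {n | n < k}).preimage
      (f := fun p : NN × NN => certSeq p.2 1) (by fun_prop)
  · exact isClosed_sameColor.preimage (f := fun p : NN × NN => (p.1, join p.1 (certSeq p.2),
      join p.1 fun i => certSeq p.2 (i + 1), certFst p.2, certSnd p.2))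
      (continuous_fst.prodMk ((continuous_join (by fun_prop) (by fun_prop)).prodMk
        ((continuous_join (by fun_prop) (by fun_prop)).prodMk (by fun_prop))))

lemma exists_mem_fault_iff {k : ℕ} {r : NN} : (∃ y, (r, y) ∈ fault k) ↔
    (∃ s : IncSeq, s.1 1 < k ∧ ∃ e e', SameColor r (join r s.1) (join r (shift s).1) e e') ∨
      ∃ y, Descends (lab r) y := by
  constructor
  · rintro ⟨y, ⟨h1, h2, h3⟩ | h⟩
    exacts [.inl ⟨⟨_, h1⟩, h2, _, _, h3⟩, .inr ⟨y, h⟩]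
  · rintro (⟨s, h1, e, e', h2⟩ | ⟨y, h⟩)
    · obtain ⟨y, hy1, hy2, hy3⟩ := exists_cert s.1 e e'
      refine ⟨y, .inl ?_⟩
      simp only [hy1, hy2, hy3]
      exact ⟨s.2, h1, h2⟩
    · exact ⟨y, .inr h⟩

lemma measurable_join {Ω : Type*} [MeasurableSpace Ω] {f g : Ω → NN} (hf : Measurable f)
    (hg : Measurable g) : Measurable fun ω => join (f ω) (g ω) := by
  refine measurable_pi_lambda _ fun n => ?_
  unfold join
  split_ifs
  exacts [(measurable_pi_apply _).comp hf, (measurable_pi_apply _).comp hg]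

lemma exists_mem_fault (r : NN) : ∃ k y, (r, y) ∈ fault k := by
  simp only [exists_mem_fault_iff]
  by_cases hr : WellFounded (codeRel (lab r))
  · obtain ⟨E, hE, hm⟩ := exists_isValuation hr
    obtain ⟨s, hs⟩ := exists_monochromatic_shift
      (fun (s : IncSeq) (i : Fin (r 0)) => join r s.1 ∈ E [(i : ℕ)])
      (measurable_pi_lambda _ fun i => measurableSet_setOfPred.1
        ((hm _).preimage (measurable_join measurable_const measurable_subtype_coe)))
    refine ⟨s.1 1 + 1, .inl ⟨s, Nat.lt_succ_self _, (sameColor_iff hr hE).2 fun i hi => ?_⟩⟩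
    simpa using congrFun hs ⟨i, hi⟩
  · rw [wellFounded_codeRel_iff, not_not] at hr
    exact ⟨0, .inr hr⟩

open Classical in
/-- Regard a strictly increasing sequence as an element of `[ℕ]^ℕ`. -/
noncomputable def toInc (v : NN) : IncSeq :=
  if h : StrictMono v then ⟨v, h⟩ else ⟨id, strictMono_id⟩

lemma toInc_of_strictMono {v : NN} (h : StrictMono v) : toInc v = ⟨v, h⟩ := dif_pos h

lemma toInc_val (s : IncSeq) : (toInc fun i => s.1 i) = s := toInc_of_strictMono s.2

lemma measurable_toInc : Measurable toInc := by
  classical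
  exact Measurable.dite (s := {v : NN | StrictMono v}) (f := fun v => (v : IncSeq)) measurable_id
    (g := fun _ => ⟨id, strictMono_id⟩) measurable_const measurableSet_strictMono

lemma exists_coloring_fault {α : Type} [Finite α] [MeasurableSpace α]
    [MeasurableSingletonClass α] (c : NN × IncSeq → α) (hc : Measurable c) :
    ∃ r s, c (r, s) = c (r, shift s) ∧ ∀ k ≤ s.1 1, ∀ y, (r, y) ∉ fault k := by
  classical
  obtain ⟨n, ⟨φ⟩⟩ := Finite.exists_equiv_fin α
  have hs : Measurable fun v : NN => fun i => v (2 * i + 1) :=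
    measurable_pi_lambda _ fun n => measurable_pi_apply _
  have hr : Measurable fun v : NN => fun i => v (2 * i) :=
    measurable_pi_lambda _ fun n => measurable_pi_apply _
  obtain ⟨r, hr0, hwf, E, hE, hP⟩ := exists_code (n := n)
    (P := fun i => (fun v : NN => φ (c (fun i => v (2 * i),
      toInc fun i => v (2 * i + 1)))) ⁻¹' {i})
    fun i => by
      have := (hc.comp (hr.prodMk (measurable_toInc.comp hs))) (measurableSet_singleton (φ.symm i))
      convert this using 1
      ext v
      simp [Equiv.eq_symm_apply]
  have hmem : ∀ (s : IncSeq) (i : Fin n), join r s.1 ∈ E [(i : ℕ)] ↔ φ (c (r, s)) = i := by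
    intro s i
    simp [hP, toInc_val]
  have hbad : ∃ m, ∃ s : IncSeq, s.1 1 = m ∧ c (r, s) = c (r, shift s) := by
    obtain ⟨s, hs⟩ := exists_monochromatic_shift (fun s => c (r, s))
      (hc.comp measurable_prodMk_left)
    exact ⟨_, s, rfl, hs⟩
  obtain ⟨s, hs1, hs2⟩ := Nat.find_spec hbad
  refine ⟨r, s, hs2, fun k hk y hy => ?_⟩
  rcases exists_mem_fault_iff.1 ⟨y, hy⟩ with ⟨s', h1, h2⟩ | h
  · refine Nat.find_min hbad (m := s'.1 1) (by omega) ⟨s', rfl, ?_⟩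
    rw [sameColor_iff hwf hE, hr0] at h2
    have := h2 _ (φ (c (r, s'))).2
    rw [hmem, hmem] at this
    exact (φ.injective (this.1 rfl)).symm
  · exact wellFounded_codeRel_iff.1 hwf h

/-- `σ` is a node of the tree of the section of `F` over `a`. -/
def Tr (F : Set (NN × NN)) (a : NN) (σ : List ℕ) : Prop :=
  ∃ p ∈ F, (∀ i < σ.length, p.1 i = a i) ∧ ∀ i < σ.length, p.2 i = σ.getD i 0

lemma Tr.of_append {F : Set (NN × NN)} {a : NN} {σ : List ℕ} {m : ℕ} (h : Tr F a (σ ++ [m])) :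
    Tr F a σ := by
  obtain ⟨p, hp, h1, h2⟩ := h
  rw [List.length_append, List.length_singleton] at h1 h2
  refine ⟨p, hp, fun i hi => h1 i (by omega), fun i hi => ?_⟩
  rw [h2 i (by omega), List.getD_append _ _ _ _ hi]

lemma Tr.congr {F : Set (NN × NN)} {a a' : NN} {σ : List ℕ} (h : Tr F a σ)
    (ha : ∀ i < σ.length, a i = a' i) : Tr F a' σ := by
  obtain ⟨p, hp, h1, h2⟩ := h
  exact ⟨p, hp, fun i hi => (h1 i hi).trans (ha i hi), h2⟩

lemma tr_preL_of_mem {F : Set (NN × NN)} {a b : NN} (h : (a, b) ∈ F) (n : ℕ) :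
    Tr F a (preL b n) := by
  refine ⟨_, h, fun _ _ => rfl, fun i hi => ?_⟩
  rw [length_preL] at hi
  rw [getD_preL _ hi]

lemma mem_of_tr_preL {F : Set (NN × NN)} (hF : IsClosed F) {a b : NN}
    (h : ∀ n, Tr F a (preL b n)) : (a, b) ∈ F := by
  choose p hp h1 h2 using h
  simp only [length_preL] at h1 h2
  refine hF.mem_of_tendsto (f := p) (b := Filter.atTop)
    (Filter.Tendsto.prodMk_nhds ?_ ?_) (.of_forall hp)
  · refine tendsto_pi_nhds.2 fun i => tendsto_const_nhds.congr' ?_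
    filter_upwards [Filter.eventually_gt_atTop i] with n hn
    exact (h1 n i hn).symm
  · refine tendsto_pi_nhds.2 fun i => tendsto_const_nhds.congr' ?_
    filter_upwards [Filter.eventually_gt_atTop i] with n hn
    rw [h2 n i hn, getD_preL _ hn]

lemma eventually_agree {X : Type*} [TopologicalSpace X] {f : X → NN} (hf : Continuous f) (x : X)
    (n : ℕ) : ∀ᶠ x' in nhds x, ∀ i < n, f x' i = f x i := by
  have : ∀ i, ∀ᶠ x' in nhds x, f x' i = f x i := fun i =>
    ((continuous_apply i).comp hf).continuousAt ((isOpen_discrete {f x i}).mem_nhds rfl)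
  exact (Filter.eventually_all_finite (finite_Iio n)).2 fun i _ => this i

lemma isClosed_of_eventually {X : Type*} [TopologicalSpace X] {p : X → Prop}
    (h : ∀ x, ∀ᶠ x' in nhds x, p x' → p x) : IsClosed {x | p x} := by
  rw [← isOpen_compl_iff, isOpen_iff_mem_nhds]
  intro x hx
  filter_upwards [h x] with x' hx' hc using hx (hx' hc)

/-- The image of a node under the monotone map of sequences stored in `q`. -/
def treeMap (q : NN) (σ : List ℕ) : List ℕ :=
  (List.range σ.length).map fun i => q (2 * Encodable.encode (σ.take (i + 1)) + 2)

@[simp] lemma length_treeMap (q : NN) (σ : List ℕ) : (treeMap q σ).length = σ.length := by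
  simp [treeMap]

lemma treeMap_append (q : NN) (σ : List ℕ) (m : ℕ) :
    treeMap q (σ ++ [m]) = treeMap q σ ++ [q (2 * Encodable.encode (σ ++ [m]) + 2)] := by
  rw [treeMap, List.length_append, List.length_singleton, List.range_succ, List.map_append,
    List.map_singleton]
  congr 1
  · refine List.map_congr_left fun i hi => ?_
    rw [List.mem_range] at hi
    rw [List.take_append_of_le_length (by omega)]
  · rw [List.take_of_length_le (by simp)]

lemma treeMap_preL (q b : NN) (n : ℕ) :
    treeMap q (preL b n) = preL (fun i => q (2 * Encodable.encode (preL b (i + 1)) + 2)) n := by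
  induction n with
  | zero => rfl
  | succ n ih => rw [preL_succ, treeMap_append, ih, ← preL_succ, ← preL_succ]

/-- Triples `(z, r, q)` such that `q` stores some `x` and `k`, together with a monotone map from the
tree of the section of `F` over `join z x` to the tree of the section of `fault k` over `r`. -/
def reductions (F : Set (NN × NN)) : Set (NN × NN × NN) :=
  {p | ∀ σ, Tr F (join p.1 fun i => p.2.2 (2 * i + 1)) σ →
    Tr (fault (p.2.2 0)) p.2.1 (treeMap p.2.2 σ)}

lemma isClosed_reductions (F : Set (NN × NN)) : IsClosed (reductions F) := by
  rw [reductions, ofPred_forall]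
  refine isClosed_iInter fun σ => isClosed_of_eventually fun w => ?_
  have hc : Continuous fun p : NN × NN × NN => join p.1 fun i => p.2.2 (2 * i + 1) :=
    continuous_join (by fun_prop) (by fun_prop)
  have hq : Continuous fun p : NN × NN × NN => p.2.2 := by fun_prop
  have hr : Continuous fun p : NN × NN × NN => p.2.1 := by fun_prop
  have ht : Continuous fun p : NN × NN × NN => fun i =>
      p.2.2 (2 * Encodable.encode (σ.take (i + 1)) + 2) := by fun_prop
  filter_upwards [eventually_agree hc w σ.length, eventually_agree hq w 1,
    eventually_agree hr w σ.length, eventually_agree ht w σ.length] with w' h1 h2 h3 h4 h hw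
  have e : treeMap w'.2.2 σ = treeMap w.2.2 σ :=
    List.map_congr_left fun i hi => h4 i (List.mem_range.1 hi)
  have := h (hw.congr fun i hi => (h1 i hi).symm)
  rw [e, h2 0 one_pos] at this
  exact this.congr fun i hi => h3 i (by simpa using hi)

lemma exists_mem_fault_of_reduction {F : Set (NN × NN)} {z r q : NN}
    (hz : ∀ x, ∃ y, (join z x, y) ∈ F) (h : (z, r, q) ∈ reductions F) :
    ∃ y, (r, y) ∈ fault (q 0) := by
  obtain ⟨b, hb⟩ := hz fun i => q (2 * i + 1)
  exact ⟨_, mem_of_tr_preL (isClosed_fault _) fun n =>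
      treeMap_preL q b n ▸ h _ (tr_preL_of_mem hb n)⟩

lemma measurableSet_tr {F : Set (NN × NN)} (σ : List ℕ) : MeasurableSet {a | Tr F a σ} :=
  (isClosed_of_eventually fun a => by
    filter_upwards [eventually_agree continuous_id a σ.length] with a' h1 h
    exact h.congr h1).measurableSet

lemma wellFounded_tr {F : Set (NN × NN)} (hF : IsClosed F) {a : NN} (ha : ∀ b, (a, b) ∉ F) :
    WellFounded fun τ σ => Tr F a τ ∧ ∃ m, τ = σ ++ [m] := by
  have h0 : Acc (fun τ σ => Tr F a τ ∧ ∃ m, τ = σ ++ [m]) [] := by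
    by_contra h0
    obtain ⟨b, hb⟩ := exists_follow (B := fun σ => {m |
      ¬ Acc (fun τ σ => Tr F a τ ∧ ∃ m, τ = σ ++ [m]) σ → Tr F a (σ ++ [m]) ∧
        ¬ Acc (fun τ σ => Tr F a τ ∧ ∃ m, τ = σ ++ [m]) (σ ++ [m])}) fun σ => by
      by_contra! hσ
      have hacc : Acc (fun τ σ => Tr F a τ ∧ ∃ m, τ = σ ++ [m]) σ := by
        refine ⟨_, ?_⟩
        rintro _ ⟨hT, m, rfl⟩
        by_contra hm
        exact (hσ ▸ notMem_empty m) fun _ => ⟨hT, hm⟩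
      exact (hσ ▸ notMem_empty 0) fun h => absurd hacc h
    have hb' : ∀ n, ¬ Acc (fun τ σ => Tr F a τ ∧ ∃ m, τ = σ ++ [m]) (preL b n) := by
      intro n
      induction n with
      | zero => exact h0
      | succ n ih => exact preL_succ b n ▸ (hb n ih).2
    exact ha b (mem_of_tr_preL hF fun n => (hb n (hb' n)).1.of_append)
  refine ⟨fun σ => ?_⟩
  induction σ using List.reverseRecOn with
  | nil => exact h0
  | append_singleton σ m ih =>
    by_cases hT : Tr F a (σ ++ [m])
    · exact ih.inv ⟨hT, m, rfl⟩
    · refine ⟨_, ?_⟩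
      rintro _ ⟨hT', m', rfl⟩
      exact absurd hT'.of_append hT

lemma measurable_sInf_nat {X : Type*} [MeasurableSpace X] {P : ℕ → Set X}
    (hP : ∀ n, MeasurableSet (P n)) : Measurable fun x => sInf {n | x ∈ P n} := by
  refine measurable_to_countable' fun m => ?_
  have : (fun x => sInf {n | x ∈ P n}) ⁻¹' {m} =
      (P m ∩ ⋂ j, ⋂ (_ : j < m), (P j)ᶜ) ∪ ({_x | m = 0} ∩ ⋂ j, (P j)ᶜ) := by
    ext x
    simp only [mem_preimage, mem_singleton_iff, mem_union, mem_inter_iff, mem_iInter,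
      mem_compl_iff, mem_ofPred_eq]
    constructor
    · rintro rfl
      by_cases hne : {n | x ∈ P n}.Nonempty
      · exact .inl ⟨Nat.sInf_mem hne, fun j hj => Nat.notMem_of_lt_sInf hj⟩
      · rw [not_nonempty_iff_eq_empty] at hne
        exact .inr ⟨by simp [hne], fun j hj => (hne ▸ notMem_empty j) hj⟩
    · rintro (⟨h1, h2⟩ | ⟨rfl, h⟩)
      · refine le_antisymm (Nat.sInf_le h1) (not_lt.1 fun hlt => ?_)
        exact h2 _ hlt (Nat.sInf_mem (s := {n | x ∈ P n}) ⟨m, h1⟩)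
      · rw [Nat.sInf_eq_zero]
        exact .inr (eq_empty_of_forall_notMem h)
  rw [this]
  exact ((hP m).inter (.iInter fun j => .iInter fun _ => (hP j).compl)).union
    ((MeasurableSet.const _).inter (.iInter fun j => (hP j).compl))

lemma measurable_param {X ι β : Type*} [MeasurableSpace X] [MeasurableSpace β] [Countable ι]
    [MeasurableSpace ι] [DiscreteMeasurableSpace ι] {f : X → ι} (hf : Measurable f)
    {g : ι → X → β} (hg : ∀ i, Measurable (g i)) : Measurable fun x => g (f x) x :=
  (measurable_from_prod_countable_right (f := fun p : ι × X => g p.1 p.2) hg).comp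
    (hf.prodMk measurable_id)

lemma exists_winning_sets {T : List ℕ → Prop} (hT : WellFounded fun τ σ => T τ ∧ ∃ m, τ = σ ++ [m])
    {G : List ℕ → Set NN} (hG : ∀ τ, MeasurableSet (G τ)) :
    ∃ W : List ℕ → List ℕ → Set NN, (∀ σ τ, MeasurableSet (W σ τ)) ∧ (∀ σ τ, W σ τ ⊆ G τ) ∧
      (∀ σ τ m, T (σ ++ [m]) → W σ τ ⊆ ⋃ m', W (σ ++ [m]) (τ ++ [m'])) ∧
      ∀ r y, (∀ n, r ∈ G (preL y n)) → ∀ σ n, r ∈ W σ (preL y n) := by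
  classical
  let W : List ℕ → List ℕ → Set NN := hT.fix fun σ rec τ => G τ ∩ ⋂ m,
    if h : T (σ ++ [m]) then ⋃ m', rec (σ ++ [m]) ⟨h, m, rfl⟩ (τ ++ [m']) else univ
  have hW : ∀ σ τ, W σ τ =
      G τ ∩ ⋂ m, if T (σ ++ [m]) then ⋃ m', W (σ ++ [m]) (τ ++ [m']) else univ := by
    intro σ τ
    rw [show W σ = _ from hT.fix_eq _ σ]
    congr 1
  refine ⟨W, fun σ => ?_, fun σ τ => ?_, fun σ τ m hm => ?_, fun r y hr σ => ?_⟩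
  · induction σ using hT.induction with
    | _ σ ih =>
      intro τ
      rw [hW]
      refine (hG τ).inter (.iInter fun m => ?_)
      split_ifs with h
      · exact .iUnion fun m' => ih _ ⟨h, m, rfl⟩ _
      · exact .univ
  · rw [hW]
    exact inter_subset_left
  · rw [hW]
    refine inter_subset_right.trans ((iInter_subset _ m).trans ?_)
    rw [if_pos hm]
  · induction σ using hT.induction with
    | _ σ ih =>
      intro n
      rw [hW]
      refine ⟨hr n, mem_iInter.2 fun m => ?_⟩
      split_ifs with h
      · exact mem_iUnion.2 ⟨y n, preL_succ y n ▸ ih _ ⟨h, m, rfl⟩ (n + 1)⟩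
      · trivial

instance : MeasurableSpace (List ℕ) := ⊤

instance : DiscreteMeasurableSpace (List ℕ) := ⟨fun _ => trivial⟩

lemma exists_measurable_reduction {F : Set (NN × NN)} (hF : IsClosed F) {z x : NN}
    (hx : ∀ y, (join z x, y) ∉ F) :
    ∃ Y : NN → NN, Measurable Y ∧ ∀ r, (z, r, Y r) ∈ reductions F := by
  have hW := fun k => exists_winning_sets (wellFounded_tr hF hx)
    (G := fun τ => {r | Tr (fault k) r τ}) measurableSet_tr
  choose W hWm hWG hWs hWb using hW
  let K : NN → ℕ := fun r => sInf {k | r ∈ W k [] []}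
  have hK : ∀ r, r ∈ W (K r) [] [] := fun r => by
    obtain ⟨k, y, hy⟩ := exists_mem_fault r
    exact Nat.sInf_mem (s := {k | r ∈ W k [] []}) ⟨k, hWb k r y (tr_preL_of_mem hy) [] 0⟩
  have hKm : Measurable K := measurable_sInf_nat fun k => hWm k [] []
  let nxt : ℕ → List ℕ → List ℕ → NN → ℕ := fun k σ τ r => sInf {m | r ∈ W k σ (τ ++ [m])}
  have hnxt : ∀ k σ τ, Measurable (nxt k σ τ) := fun k σ τ =>
    measurable_sInf_nat fun m => hWm k σ (τ ++ [m])
  let g : List ℕ → NN → List ℕ := fun l => List.rec (motive := fun _ => NN → List ℕ)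
    (fun _ => []) (fun m l ih r => ih r ++ [nxt (K r) (m :: l).reverse (ih r) r]) l
  have hg : ∀ m l r, g (m :: l) r = g l r ++ [nxt (K r) (m :: l).reverse (g l r) r] :=
    fun _ _ _ => rfl
  have hgm : ∀ l, Measurable (g l) := by
    intro l
    induction l with
    | nil => exact measurable_const
    | cons m l ih =>
      have h1 : Measurable fun r => nxt (K r) (m :: l).reverse (g l r) r :=
        measurable_param (f := fun r => (K r, g l r)) (hKm.prodMk ih)
          (g := fun i r => nxt i.1 (m :: l).reverse i.2 r) fun i => hnxt _ _ _
      exact (Measurable.of_discrete (f := fun p : List ℕ × ℕ => p.1 ++ [p.2])).comp (ih.prodMk h1)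
  have hgW : ∀ r σ, Tr F (join z x) σ → r ∈ W (K r) σ (g σ.reverse r) := by
    intro r σ
    induction σ using List.reverseRecOn with
    | nil => exact fun _ => hK r
    | append_singleton σ m ih =>
      intro h
      have := mem_iUnion.1 (hWs _ _ _ m h (ih h.of_append))
      rw [List.reverse_append, List.reverse_singleton, List.singleton_append, hg,
        List.reverse_cons, List.reverse_reverse]
      exact Nat.sInf_mem (s := {m' | r ∈ W (K r) (σ ++ [m]) (g σ.reverse r ++ [m'])}) this
  let Y : NN → NN := fun r n => if n = 0 then K r else
    join x (fun i => (g (Denumerable.ofNat (List ℕ) i).reverse r).getLastD 0) (n - 1)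
  have hY : ∀ r σ, treeMap (Y r) σ = g σ.reverse r := by
    intro r σ
    induction σ using List.reverseRecOn with
    | nil => rfl
    | append_singleton σ m ih =>
      rw [treeMap_append, ih]
      simp [Y, hg]
  refine ⟨Y, measurable_pi_lambda _ fun n => ?_, fun r σ h => ?_⟩
  · by_cases hn : n = 0
    · simpa [Y, hn] using hKm
    · simp only [Y, hn, if_false]
      have hp : Measurable fun r i => (g (Denumerable.ofNat (List ℕ) i).reverse r).getLastD 0 :=
        measurable_pi_lambda _ fun i =>
          (Measurable.of_discrete (f := fun l : List ℕ => l.getLastD 0)).comp (hgm _)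
      exact (measurable_pi_apply (X := fun _ => ℕ) (n - 1)).comp
        (measurable_join (measurable_const (a := x)) hp)
  · have h' : Tr F (join z x) σ := by simpa [Y] using h
    have := hWG _ _ _ (hgW r σ h')
    rw [← hY] at this
    exact this

/-- The first `m` terms of `z`, `r` and `s` show that no `q` with `(z, r, q) ∈ reductions F` is
dominated by `s`. -/
def Escapes (F : Set (NN × NN)) (m : ℕ) (z r s : NN) : Prop :=
  ∀ z' r' q, (z', r', q) ∈ reductions F → (∀ i < m, z' i = z i) → (∀ i < m, r' i = r i) →
    ¬ ∀ i < m, q i ≤ s i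

lemma Escapes.congr {F : Set (NN × NN)} {m : ℕ} {z r s z' r' s' : NN} (h : Escapes F m z r s)
    (hz : ∀ i < m, z' i = z i) (hr : ∀ i < m, r' i = r i) (hs : ∀ i < m, s' i ≤ s i) :
    Escapes F m z' r' s' := fun z'' r'' q hq h1 h2 h3 =>
  h z'' r'' q hq (fun i hi => (h1 i hi).trans (hz i hi)) (fun i hi => (h2 i hi).trans (hr i hi))
    fun i hi => (h3 i hi).trans (hs i hi)

lemma exists_escapes_iff {F : Set (NN × NN)} {z r s : NN} :
    (∃ m, Escapes F m z r s) ↔ ∀ q, (z, r, q) ∈ reductions F → ¬ ∀ i, q i ≤ s i := by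
  constructor
  · rintro ⟨m, hm⟩ q hq h
    exact hm z r q hq (fun _ _ => rfl) (fun _ _ => rfl) fun i _ => h i
  · intro h
    by_contra! hcon
    simp only [Escapes] at hcon
    push Not at hcon
    choose z' r' q' hQ hz hr hq using hcon
    obtain ⟨q, hqK, φ, hφ, hlim⟩ :=
      (isCompact_univ_pi fun i => (finite_Iic (s i)).isCompact).tendsto_subseq
      (x := fun m i => min (q' m i) (s i)) fun m i _ =>
        mem_Iic.2 (min_le_right (q' m i) (s i))
    refine h q ?_ fun i => hqK i trivial
    refine (isClosed_reductions F).mem_of_tendsto (f := fun n => (z' (φ n), r' (φ n), q' (φ n)))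
      (b := Filter.atTop) (.prodMk_nhds ?_ (.prodMk_nhds ?_ ?_)) (.of_forall fun n => hQ _)
    · refine tendsto_pi_nhds.2 fun i => tendsto_const_nhds.congr' ?_
      filter_upwards [hφ.tendsto_atTop.eventually_gt_atTop i] with n hn
      exact (hz _ i hn).symm
    · refine tendsto_pi_nhds.2 fun i => tendsto_const_nhds.congr' ?_
      filter_upwards [hφ.tendsto_atTop.eventually_gt_atTop i] with n hn
      exact (hr _ i hn).symm
    · refine tendsto_pi_nhds.2 fun i => (tendsto_pi_nhds.1 hlim i).congr' ?_
      filter_upwards [hφ.tendsto_atTop.eventually_gt_atTop i] with n hn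
      exact min_eq_left (hq _ i hn)

/-- The lengths of the finite sequences coded by the terms of `t`. -/
def lenSeq (t : NN) : NN := fun m => (Denumerable.ofNat (List ℕ) (t m)).length

/-- The limit of the finite sequences coded by the terms of `t`. -/
def limSeq (t : NN) : NN := fun i => (Denumerable.ofNat (List ℕ) (t (i + 1))).getD i 0

/-- The sequence of first coordinates of the lengths coded by `t`. -/
def fstSeq (t : NN) : NN := fun m => (lenSeq t m).unpair.1

/-- The pairs `(z, t)` such that `t` codes a pair `(r, s)` and a number witnessing that `s` escapes
domination. -/
def escapeSet (F : Set (NN × NN)) : Set (NN × IncSeq) :=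
  {p | (∀ m, Denumerable.ofNat (List ℕ) (p.2.1 m) = preL (limSeq p.2.1) (lenSeq p.2.1 m)) ∧
    (∀ m, fstSeq p.2.1 m < fstSeq p.2.1 (m + 1)) ∧
    Escapes F (lenSeq p.2.1 0).unpair.2 p.1 (limSeq p.2.1) (fstSeq p.2.1)}

lemma continuous_lenSeq : Continuous lenSeq := continuous_pi fun i =>
  .nat_comp (f := fun y : NN => y _) (by fun_prop) fun n => (Denumerable.ofNat (List ℕ) n).length

lemma continuous_limSeq : Continuous limSeq := continuous_pi fun i =>
  .nat_comp (f := fun y : NN => y _) (by fun_prop) fun n => (Denumerable.ofNat (List ℕ) n).getD i 0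

lemma continuous_fstSeq : Continuous fstSeq := continuous_pi fun i =>
  .nat_comp (f := fun y => lenSeq y _) ((continuous_apply i).comp continuous_lenSeq)
    fun n => n.unpair.1

lemma isClosed_escapeSet (F : Set (NN × NN)) : IsClosed (escapeSet F) := by
  have ht : Continuous fun p : NN × IncSeq => p.2.1 := by fun_prop
  have hz : Continuous fun p : NN × IncSeq => p.1 := by fun_prop
  have hl := continuous_lenSeq.comp ht
  have hr := continuous_limSeq.comp ht
  have hs := continuous_fstSeq.comp ht
  have e : escapeSet F = {p | ∀ m,
      Denumerable.ofNat (List ℕ) (p.2.1 m) = preL (limSeq p.2.1) (lenSeq p.2.1 m) ∧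
      fstSeq p.2.1 m < fstSeq p.2.1 (m + 1) ∧
      Escapes F (lenSeq p.2.1 0).unpair.2 p.1 (limSeq p.2.1) (fstSeq p.2.1)} := by
    ext p
    simp [escapeSet, forall_and]
  rw [e, ofPred_forall]
  refine isClosed_iInter fun m => isClosed_of_eventually fun p => ?_
  filter_upwards [eventually_agree ht p (m + 1), eventually_agree hl p (m + 1),
    eventually_agree hr p (lenSeq p.2.1 m), eventually_agree hs p (m + 2),
    eventually_agree hz p (lenSeq p.2.1 0).unpair.2,
    eventually_agree hr p (lenSeq p.2.1 0).unpair.2,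
    eventually_agree hs p (lenSeq p.2.1 0).unpair.2] with p' h1 h2 h3 h4 h5 h6 h7 ⟨g1, g2, g3⟩
  simp only [Function.comp_apply] at h2 h3 h4 h6 h7
  rw [h1 m (by omega), h2 m (by omega)] at g1
  rw [h4 m (by omega), h4 (m + 1) (by omega)] at g2
  rw [h2 0 (by omega)] at g3
  refine ⟨g1.trans (preL_eq_iff.2 h3), g2, g3.congr (fun i hi => (h5 i hi).symm)
    (fun i hi => (h6 i hi).symm) fun i hi => (h7 i hi).ge⟩

lemma escapes_of_mem_escapeSet {F : Set (NN × NN)} {z : NN} {t : IncSeq} (h : (z, t) ∈ escapeSet F)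
    {q : NN} (hq : (z, limSeq t.1, q) ∈ reductions F) : ¬ ∀ i, q i ≤ fstSeq t.1 i :=
  exists_escapes_iff.1 ⟨_, h.2.2⟩ q hq

lemma strictMono_fstSeq {F : Set (NN × NN)} {z : NN} {t : IncSeq} (h : (z, t) ∈ escapeSet F) :
    StrictMono (fstSeq t.1) := strictMono_nat_of_lt_succ h.2.1

lemma limSeq_shift {F : Set (NN × NN)} {z : NN} {t : IncSeq} (h : (z, t) ∈ escapeSet F) :
    limSeq (shift t).1 = limSeq t.1 := by
  funext i
  change (Denumerable.ofNat (List ℕ) (t.1 (i + 2))).getD i 0 = _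
  have : i + 2 ≤ lenSeq t.1 (i + 2) :=
    (strictMono_fstSeq h).le_apply.trans (Nat.unpair_left_le _)
  have e : Denumerable.ofNat (List ℕ) (t.1 (i + 2)) = preL (limSeq t.1) (lenSeq t.1 (i + 2)) :=
    h.1 (i + 2)
  rw [e, getD_preL _ (by omega)]

lemma borelColoringLE_of_finite {α : Type} [Finite α] [MeasurableSpace α]
    [MeasurableSingletonClass α] {B : Set IncSeq} (c : B → α) (hc : Measurable c)
    (h : ∀ t t' : B, shift t.1 = t'.1 → c t ≠ c t') : ∃ n, BorelColoringLE B n := by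
  obtain ⟨n, ⟨φ⟩⟩ := Finite.exists_equiv_fin α
  refine ⟨n, φ ∘ c, (Measurable.of_discrete).comp hc, ?_⟩
  rintro t t' ⟨-, h' | h'⟩ heq
  · exact h t t' h' (φ.injective heq)
  · exact h t' t h' (φ.injective heq.symm)

lemma exists_borelColoringLE_escapeSet {F : Set (NN × NN)} (hF : IsClosed F) {z x : NN}
    (hx : ∀ y, (join z x, y) ∉ F) : ∃ n, BorelColoringLE {t | (z, t) ∈ escapeSet F} n := by
  obtain ⟨Y, hY, hYQ⟩ := exists_measurable_reduction hF hx
  refine borelColoringLE_of_finite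
    (fun t => escapeColor (Y (limSeq t.1.1)) (fstSeq t.1.1)) ?_ fun t t' h heq => ?_
  · have ht : Measurable fun t : {t | (z, t) ∈ escapeSet F} => t.1.1 :=
      measurable_subtype_coe.comp measurable_subtype_coe
    exact measurable_escapeColor (hY.comp (continuous_limSeq.measurable.comp ht))
      (continuous_fstSeq.measurable.comp ht)
  · refine escapeColor_ne (strictMono_fstSeq t.2) (escapes_of_mem_escapeSet t.2 (hYQ _)) ?_
    rw [heq, ← h, limSeq_shift t.2]
    rfl

/-- The least number witnessing that `s` escapes domination. -/
noncomputable def rank (F : Set (NN × NN)) (z r s : NN) : ℕ := sInf {m | Escapes F m z r s}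

/-- The length of the `m`-th finite sequence in the code of `(r, s)`. -/
noncomputable def rankLen (F : Set (NN × NN)) (z r s : NN) (m : ℕ) : ℕ :=
  Nat.pair (s m) ((Finset.range (m + 1)).sup fun j => rank F z r fun i => s (i + j))

/-- The code of `(r, s)`. -/
noncomputable def rankCode (F : Set (NN × NN)) (z r s : NN) : NN :=
  fun m => Encodable.encode (preL r (rankLen F z r s m))

lemma encode_lt_encode_append (l : List ℕ) (m : ℕ) :
    Encodable.encode l < Encodable.encode (l ++ [m]) := by
  induction l with
  | nil => simp
  | cons a l ih =>
    rw [List.cons_append, Encodable.encode_list_cons, Encodable.encode_list_cons]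
    exact Nat.succ_lt_succ (Nat.pair_lt_pair_right _ ih)

lemma strictMono_rankLen (F : Set (NN × NN)) (z r : NN) {s : NN} (hs : StrictMono s) :
    StrictMono (rankLen F z r s) := strictMono_nat_of_lt_succ fun n =>
  (Nat.pair_lt_pair_left _ (hs (Nat.lt_succ_self n))).trans_le
    ((show StrictMono (Nat.pair (s (n + 1))) from fun _ _ => Nat.pair_lt_pair_right _).monotone
      (Finset.sup_mono (by simp)))

lemma strictMono_rankCode (F : Set (NN × NN)) (z r : NN) {s : NN} (hs : StrictMono s) :
    StrictMono (rankCode F z r s) :=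
  (strictMono_nat_of_lt_succ (f := fun n => Encodable.encode (preL r n)) fun n => by
    rw [preL_succ]; exact encode_lt_encode_append _ _).comp (strictMono_rankLen F z r hs)

lemma rankCode_mem_escapeSet {F : Set (NN × NN)} {z r : NN} {s : IncSeq}
    (h : ∃ m, Escapes F m z r s.1) : (z, ⟨_, strictMono_rankCode F z r s.2⟩) ∈ escapeSet F := by
  have h1 : lenSeq (rankCode F z r s.1) = rankLen F z r s.1 := by
    funext m; simp [lenSeq, rankCode]
  have h2 : limSeq (rankCode F z r s.1) = r := by
    funext i
    have := (strictMono_rankLen F z r s.2).le_apply (x := i + 1)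
    simp only [limSeq, rankCode, Denumerable.ofNat_encode]
    exact getD_preL _ (by omega) _
  have h3 : fstSeq (rankCode F z r s.1) = s.1 := by
    funext m; simp [fstSeq, h1, rankLen]
  refine ⟨fun m => ?_, fun m => ?_, ?_⟩
  · simp only [h1, h2]
    simp [rankCode]
  · simp only [h3]
    exact s.2 (Nat.lt_succ_self m)
  · simp only [h1, h2, h3]
    have hm : Escapes F (rank F z r s.1) z r s.1 := Nat.sInf_mem h
    simpa only [rankLen, Nat.unpair_pair, zero_add, Finset.range_one, Finset.sup_singleton,
      add_zero] using hm

lemma shift_rankCode {F : Set (NN × NN)} {z r : NN} {s : IncSeq}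
    (h : ∃ m, Escapes F m z r (shift s).1) :
    shift ⟨_, strictMono_rankCode F z r s.2⟩ =
      ⟨_, strictMono_rankCode F z r (shift s).2⟩ := by
  apply Subtype.ext
  funext m
  change rankCode F z r s.1 (m + 1) = rankCode F z r (shift s).1 m
  rw [rankCode, rankCode]
  congr 2
  rw [rankLen, rankLen]
  congr 1
  have hle : rank F z r s.1 ≤ rank F z r (shift s).1 :=
    Nat.sInf_le (Escapes.congr (Nat.sInf_mem (s := {m | Escapes F m z r (shift s).1}) h)
      (fun _ _ => rfl) (fun _ _ => rfl) fun i _ => (s.2 (Nat.lt_succ_self i)).le)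
  have hsh : ∀ j, (fun i => (shift s).1 (i + j)) = fun i => s.1 (i + (j + 1)) := fun j => rfl
  apply le_antisymm
  · refine Finset.sup_le fun j hj => ?_
    rcases j with _ | j
    · exact hle.trans (Finset.le_sup (f := fun j => rank F z r fun i => (shift s).1 (i + j))
        (b := 0) (by simp))
    · rw [← hsh]
      exact Finset.le_sup (f := fun j => rank F z r fun i => (shift s).1 (i + j))
        (b := j) (by simpa using hj)
  · refine Finset.sup_le fun j hj => ?_
    rw [hsh]
    exact Finset.le_sup (f := fun j => rank F z r fun i => s.1 (i + j))
      (b := j + 1) (by simpa using hj)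

lemma measurable_rankCode (F : Set (NN × NN)) (z : NN) :
    Measurable fun p : NN × NN => rankCode F z p.1 p.2 := by
  have h1 : Measurable fun p : NN × NN => rank F z p.1 p.2 := by
    refine measurable_sInf_nat (P := fun m => {p : NN × NN | Escapes F m z p.1 p.2}) fun m => ?_
    refine (isClosed_of_eventually fun p => ?_).measurableSet
    filter_upwards [eventually_agree continuous_fst p m, eventually_agree continuous_snd p m]
      with p' h1 h2 h
    exact h.congr (fun _ _ => rfl) (fun i hi => (h1 i hi).symm) fun i hi => (h2 i hi).ge
  have h2 : ∀ m, Measurable fun p : NN × NN => rankLen F z p.1 p.2 m := by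
    intro m
    have hsup : Measurable fun p : NN × NN =>
        (Finset.range (m + 1)).sup fun j => rank F z p.1 fun i => p.2 (i + j) := by
      have : ∀ j, Measurable fun p : NN × NN => rank F z p.1 fun i => p.2 (i + j) := fun j =>
        h1.comp (measurable_fst.prodMk (measurable_pi_lambda _ fun i =>
          (measurable_pi_apply (X := fun _ => ℕ) (i + j)).comp measurable_snd))
      generalize Finset.range (m + 1) = S
      induction S using Finset.induction_on with
      | empty => simp
      | insert a S _ ih => simpa using (this a).max ih
    exact (Measurable.of_discrete (f := fun p : ℕ × ℕ => Nat.pair p.1 p.2)).comp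
      (((measurable_pi_apply (X := fun _ => ℕ) m).comp measurable_snd).prodMk hsup)
  have h3 : ∀ n, Measurable fun r : NN => preL r n := by
    intro n
    induction n with
    | zero => exact measurable_const
    | succ n ih =>
      simp only [preL_succ]
      exact (Measurable.of_discrete (f := fun p : List ℕ × ℕ => p.1 ++ [p.2])).comp
        (ih.prodMk (measurable_pi_apply n))
  exact measurable_pi_lambda _ fun m => Measurable.of_discrete.comp
    (measurable_param (h2 m) (g := fun n (p : NN × NN) => preL p.1 n)
      fun n => (h3 n).comp measurable_fst)

lemma not_borelColoringLE_escapeSet {F : Set (NN × NN)} {z : NN}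
    (hz : ∀ x, ∃ y, (join z x, y) ∈ F) (n : ℕ) :
    ¬ BorelColoringLE {t | (z, t) ∈ escapeSet F} n := by
  classical
  rintro ⟨c, hc, hcol⟩
  have hB : MeasurableSet {t : IncSeq | (z, t) ∈ escapeSet F} :=
    ((isClosed_escapeSet F).preimage (f := fun t : IncSeq => (z, t)) (by fun_prop)).measurableSet
  have hext : Measurable fun t : IncSeq =>
      if h : t ∈ {t | (z, t) ∈ escapeSet F} then (c ⟨t, h⟩).castSucc else Fin.last n :=
    Measurable.dite (f := fun t => (c t).castSucc) (Measurable.of_discrete.comp hc)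
      (g := fun _ => Fin.last n) measurable_const hB
  have hrc : Measurable fun p : NN × IncSeq => toInc (rankCode F z p.1 p.2.1) :=
    measurable_toInc.comp ((measurable_rankCode F z).comp
      (measurable_fst.prodMk (measurable_subtype_coe.comp measurable_snd)))
  obtain ⟨r, s, hrs, hJ⟩ := exists_coloring_fault _ (hext.comp hrc)
  have hs01 : s.1 0 ≤ s.1 1 := (s.2 one_pos).le
  have hO : ∀ s' : IncSeq, s'.1 0 ≤ s.1 1 → ∃ m, Escapes F m z r s'.1 := fun s' hs' =>
    exists_escapes_iff.2 fun q hq hle => by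
      obtain ⟨y, hy⟩ := exists_mem_fault_of_reduction hz hq
      exact hJ _ ((hle 0).trans hs') y hy
  have h1 := hO s hs01
  have h2 := hO (shift s) le_rfl
  have m1 : (⟨_, strictMono_rankCode F z r s.2⟩ : IncSeq) ∈ {t | (z, t) ∈ escapeSet F} :=
    rankCode_mem_escapeSet h1
  have m2 : (⟨_, strictMono_rankCode F z r (shift s).2⟩ : IncSeq) ∈ {t | (z, t) ∈ escapeSet F} :=
    rankCode_mem_escapeSet h2
  have hne : shift (⟨_, strictMono_rankCode F z r s.2⟩ : IncSeq) ≠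
      ⟨_, strictMono_rankCode F z r s.2⟩ := fun h =>
    (strictMono_rankCode F z r s.2 one_pos).ne' (congrFun (congrArg Subtype.val h) 0)
  refine hcol ⟨_, m1⟩ ⟨_, m2⟩
    ⟨fun h => hne ((shift_rankCode h2).trans h.symm), .inl (shift_rankCode h2)⟩ ?_
  · simp only [Function.comp_apply, toInc_of_strictMono (strictMono_rankCode F z r s.2),
      toInc_of_strictMono (strictMono_rankCode F z r (shift s).2)] at hrs
    rw [dif_pos m1, dif_pos m2] at hrs
    exact Fin.castSucc_injective n hrs

lemma mem_iff_borelColoringLE_escapeSet {F : Set (NN × NN)} (hF : IsClosed F) (z : NN) :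
    (∃ x, ∀ y, (join z x, y) ∉ F) ↔ ∃ n, BorelColoringLE {t | (z, t) ∈ escapeSet F} n := by
  refine ⟨fun ⟨x, hx⟩ => exists_borelColoringLE_escapeSet hF hx, fun ⟨n, hn⟩ => ?_⟩
  by_contra! h
  exact not_borelColoringLE_escapeSet h n hn

instance polishSpace_prod {X Y : Type*} [TopologicalSpace X] [TopologicalSpace Y] [PolishSpace X]
    [PolishSpace Y] : PolishSpace (X × Y) := inferInstance

instance : PolishSpace IncSeq := isClosed_strictMono.polishSpace

lemma exists_closed_of_analyticSet {Z : Type} [TopologicalSpace Z] [PolishSpace Z]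
    [MeasurableSpace Z] [BorelSpace Z] {D : Set (Z × NN)} (hD : AnalyticSet D) :
    ∃ φ : Z → NN, Measurable φ ∧ ∃ F : Set (NN × NN), IsClosed F ∧
      ∀ z x, (z, x) ∈ D ↔ ∃ y, (join (φ z) x, y) ∈ F := by
  obtain ⟨ψ, hψ, hinj⟩ := MeasurableSpace.measurable_injection_nat_bool_of_countablySeparated Z
  have hφ : Measurable fun z n => (ψ z n).toNat := measurable_pi_lambda _ fun n =>
    (Measurable.of_discrete (f := Bool.toNat)).comp ((measurable_pi_apply n).comp hψ)
  have hφi : Function.Injective fun z n => (ψ z n).toNat := fun z z' h =>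
    hinj (funext fun n => by
      have := congrFun h n
      cases h1 : ψ z n <;> cases h2 : ψ z' n <;> simp_all)
  refine ⟨_, hφ, ?_⟩
  have hA : AnalyticSet (Prod.map (fun z n => (ψ z n).toNat) id '' D) := by
    rw [AnalyticSet] at hD
    rcases hD with rfl | ⟨g, hg, rfl⟩
    · simpa using analyticSet_empty
    · rw [← range_comp, ← image_univ]
      exact MeasurableSet.univ.analyticSet_image ((hφ.prodMap measurable_id).comp hg.measurable)
  have hmem : ∀ z x, (z, x) ∈ D ↔
      ((fun n => (ψ z n).toNat), x) ∈ Prod.map (fun z n => (ψ z n).toNat) id '' D := by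
    intro z x
    rw [show ((fun n => (ψ z n).toNat), x) = Prod.map (fun z n => (ψ z n).toNat) id (z, x) from rfl,
      (hφi.prodMap Function.injective_id).mem_set_image]
  rw [AnalyticSet] at hA
  rcases hA with h | ⟨g, hg, h⟩
  · exact ⟨∅, isClosed_empty, fun z x => by simp [hmem, h]⟩
  · refine ⟨{p | p.1 = join (g p.2).1 (g p.2).2}, isClosed_eq continuous_fst
      (continuous_join (by fun_prop) (by fun_prop)), fun z x => ?_⟩
    rw [hmem, ← h]
    simp only [mem_ofPred_eq, join_inj, mem_range, Prod.ext_iff, eq_comm]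

lemma sigma12Hard_of_universal {U : Set (NN × IncSeq)}
    (hU : ∀ C : Set (NN × IncSeq), IsClosed C → ∃ f : NN → NN, Measurable f ∧
      ∀ p, {y : IncSeq | (f p, y) ∈ U} = {y : IncSeq | (p, y) ∈ C}) :
    Sigma12Hard {x : NN | ∃ n : ℕ, BorelColoringLE {y : IncSeq | (x, y) ∈ U} n} := by
  rintro Z _ _ _ _ A ⟨C, hC, rfl⟩
  obtain ⟨φ, hφ, F, hF, hCF⟩ := exists_closed_of_analyticSet hC
  obtain ⟨f, hf, hfU⟩ := hU _ (isClosed_escapeSet F)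
  refine ⟨_, hf.comp hφ, fun z => ?_⟩
  simp only [mem_ofPred_eq, Function.comp_apply, hfU, ← mem_iff_borelColoringLE_escapeSet hF]
  simp only [mem_image, Prod.exists, exists_and_right, exists_eq_right]
  refine exists_congr fun x => ?_
  rw [← not_exists, ← hCF, notMem_compl_iff]

lemma continuous_shift : Continuous shift :=
  Continuous.subtype_mk (f := fun (x : IncSeq) n => x.1 (n + 1))
    (continuous_pi fun n => (continuous_apply (n + 1)).comp continuous_subtype_val) _

/-- The pairs `(x, r)` such that `r` does not code a coloring of the graph on `U_x`. -/
def badCode (U : Set (NN × IncSeq)) : Set (NN × NN) :=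
  {p | (∃ y, Descends (lab p.2) y) ∨ ∃ s e e', (p.1, s) ∈ U ∧ (p.1, shift s) ∈ U ∧
    SameColor p.2 s.1 (shift s).1 e e'}

lemma analyticSet_badCode {U : Set (NN × IncSeq)} (hU : IsClosed U) : AnalyticSet (badCode U) := by
  have h1 : AnalyticSet {p : NN × NN | ∃ y, Descends (lab p.2) y} := by
    have : IsClosed {q : (NN × NN) × NN | Descends (lab q.1.2) q.2} :=
      isClosed_descends.preimage (f := fun q : (NN × NN) × NN => (q.1.2, q.2)) (by fun_prop)
    convert (IsClosed.analyticSet this).image_of_continuous continuous_fst using 1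
    ext; simp
  have h2 : AnalyticSet {p : NN × NN | ∃ s e e', (p.1, s) ∈ U ∧ (p.1, shift s) ∈ U ∧
      SameColor p.2 s.1 (shift s).1 e e'} := by
    have hs := continuous_shift
    have hs' : Continuous fun s : IncSeq => (shift s).1 := continuous_subtype_val.comp hs
    have : IsClosed {q : (NN × NN) × IncSeq × (List ℕ → ℕ) × (List ℕ → ℕ) |
        (q.1.1, q.2.1) ∈ U ∧ (q.1.1, shift q.2.1) ∈ U ∧
        SameColor q.1.2 q.2.1.1 (shift q.2.1).1 q.2.2.1 q.2.2.2} :=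
      .inter (hU.preimage (f := fun q : (NN × NN) × IncSeq × (List ℕ → ℕ) × (List ℕ → ℕ) =>
        (q.1.1, q.2.1)) (by fun_prop)) <|
      .inter (hU.preimage (f := fun q : (NN × NN) × IncSeq × (List ℕ → ℕ) × (List ℕ → ℕ) =>
        (q.1.1, shift q.2.1)) (by fun_prop)) <|
      isClosed_sameColor.preimage (f := fun q : (NN × NN) × IncSeq × (List ℕ → ℕ) ×
        (List ℕ → ℕ) => (q.1.2, q.2.1.1, (shift q.2.1).1, q.2.2.1, q.2.2.2)) <|
        (by fun_prop : Continuous _).prodMk <| (by fun_prop : Continuous _).prodMk <|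
        (hs'.comp (by fun_prop : Continuous _)).prodMk (by fun_prop)
    convert (IsClosed.analyticSet this).image_of_continuous continuous_fst using 1
    ext; simp
  rw [show badCode U = ⋃ b : Bool, cond b _ _ from (union_eq_iUnion ..)]
  exact .iUnion fun b => by cases b <;> assumption

lemma exists_borelColoringLE_iff {U : Set (NN × IncSeq)} (hU : IsClosed U) (x : NN) :
    (∃ n, BorelColoringLE {y : IncSeq | (x, y) ∈ U} n) ↔ ∃ r, (x, r) ∉ badCode U := by
  have hUx : IsClosed {y : IncSeq | (x, y) ∈ U} :=
    hU.preimage (f := fun y : IncSeq => (x, y)) (by fun_prop)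
  constructor
  · rintro ⟨n, c, hc, hcol⟩
    have hP : ∀ i, MeasurableSet (Subtype.val '' (Subtype.val '' (c ⁻¹' {i})) : Set NN) := fun i =>
      .subtype_image isClosed_strictMono.measurableSet
        (.subtype_image hUx.measurableSet (hc (measurableSet_singleton i)))
    obtain ⟨r, hr, hwf, E, hE, hEP⟩ := exists_code hP
    refine ⟨r, ?_⟩
    have hmem : ∀ (t : {y : IncSeq | (x, y) ∈ U}) (i : Fin n), t.1.1 ∈ E [(i : ℕ)] ↔ c t = i := by
      intro t i
      rw [hEP, Subtype.val_injective.mem_set_image, Subtype.val_injective.mem_set_image]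
      rfl
    rintro (h | ⟨s, e, e', h1, h2, h3⟩)
    · exact wellFounded_codeRel_iff.1 hwf h
    · have h := (sameColor_iff hwf hE).1 ⟨e, e', h3⟩ (c ⟨s, h1⟩) (hr ▸ (c ⟨s, h1⟩).2)
      have hne : s ≠ shift s := fun h => (s.2 one_pos).ne (congrFun (congrArg Subtype.val h) 0)
      exact hcol ⟨s, h1⟩ ⟨shift s, h2⟩ ⟨hne, .inl rfl⟩
        ((hmem ⟨shift s, h2⟩ _).1 (h.1 ((hmem ⟨s, h1⟩ _).2 rfl))).symm
  · rintro ⟨r, hr⟩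
    simp only [badCode, mem_ofPred_eq, not_or] at hr
    have hwf := wellFounded_codeRel_iff.2 hr.1
    obtain ⟨E, hE, hEm⟩ := exists_isValuation hwf
    refine borelColoringLE_of_finite (α := Fin (r 0) → Prop)
      (fun t i => t.1.1 ∈ E [(i : ℕ)]) (measurable_pi_lambda _ fun i => ?_) ?_
    · exact measurableSet_setOfPred.1 (measurable_subtype_coe.comp measurable_subtype_coe (hEm _))
    · rintro ⟨s, hs⟩ ⟨_, hs'⟩ rfl heq
      obtain ⟨e, e', h⟩ := (sameColor_iff (v := s.1) (v' := (shift s).1) hwf hE).2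
        fun i hi => (congrFun heq ⟨i, hi⟩).to_iff
      exact hr.2 ⟨s, e, e', hs, hs', h⟩

/-- Let `U` be a good universal closed subset of `ℕ^ℕ × [ℕ]^ℕ`: a closed set such that for
every Polish space `P` and every closed `C ⊆ P × [ℕ]^ℕ` there is a Borel map `f : P → ℕ^ℕ`
with `U_{f p} = C_p` for all `p`.  Then `{x ∈ ℕ^ℕ : χ_B(G_S|_{U_x}) < ℵ₀}` is
`Σ¹₂`-complete. -/
theorem universal_closed_finiteBorelChromatic_Sigma12_complete
    (U : Set (NN × IncSeq)) (hUclosed : IsClosed U)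
    (hUuniv : ∀ (P : Type) [TopologicalSpace P] [PolishSpace P] [MeasurableSpace P]
      [BorelSpace P] (C : Set (P × IncSeq)), IsClosed C →
      ∃ f : P → NN, Measurable f ∧
        ∀ p : P, {y : IncSeq | (f p, y) ∈ U} = {y : IncSeq | (p, y) ∈ C}) :
    Sigma12Hard {x : NN | ∃ n : ℕ, BorelColoringLE {y : IncSeq | (x, y) ∈ U} n} ∧
    IsSigma12 {x : NN | ∃ n : ℕ, BorelColoringLE {y : IncSeq | (x, y) ∈ U} n} := by
  refine ⟨sigma12Hard_of_universal (hUuniv NN), (badCode U)ᶜ, ?_, ?_⟩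
  · rw [IsCoanalytic, compl_compl]
    exact analyticSet_badCode hUclosed
  · ext x
    simp [exists_borelColoringLE_iff hUclosed]
end
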